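/- There exists a constant C > 0 such that Q[ν] ≥ C‖ν‖² for every smooth compactly supported ν : ℝ³ → ℝ satisfying the orthogonality conditions ⟨ν, U⟩_{H¹} = 0 and ⟨ν, ∂U/∂x_j⟩_{H¹} = 0 for j = 1, 2, 3, where Q[ν] = ∫_{ℝ³} ( |∇ν|² + ν² − pU^{p−1}ν² ) dx. -/

import Mathlib

open MeasureTheory Filter Real Topology
open scoped RealInnerProductSpace

noncomputable section

abbrev E3 := EuclideanSpace ℝ (Fin 3)

/-- Partial derivative in the `i`-th coordinate direction. -/
def pd (f : E3 → ℝ) (i : Fin 3) (x : E3) : ℝ := fderiv ℝ f x (EuclideanSpace.single i 1)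

/-- The Laplacian, as the sum of the second partial derivatives. -/
def lap (u : E3 → ℝ) (x : E3) : ℝ := ∑ i : Fin 3, pd (pd u i) i x

/-- The H¹ inner product `⟨u,v⟩ = ∫ (∇u·∇v + uv)`. -/
def h1i (u v : E3 → ℝ) : ℝ := ∫ x : E3, (⟪gradient u x, gradient v x⟫ + u x * v x)

section Calculus

lemma le_of_hasDerivAt_nonneg {f f' : ℝ → ℝ} {a b : ℝ} (hab : a ≤ b)
    (hc : ContinuousOn f (Set.Icc a b)) (hd : ∀ x ∈ Set.Ioo a b, HasDerivAt f (f' x) x)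
    (hn : ∀ x ∈ Set.Ioo a b, 0 ≤ f' x) : f a ≤ f b := by
  rcases hab.eq_or_lt with rfl | hlt
  · exact le_rfl
  obtain ⟨c, hcm, hceq⟩ := exists_hasDerivAt_eq_slope f f' hlt hc hd
  have h := hn c hcm
  rw [hceq, le_div_iff₀ (sub_pos.2 hlt)] at h
  linarith

lemma lt_of_hasDerivAt_pos {f f' : ℝ → ℝ} {a b : ℝ} (hab : a < b)
    (hc : ContinuousOn f (Set.Icc a b)) (hd : ∀ x ∈ Set.Ioo a b, HasDerivAt f (f' x) x)
    (hn : ∀ x ∈ Set.Ioo a b, 0 < f' x) : f a < f b := by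
  obtain ⟨c, hcm, hceq⟩ := exists_hasDerivAt_eq_slope f f' hab hc hd
  have h := hn c hcm
  rw [hceq, lt_div_iff₀ (sub_pos.2 hab)] at h
  linarith

lemma le_of_hasDerivAt_nonpos {f f' : ℝ → ℝ} {a b : ℝ} (hab : a ≤ b)
    (hc : ContinuousOn f (Set.Icc a b)) (hd : ∀ x ∈ Set.Ioo a b, HasDerivAt f (f' x) x)
    (hn : ∀ x ∈ Set.Ioo a b, f' x ≤ 0) : f b ≤ f a := by
  have := le_of_hasDerivAt_nonneg (f := fun x => -f x) (f' := fun x => -f' x) hab hc.neg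
    (fun x hx => (hd x hx).neg) (fun x hx => by simpa using hn x hx)
  simpa using this

lemma lt_of_hasDerivAt_neg {f f' : ℝ → ℝ} {a b : ℝ} (hab : a < b)
    (hc : ContinuousOn f (Set.Icc a b)) (hd : ∀ x ∈ Set.Ioo a b, HasDerivAt f (f' x) x)
    (hn : ∀ x ∈ Set.Ioo a b, f' x < 0) : f b < f a := by
  have := lt_of_hasDerivAt_pos (f := fun x => -f x) (f' := fun x => -f' x) hab hc.neg
    (fun x hx => (hd x hx).neg) (fun x hx => by simpa using hn x hx)
  simpa using this

lemma HasDerivAt.eventually_right_lt {f : ℝ → ℝ} {x d : ℝ} (h : HasDerivAt f d x) (hd : d < 0) :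
    ∀ᶠ y in 𝓝[>] x, f y < f x := by
  have h1 := (h.tendsto_slope.mono_left (nhdsWithin_mono x (s := Set.Ioi x)
    (fun y hy => ne_of_gt hy))).eventually (gt_mem_nhds hd)
  filter_upwards [h1, self_mem_nhdsWithin] with y hy hxy
  rw [slope_def_field, div_lt_iff₀ (sub_pos.2 hxy)] at hy
  linarith

lemma HasDerivAt.eventually_left_gt {f : ℝ → ℝ} {x d : ℝ} (h : HasDerivAt f d x) (hd : d < 0) :
    ∀ᶠ y in 𝓝[<] x, f x < f y := by
  have h1 := (h.tendsto_slope.mono_left (nhdsWithin_mono x (s := Set.Iio x)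
    (fun y hy => ne_of_lt hy))).eventually (gt_mem_nhds hd)
  filter_upwards [h1, self_mem_nhdsWithin] with y hy hxy
  rw [slope_def_field, div_lt_iff_of_neg (sub_neg.2 hxy)] at hy
  linarith

/-- A continuous function with `f a < 0` and `f b ≥ 0` has a first zero in `(a, b]`. -/
lemma exists_first_zero {f : ℝ → ℝ} {a b : ℝ} (hab : a ≤ b) (hf : ContinuousOn f (Set.Icc a b))
    (ha : f a < 0) (hb : 0 ≤ f b) :
    ∃ c ∈ Set.Ioc a b, f c = 0 ∧ ∀ x ∈ Set.Ico a c, f x < 0 := by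
  have hcomp : IsCompact (Set.Icc a b ∩ f ⁻¹' Set.Ici 0) :=
    isCompact_Icc.of_isClosed_subset (hf.preimage_isClosed_of_isClosed isClosed_Icc isClosed_Ici)
      Set.inter_subset_left
  obtain ⟨c, ⟨hc1, hc2⟩, hmin⟩ := hcomp.exists_isLeast ⟨b, ⟨hab, le_rfl⟩, hb⟩
  have hlt : ∀ x ∈ Set.Ico a c, f x < 0 := by
    intro x hx
    by_contra hcon
    have := hmin ⟨⟨hx.1, hx.2.le.trans hc1.2⟩, not_lt.1 hcon⟩
    exact absurd hx.2 (not_lt.2 this)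
  have hac : a < c := by
    rcases hc1.1.eq_or_lt with h | h
    · subst h; exact absurd ha (not_lt.2 hc2)
    · exact h
  refine ⟨c, ⟨hac, hc1.2⟩, le_antisymm ?_ hc2, hlt⟩
  have hcw : ContinuousWithinAt f (Set.Ico a c) c :=
    (hf c hc1).mono (fun x hx => ⟨hx.1, hx.2.le.trans hc1.2⟩)
  have : (𝓝[Set.Ico a c] c).NeBot := by
    rw [← mem_closure_iff_nhdsWithin_neBot, closure_Ico hac.ne]
    exact ⟨hac.le, le_rfl⟩
  exact le_of_tendsto hcw (eventually_nhdsWithin_of_forall fun x hx => (hlt x hx).le)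

end Calculus

/-- A positive decaying `C²` radial profile solving `u'' + 2 u' / r = u - u ^ p`. -/
structure Profile (p : ℝ) (u u' u'' : ℝ → ℝ) : Prop where
  one_lt : 1 < p
  lt_five : p < 5
  hasDeriv : ∀ r, HasDerivAt u (u' r) r
  hasDeriv' : ∀ r, HasDerivAt u' (u'' r) r
  cont'' : Continuous u''
  pos : ∀ r, 0 < u r
  deriv_zero : u' 0 = 0
  ode : ∀ r, 0 < r → r * u'' r + 2 * u' r = r * (u r - u r ^ p)
  lim : Tendsto u atTop (𝓝 0)

/-- The potential `u ^ (p - 1)`. -/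
def pot (p : ℝ) (u : ℝ → ℝ) (r : ℝ) : ℝ := u r ^ (p - 1)

namespace Profile

variable {p : ℝ} {u u' u'' : ℝ → ℝ}

lemma cont (h : Profile p u u' u'') : Continuous u :=
  continuous_iff_continuousAt.2 fun r => (h.hasDeriv r).continuousAt

lemma cont' (h : Profile p u u' u'') : Continuous u' :=
  continuous_iff_continuousAt.2 fun r => (h.hasDeriv' r).continuousAt

lemma pot_cont (h : Profile p u u' u'') : Continuous (pot p u) :=
  h.cont.rpow_const fun r => Or.inl (h.pos r).ne'

lemma pot_pos (h : Profile p u u' u'') (r : ℝ) : 0 < pot p u r := rpow_pos_of_pos (h.pos r) _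

lemma rpow_eq (h : Profile p u u' u'') (r : ℝ) : u r ^ p = pot p u r * u r := by
  rw [pot, ← rpow_add_one (h.pos r).ne', sub_add_cancel]

lemma hasDeriv_pot (h : Profile p u u' u'') (r : ℝ) :
    HasDerivAt (pot p u) ((p - 1) * pot p u r * u' r / u r) r := by
  refine ((h.hasDeriv r).rpow_const (p := p - 1) (Or.inl (h.pos r).ne')).congr_deriv ?_
  have h1 : pot p u r = u r ^ (p - 1 - 1) * u r := by
    rw [pot, ← rpow_add_one (h.pos r).ne', sub_add_cancel]
  rw [h1]
  field_simp [(h.pos r).ne']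

lemma ode' (h : Profile p u u' u'') {r : ℝ} (hr : 0 ≤ r) :
    r * u'' r + 2 * u' r = r * ((1 - pot p u r) * u r) := by
  rcases hr.eq_or_lt with rfl | hr
  · simp [h.deriv_zero]
  · rw [h.ode r hr, h.rpow_eq]; ring

lemma tendsto_pot (h : Profile p u u' u'') : Tendsto (pot p u) atTop (𝓝 0) := by
  have := h.lim.rpow_const (p := p - 1) (Or.inr (by linarith [h.one_lt]))
  rwa [zero_rpow (by linarith [h.one_lt])] at this

/-- `w = r u` solves `w'' = (1 - u^(p-1)) w`. -/
lemma hasDeriv_w (h : Profile p u u' u'') (r : ℝ) :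
    HasDerivAt (fun r => r * u r) (u r + r * u' r) r := by
  exact ((hasDerivAt_id r).mul (h.hasDeriv r)).congr_deriv (by simp)

lemma hasDeriv_w' (h : Profile p u u' u'') {r : ℝ} (hr : 0 ≤ r) :
    HasDerivAt (fun r => u r + r * u' r) ((1 - pot p u r) * (r * u r)) r := by
  refine ((h.hasDeriv r).add ((hasDerivAt_id r).mul (h.hasDeriv' r))).congr_deriv ?_
  have := h.ode' hr
  simp only [id]
  linarith

lemma exists_tail (h : Profile p u u' u'') :
    ∃ R, 1 ≤ R ∧ ∀ r, R ≤ r → u r + r * u' r ≤ -(1 / 2) * (r * u r) := by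
  have h1 : ∀ᶠ r in atTop, pot p u r < 3 / 4 := h.tendsto_pot.eventually (gt_mem_nhds (by norm_num))
  have h2 : ∀ᶠ r in atTop, u r < 1 := h.lim.eventually (gt_mem_nhds (by norm_num))
  obtain ⟨R, hR⟩ := eventually_atTop.1 (h1.and h2)
  refine ⟨max R 1, le_max_right _ _, fun r1 hr1 => ?_⟩
  by_contra! hcon
  have hR1 : R ≤ r1 := (le_max_left _ _).trans hr1
  have hr1' : 1 ≤ r1 := (le_max_right _ _).trans hr1
  set b := u r1 + r1 * u' r1 + 1 / 2 * (r1 * u r1) with hb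
  have hbpos : 0 < b := by linarith
  -- `w' + w / 2` grows at least like `exp (r / 2)`
  have hgrow : ∀ r, r1 ≤ r → b * exp (-r1 / 2) ≤
      exp (-r / 2) * (u r + r * u' r + 1 / 2 * (r * u r)) := by
    intro r hr
    have hd : ∀ x ∈ Set.Icc r1 r, HasDerivAt
        (fun r => exp (-r / 2) * (u r + r * u' r + 1 / 2 * (r * u r)))
        (exp (-x / 2) * ((3 / 4 - pot p u x) * (x * u x))) x := by
      intro x hx
      have e1 : HasDerivAt (fun r : ℝ => exp (-r / 2)) (exp (-x / 2) * (-1 / 2)) x := by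
        have := ((hasDerivAt_id x).neg.div_const 2).exp
        simpa using this
      refine (e1.mul ((h.hasDeriv_w' (r := x) (by linarith [hx.1])).add
        ((h.hasDeriv_w x).const_mul (1 / 2)))).congr_deriv ?_
      simp only [Pi.add_apply]
      ring
    have := le_of_hasDerivAt_nonneg hr (fun x hx => (hd x hx).continuousAt.continuousWithinAt)
      (fun x hx => hd x ⟨hx.1.le, hx.2.le⟩) (fun x hx => by
        have := (hR x (hR1.trans hx.1.le)).1
        have hxp : 0 < x := by linarith [hx.1]
        have := h.pos x
        have : 0 ≤ 3 / 4 - pot p u x := by linarith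
        positivity)
    rw [mul_comm]; exact this
  have hgrow2 : ∀ r, r1 ≤ r → b * exp (-r1 / 2) * (exp r - exp r1) ≤ exp (r / 2) * (r * u r) := by
    intro r hr
    have hd : ∀ x ∈ Set.Icc r1 r, HasDerivAt
        (fun r => exp (r / 2) * (r * u r) - b * exp (-r1 / 2) * (exp r - exp r1))
        (exp (x / 2) * (u x + x * u' x + 1 / 2 * (x * u x)) - b * exp (-r1 / 2) * exp x) x := by
      intro x hx
      have e1 : HasDerivAt (fun r : ℝ => exp (r / 2)) (exp (x / 2) * (1 / 2)) x := by
        have := ((hasDerivAt_id x).div_const 2).exp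
        simpa using this
      refine ((e1.mul (h.hasDeriv_w x)).sub
        (((hasDerivAt_exp x).sub_const (exp r1)).const_mul (b * exp (-r1 / 2)))).congr_deriv ?_
      ring
    have := le_of_hasDerivAt_nonneg hr (fun x hx => (hd x hx).continuousAt.continuousWithinAt)
      (fun x hx => hd x ⟨hx.1.le, hx.2.le⟩) (fun x hx => by
        have h3 := mul_le_mul_of_nonneg_left (hgrow x hx.1.le) (exp_pos x).le
        have h4 : exp x * exp (-x / 2) = exp (x / 2) := by rw [← exp_add]; ring_nf
        rw [← mul_assoc (exp x) (exp (-x / 2)), h4] at h3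
        linarith)
    have h4 : 0 ≤ exp (r1 / 2) * (r1 * u r1) := by have := h.pos r1; positivity
    simp only [sub_self, mul_zero, sub_zero] at this
    linarith
  have hlim : Tendsto (fun r : ℝ => exp (-r / 2) * (b * exp (-r1 / 2) * exp r1) +
      exp (-r / 2) * r) atTop (𝓝 0) := by
    have e1 : Tendsto (fun r : ℝ => exp (-r / 2)) atTop (𝓝 0) := by
      refine tendsto_exp_atBot.comp ?_
      exact (tendsto_neg_atTop_atBot).atBot_div_const (by norm_num)
    have e2 : Tendsto (fun r : ℝ => exp (-r / 2) * r) atTop (𝓝 0) := by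
      have := ((Real.tendsto_pow_mul_exp_neg_atTop_nhds_zero 1).comp
        (tendsto_id.atTop_div_const (show (0 : ℝ) < 2 by norm_num))).const_mul 2
      simp only [mul_zero] at this
      refine this.congr fun r => ?_
      simp only [Function.comp, id, pow_one]
      rw [neg_div]; ring
    simpa using (e1.mul_const (b * exp (-r1 / 2) * exp r1)).add e2
  have hpos : 0 < b * exp (-r1 / 2) := by positivity
  obtain ⟨r, hr, hr2⟩ := ((eventually_ge_atTop (max r1 0)).and
    (hlim.eventually (gt_mem_nhds hpos))).exists
  have hrr1 : r1 ≤ r := (le_max_left _ _).trans hr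
  have h5 := hgrow2 r hrr1
  have h6 : r * u r ≤ r := by
    have := (hR r (hR1.trans hrr1)).2
    have : 0 ≤ r := by linarith
    nlinarith
  have h7 : b * exp (-r1 / 2) * exp r < b * exp (-r1 / 2) * exp r := by
    calc b * exp (-r1 / 2) * exp r ≤ b * exp (-r1 / 2) * exp r1 + exp (r / 2) * (r * u r) := by
          linarith
      _ ≤ b * exp (-r1 / 2) * exp r1 + exp (r / 2) * r := by gcongr
      _ ≤ exp (r / 2) * (b * exp (-r1 / 2) * exp r1) + exp (r / 2) * r := by
          have : 1 ≤ exp (r / 2) := one_le_exp (by linarith)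
          have : 0 ≤ b * exp (-r1 / 2) * exp r1 := by positivity
          nlinarith
      _ = (exp (-r / 2) * (b * exp (-r1 / 2) * exp r1) + exp (-r / 2) * r) * exp r := by
          have : exp (r / 2) = exp (-r / 2) * exp r := by rw [← exp_add]; ring_nf
          rw [this]; ring
      _ < _ := by gcongr
  exact lt_irrefl _ h7

/-- Exponential decay of the profile and of its derivative. -/
lemma exists_decay (h : Profile p u u' u'') : ∃ C R, 0 < C ∧ 1 ≤ R ∧ ∀ r, R ≤ r →
    u r ≤ C * exp (-r / 2) ∧ |u' r| ≤ C * exp (-r / 2) := by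
  obtain ⟨R0, hR0, htail⟩ := h.exists_tail
  obtain ⟨R1, hR1⟩ := eventually_atTop.1 (h.tendsto_pot.eventually (gt_mem_nhds one_pos))
  set R := max R0 R1 with hRdef
  have hRR0 : R0 ≤ R := le_max_left _ _
  have hRR1 : R1 ≤ R := le_max_right _ _
  set C := exp (R / 2) * (R * u R)
  have hC : 0 < C := by have := h.pos R; have : 0 < R := by linarith
                        positivity
  have hw : ∀ r, R ≤ r → r * u r ≤ C * exp (-r / 2) := by
    intro r hr
    have hd : ∀ x ∈ Set.Icc R r, HasDerivAt (fun r => exp (r / 2) * (r * u r))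
        (exp (x / 2) * (u x + x * u' x + 1 / 2 * (x * u x))) x := by
      intro x hx
      have e1 : HasDerivAt (fun r : ℝ => exp (r / 2)) (exp (x / 2) * (1 / 2)) x := by
        have := ((hasDerivAt_id x).div_const 2).exp
        simpa using this
      refine (e1.mul (h.hasDeriv_w x)).congr_deriv ?_
      ring
    have := le_of_hasDerivAt_nonpos hr (fun x hx => (hd x hx).continuousAt.continuousWithinAt)
      (fun x hx => hd x ⟨hx.1.le, hx.2.le⟩) (fun x hx => by
        have := htail x (hRR0.trans hx.1.le)
        have := exp_pos (x / 2)
        exact mul_nonpos_of_nonneg_of_nonpos this.le (by linarith))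
    calc r * u r = exp (-r / 2) * (exp (r / 2) * (r * u r)) := by
          rw [← mul_assoc, ← exp_add]; ring_nf; simp
      _ ≤ exp (-r / 2) * C := by gcongr
      _ = _ := mul_comm _ _
  have hu : ∀ r, R ≤ r → u r ≤ C * exp (-r / 2) := fun r hr => by
    have := hw r hr
    have := h.pos r
    nlinarith
  have hw' : ∀ r, R + 1 ≤ r → -(u r + r * u' r) ≤ C * exp (1 / 2) * exp (-r / 2) := by
    intro r hr
    obtain ⟨c, hc, hceq⟩ := exists_hasDerivAt_eq_slope (fun r => r * u r) (fun r => u r + r * u' r)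
      (show r - 1 < r by linarith) (fun x _ => (h.hasDeriv_w x).continuousAt.continuousWithinAt)
      (fun x _ => h.hasDeriv_w x)
    have hmono : u c + c * u' c ≤ u r + r * u' r := by
      refine le_of_hasDerivAt_nonneg (f := fun r => u r + r * u' r) hc.2.le
        (fun x hx => (h.hasDeriv_w' (r := x) (by linarith [hc.1,
          hx.1])).continuousAt.continuousWithinAt)
        (fun x hx => h.hasDeriv_w' (r := x) (by linarith [hc.1, hx.1])) (fun x hx => ?_)
      have := hR1 x (by linarith [hc.1, hx.1])
      have := h.pos x
      have : 0 ≤ 1 - pot p u x := by linarith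
      have : 0 < x := by linarith [hc.1, hx.1]
      positivity
    rw [sub_sub_cancel, div_one] at hceq
    have h1 := hw (r - 1) (by linarith)
    have h2 : C * exp (-(r - 1) / 2) = C * exp (1 / 2) * exp (-r / 2) := by
      have : exp (-(r - 1) / 2) = exp (1 / 2) * exp (-r / 2) := by rw [← exp_add]; ring_nf
      rw [this]; ring
    have h3 : 0 ≤ r * u r := by have := h.pos r; have : 0 < r := by linarith
                                positivity
    rw [h2] at h1
    linarith
  refine ⟨C * exp (1 / 2) + C, R + 1, by positivity, by linarith, fun r hr => ⟨?_, ?_⟩⟩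
  · have := hu r (by linarith)
    have : 0 ≤ C * exp (1 / 2) * exp (-r / 2) := by positivity
    linarith
  · have h1 := hw' r hr
    have h2 := htail r (by linarith)
    have h3 := hu r (by linarith)
    have h4 := h.pos r
    have hr0 : 0 < r := by linarith
    have h5 : 0 ≤ C * exp (-r / 2) := by positivity
    have h6 : u' r ≤ 0 := by nlinarith
    rw [abs_of_nonpos h6]
    have h7 : -u' r ≤ r * (-u' r) := by nlinarith
    linarith

lemma tendsto_pow_mul (h : Profile p u u' u'') (n : ℕ) :
    Tendsto (fun r => r ^ n * u r) atTop (𝓝 0) ∧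
    Tendsto (fun r => r ^ n * u' r) atTop (𝓝 0) := by
  obtain ⟨C, R, hC, hR, hd⟩ := h.exists_decay
  have e2 : Tendsto (fun r : ℝ => C * (r ^ n * exp (-r / 2))) atTop (𝓝 0) := by
    have := (((Real.tendsto_pow_mul_exp_neg_atTop_nhds_zero n).comp
      (tendsto_id.atTop_div_const (show (0 : ℝ) < 2 by norm_num))).const_mul (2 ^ n)).const_mul C
    simp only [mul_zero] at this
    refine this.congr fun r => ?_
    simp only [Function.comp, id]
    rw [neg_div, div_pow]; field_simp
  constructor
  · refine squeeze_zero_norm' ?_ e2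
    filter_upwards [eventually_ge_atTop R] with r hr
    have hr0 : 0 ≤ r := by linarith
    rw [norm_mul, norm_of_nonneg (h.pos r).le, norm_of_nonneg (pow_nonneg hr0 n)]
    have := mul_le_mul_of_nonneg_left (hd r hr).1 (pow_nonneg hr0 n)
    linarith
  · refine squeeze_zero_norm' ?_ e2
    filter_upwards [eventually_ge_atTop R] with r hr
    have hr0 : 0 ≤ r := by linarith
    rw [norm_mul, norm_of_nonneg (pow_nonneg hr0 n), Real.norm_eq_abs]
    have := mul_le_mul_of_nonneg_left (hd r hr).2 (pow_nonneg hr0 n)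
    linarith

lemma tendsto_sq_mul_pot (h : Profile p u u' u'') :
    Tendsto (fun r => r ^ 2 * pot p u r) atTop (𝓝 0) := by
  have hp : 0 < p - 1 := by linarith [h.one_lt]
  obtain ⟨n, hn⟩ := exists_nat_gt (2 / (p - 1))
  have h1 := ((h.tendsto_pow_mul n).1.rpow_const (p := p - 1) (Or.inr hp.le))
  rw [zero_rpow hp.ne'] at h1
  refine squeeze_zero_norm' ?_ h1
  filter_upwards [eventually_ge_atTop 1] with r hr
  have hr0 : 0 ≤ r := by linarith
  rw [norm_of_nonneg (mul_nonneg (sq_nonneg r) (h.pot_pos r).le),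
    mul_rpow (pow_nonneg hr0 n) (h.pos r).le, pot]
  refine mul_le_mul_of_nonneg_right ?_ (h.pot_pos r).le
  rw [← rpow_natCast, ← rpow_natCast, ← rpow_mul hr0]
  refine rpow_le_rpow_of_exponent_le hr ?_
  rw [div_lt_iff₀ hp] at hn
  exact_mod_cast hn.le

/-- At a critical point the potential exceeds one. -/
lemma one_lt_pot_of_critical (h : Profile p u u' u'') {r : ℝ} (hr : 0 ≤ r) (hcrit : u' r = 0) :
    1 < pot p u r := by
  have hp := h.one_lt
  set E : ℝ → ℝ := fun r => u' r ^ 2 / 2 - u r ^ 2 / 2 + pot p u r * u r ^ 2 / (p + 1) with hE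
  have hder : ∀ x, 0 < x → HasDerivAt E (-2 * u' x ^ 2 / x) x := by
    intro x hx
    have e1 := (((h.hasDeriv' x).pow 2).div_const 2).sub (((h.hasDeriv x).pow 2).div_const 2)
    have e2 := ((h.hasDeriv_pot x).mul ((h.hasDeriv x).pow 2)).div_const (p + 1)
    refine (e1.add e2).congr_deriv ?_
    have h1 := h.ode' hx.le
    have h2 : u'' x = (1 - pot p u x) * u x - 2 * u' x / x := by field_simp; linarith
    have h3 := (h.pos x).ne'
    have h4 : p + 1 ≠ 0 := by linarith
    rw [h2]
    simp only [Nat.cast_ofNat, Pi.pow_apply]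
    field_simp
    ring
  have hcont : Continuous E := by
    have := h.cont; have := h.cont'; have := h.pot_cont
    fun_prop
  have hlim : Tendsto E atTop (𝓝 0) := by
    have h1 : Tendsto u' atTop (𝓝 0) := by simpa using (h.tendsto_pow_mul 0).2
    have := (((h1.pow 2).div_const 2).sub ((h.lim.pow 2).div_const 2)).add
      ((h.tendsto_pot.mul (h.lim.pow 2)).div_const (p + 1))
    simpa using this
  have hnn : 0 ≤ E r := by
    refine le_of_tendsto hlim ?_
    filter_upwards [eventually_ge_atTop r] with s hs
    refine le_of_hasDerivAt_nonpos hs hcont.continuousOn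
      (fun x hx => hder x (hr.trans_lt hx.1)) (fun x hx => ?_)
    have : 0 < x := hr.trans_lt hx.1
    have := sq_nonneg (u' x)
    exact div_nonpos_of_nonpos_of_nonneg (by linarith) (by linarith)
  simp only [hE, hcrit] at hnn
  have hu2 : 0 < u r ^ 2 := pow_pos (h.pos r) 2
  have h5 : (p + 1) * (u r ^ 2 / 2) ≤ pot p u r * u r ^ 2 := by
    have : u r ^ 2 / 2 ≤ pot p u r * u r ^ 2 / (p + 1) := by linarith
    rw [le_div_iff₀ (by linarith)] at this
    linarith
  have : (p + 1) / 2 ≤ pot p u r := le_of_mul_le_mul_right (by linarith) hu2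
  linarith

lemma tendsto_deriv_div (h : Profile p u u' u'') :
    Tendsto (fun r => u' r / r) (𝓝[>] 0) (𝓝 (u'' 0)) := by
  have := ((h.hasDeriv' 0).tendsto_slope).mono_left (nhdsWithin_mono 0 (s := Set.Ioi 0)
    (fun y hy => ne_of_gt hy))
  refine this.congr fun r => ?_
  rw [slope_def_field, h.deriv_zero]; simp

lemma second_deriv_zero (h : Profile p u u' u'') : u'' 0 < 0 := by
  have h1 : Tendsto (fun r => u'' r + 2 * (u' r / r)) (𝓝[>] 0) (𝓝 (u'' 0 + 2 * u'' 0)) :=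
    (h.cont''.tendsto 0 |>.mono_left nhdsWithin_le_nhds).add (h.tendsto_deriv_div.const_mul 2)
  have h2 : Tendsto (fun r => (1 - pot p u r) * u r) (𝓝[>] 0) (𝓝 ((1 - pot p u 0) * u 0)) :=
    ((continuous_const.sub h.pot_cont).mul h.cont).tendsto 0 |>.mono_left nhdsWithin_le_nhds
  have h3 : u'' 0 + 2 * u'' 0 = (1 - pot p u 0) * u 0 := by
    refine tendsto_nhds_unique (h1.congr' ?_) h2
    filter_upwards [self_mem_nhdsWithin] with r hr
    have hr' : (0 : ℝ) < r := hr
    have := h.ode' hr'.le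
    field_simp
    linarith
  have h4 := h.one_lt_pot_of_critical le_rfl h.deriv_zero
  have := h.pos 0
  nlinarith

lemma deriv_neg (h : Profile p u u' u'') {r : ℝ} (hr : 0 < r) : u' r < 0 := by
  by_contra! hcon
  obtain ⟨s, hs1, hs2⟩ := (((h.hasDeriv' 0).eventually_right_lt h.second_deriv_zero).and
    (Ioo_mem_nhdsGT hr)).exists
  rw [h.deriv_zero] at hs1
  obtain ⟨c, hc, hc0, hlt⟩ := exists_first_zero hs2.2.le h.cont'.continuousOn hs1 hcon
  have hc' : 0 < c := hs2.1.trans hc.1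
  have h1 := h.one_lt_pot_of_critical hc'.le hc0
  have h2 := h.ode' hc'.le
  have h3 : u'' c < 0 := by
    have := h.pos c
    have h4 : c * u'' c = c * ((1 - pot p u c) * u c) := by rw [← h2, hc0]; ring
    rw [mul_left_cancel₀ hc'.ne' h4]
    nlinarith
  obtain ⟨y, hy1, hy2⟩ := (((h.hasDeriv' c).eventually_left_gt h3).and
    (Ioo_mem_nhdsLT hc.1)).exists
  rw [hc0] at hy1
  exact lt_asymm hy1 (hlt y ⟨hy2.1.le, hy2.2⟩)

end Profile

section LinearODE

lemma exp_integral_le {l r : ℝ} (hl : 0 < l) :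
    ∫ s in (0 : ℝ)..r, exp (l * s) ≤ exp (l * r) / l := by
  have : ∀ x ∈ Set.uIcc 0 r, HasDerivAt (fun s => exp (l * s) / l) (exp (l * x)) x := by
    intro x _
    have := (((hasDerivAt_id x).const_mul l).exp).div_const l
    refine this.congr_deriv ?_
    simp only [id, mul_one]
    field_simp
  rw [intervalIntegral.integral_eq_sub_of_hasDerivAt this
    ((by fun_prop : Continuous fun s : ℝ => exp (l * s)).intervalIntegrable _ _)]
  have : 0 < exp (l * 0) / l := by positivity
  linarith

/-- Global forward existence for `z'' = Q z` with `Q` continuous and bounded on `[0, ∞)`. -/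
lemma exists_linear_ode {Q : ℝ → ℝ} {M : ℝ} (hQ : Continuous Q) (hM : ∀ r, 0 ≤ r → |Q r| ≤ M)
    (a b : ℝ) : ∃ z z' : ℝ → ℝ, z 0 = a ∧ z' 0 = b ∧ (∀ r, HasDerivAt z (z' r) r) ∧
      Continuous z' ∧ ∀ r, 0 ≤ r → HasDerivAt z' (Q r * z r) r := by
  set K : ℝ := max 1 M with hK
  have hK1 : 1 ≤ K := le_max_left _ _
  set l : ℝ := 2 * K with hl
  have hlpos : 0 < l := by linarith
  set A : ℝ → ℝ × ℝ → ℝ × ℝ := fun s x => (x.2, Q s * x.1) with hA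
  have hAsub : ∀ s x y, A s x - A s y = A s (x - y) := by
    intro s x y; ext <;> simp [hA]; ring
  have hAsmul : ∀ s (c : ℝ) x, A s (c • x) = c • A s x := by
    intro s c x; ext <;> simp [hA]; ring
  have hAb : ∀ s, 0 ≤ s → ∀ x, ‖A s x‖ ≤ K * ‖x‖ := by
    intro s hs x
    have h1 := hM s hs
    refine max_le ?_ ?_
    · have h2 := norm_snd_le x
      have := norm_nonneg x
      simp only [hA]
      nlinarith
    · simp only [hA, norm_mul, Real.norm_eq_abs]
      have h2 := norm_fst_le x
      rw [Real.norm_eq_abs] at h2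
      exact mul_le_mul (h1.trans (le_max_right _ _)) h2 (abs_nonneg _) (by linarith)
  have hFint : ∀ g : ℝ → ℝ × ℝ, Continuous g → Continuous fun s => A s (g s) := by
    intro g hg; simp only [hA]; fun_prop
  have hcg : ∀ f : BoundedContinuousFunction ℝ (ℝ × ℝ), Continuous fun s => exp (l * s) • f s :=
    fun f => by have := f.continuous; fun_prop
  have hbound : ∀ (f : BoundedContinuousFunction ℝ (ℝ × ℝ)) (r : ℝ), 0 ≤ r →
      ‖exp (-(l * r)) • ∫ s in (0 : ℝ)..r, A s (exp (l * s) • f s)‖ ≤ ‖f‖ / 2 := by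
    intro f r hr
    have h1 : ‖∫ s in (0 : ℝ)..r, A s (exp (l * s) • f s)‖ ≤
        ∫ s in (0 : ℝ)..r, K * ‖f‖ * exp (l * s) := by
      refine intervalIntegral.norm_integral_le_of_norm_le hr (Eventually.of_forall fun s hs => ?_)
        ((by fun_prop : Continuous fun s : ℝ => K * ‖f‖ * exp (l * s)).intervalIntegrable _ _)
      rw [hAsmul, norm_smul, Real.norm_eq_abs, abs_of_pos (exp_pos _)]
      have h2 := hAb s hs.1.le (f s)
      have h3 := f.norm_coe_le_norm s
      have h4 := exp_pos (l * s)
      have : ‖A s (f s)‖ ≤ K * ‖f‖ := h2.trans (by gcongr)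
      nlinarith
    rw [intervalIntegral.integral_const_mul] at h1
    rw [norm_smul, Real.norm_eq_abs, abs_of_pos (exp_pos _)]
    have h5 := exp_integral_le (r := r) hlpos
    calc exp (-(l * r)) * ‖∫ s in (0 : ℝ)..r, A s (exp (l * s) • f s)‖
        ≤ exp (-(l * r)) * (K * ‖f‖ * (exp (l * r) / l)) := by
          gcongr
          refine h1.trans ?_
          gcongr
      _ = (exp (-(l * r)) * exp (l * r)) * (K * ‖f‖ / l) := by ring
      _ = ‖f‖ / 2 := by
          rw [← exp_add, neg_add_cancel, exp_zero, hl]; field_simp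
  have hprim : ∀ g : ℝ → ℝ × ℝ, Continuous g → Continuous fun r => ∫ s in (0 : ℝ)..r, g s :=
    fun g hg => intervalIntegral.continuous_primitive (fun _ _ => hg.intervalIntegrable _ _) 0
  set x0 : ℝ × ℝ := (a, b) with hx0
  let Φ : BoundedContinuousFunction ℝ (ℝ × ℝ) → BoundedContinuousFunction ℝ (ℝ × ℝ) := fun f =>
    BoundedContinuousFunction.ofNormedAddCommGroup
      (fun r => exp (-(l * max r 0)) • (x0 + ∫ s in (0 : ℝ)..(max r 0), A s (exp (l * s) • f s)))
      (by
        have h1 := (hprim _ (hFint _ (hcg f))).comp (show Continuous fun r : ℝ => max r 0 by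
          fun_prop)
        have h2 : Continuous fun r : ℝ => exp (-(l * max r 0)) := by fun_prop
        exact h2.smul (continuous_const.add h1))
      (‖x0‖ + ‖f‖ / 2) (by
        intro r
        rw [smul_add]
        refine (norm_add_le _ _).trans (add_le_add ?_ (hbound f _ (le_max_right _ _)))
        rw [norm_smul, Real.norm_eq_abs, abs_of_pos (exp_pos _)]
        have : exp (-(l * max r 0)) ≤ 1 := by
          rw [exp_le_one_iff]
          have := le_max_right r 0
          have : 0 ≤ l * max r 0 := by positivity
          linarith
        have := norm_nonneg x0
        nlinarith)
  have hΦ : ∀ f r, Φ f r = exp (-(l * max r 0)) •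
      (x0 + ∫ s in (0 : ℝ)..(max r 0), A s (exp (l * s) • f s)) := fun _ _ => rfl
  have hcontr : ContractingWith (1 / 2) Φ := by
    refine ⟨by norm_num, LipschitzWith.of_dist_le_mul fun f g => ?_⟩
    rw [dist_eq_norm, dist_eq_norm]
    refine (BoundedContinuousFunction.norm_le (by positivity)).2 fun r => ?_
    have : (Φ f - Φ g) r = exp (-(l * max r 0)) • ∫ s in (0 : ℝ)..(max r 0),
        A s (exp (l * s) • (f - g) s) := by
      rw [BoundedContinuousFunction.sub_apply, hΦ, hΦ, ← smul_sub, add_sub_add_left_eq_sub,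
        ← intervalIntegral.integral_sub ((hFint _ (hcg f)).intervalIntegrable _ _)
          ((hFint _ (hcg g)).intervalIntegrable _ _)]
      congr 1
      refine intervalIntegral.integral_congr fun s _ => ?_
      simp only [hAsub, BoundedContinuousFunction.sub_apply, smul_sub]
    rw [this]
    refine (hbound _ _ (le_max_right _ _)).trans (le_of_eq ?_)
    push_cast; ring
  obtain ⟨f, hf⟩ : ∃ f, Φ f = f := ⟨_, hcontr.fixedPoint_isFixedPt⟩
  set g : ℝ → ℝ × ℝ := fun s => exp (l * s) • f s with hg
  have hgc : Continuous g := hcg f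
  have hgeq : ∀ r, 0 ≤ r → g r = x0 + ∫ s in (0 : ℝ)..r, A s (g s) := by
    intro r hr
    have h1 := hΦ f r
    rw [hf, max_eq_left hr] at h1
    simp only [hg]
    rw [h1, smul_smul, ← exp_add, add_neg_cancel, exp_zero, one_smul]
  have hzI : ∀ r, HasDerivAt (fun r => ∫ s in (0 : ℝ)..r, Q s * (g s).1) (Q r * (g r).1) r :=
    fun r => (hQ.mul hgc.fst).integral_hasStrictDerivAt 0 r |>.hasDerivAt
  set z' : ℝ → ℝ := fun r => b + ∫ s in (0 : ℝ)..r, Q s * (g s).1 with hz'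
  have hz'd : ∀ r, HasDerivAt z' (Q r * (g r).1) r := fun r => (hzI r).const_add b
  have hz'c : Continuous z' := continuous_iff_continuousAt.2 fun r => (hz'd r).continuousAt
  have hfst : ∀ r, 0 ≤ r → (g r).1 = a + ∫ s in (0 : ℝ)..r, (g s).2 := by
    intro r hr
    have h1 := congrArg (ContinuousLinearMap.fst ℝ ℝ ℝ) (hgeq r hr)
    rw [map_add, ← ContinuousLinearMap.intervalIntegral_comp_comm _
      ((hFint _ hgc).intervalIntegrable _ _)] at h1
    exact h1
  have hsnd : ∀ r, 0 ≤ r → (g r).2 = z' r := by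
    intro r hr
    have h1 := congrArg (ContinuousLinearMap.snd ℝ ℝ ℝ) (hgeq r hr)
    rw [map_add, ← ContinuousLinearMap.intervalIntegral_comp_comm _
      ((hFint _ hgc).intervalIntegrable _ _)] at h1
    exact h1
  set z : ℝ → ℝ := fun r => a + ∫ s in (0 : ℝ)..r, z' s with hz
  have hzeq : ∀ r, 0 ≤ r → z r = (g r).1 := by
    intro r hr
    rw [hfst r hr]
    simp only [hz]
    congr 1
    refine intervalIntegral.integral_congr fun s hs => ?_
    rw [Set.uIcc_of_le hr] at hs
    exact (hsnd s hs.1).symm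
  refine ⟨z, z', by simp [hz], by simp [hz'],
    fun r => (hz'c.integral_hasStrictDerivAt 0 r).hasDerivAt.const_add a, hz'c, fun r hr => ?_⟩
  rw [hzeq r hr]
  exact hz'd r

end LinearODE

/-- The solution of `z'' = (1 - p u^(p-1)) z` with `z 0 = 0` and `z' 0 = 1`. -/
structure LinearizedSol (p : ℝ) (u z z' : ℝ → ℝ) : Prop where
  hasDeriv : ∀ r, HasDerivAt z (z' r) r
  hasDeriv' : ∀ r, 0 ≤ r → HasDerivAt z' ((1 - p * pot p u r) * z r) r
  cont' : Continuous z'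
  zero : z 0 = 0
  deriv_zero : z' 0 = 1

namespace Profile

variable {p : ℝ} {u u' u'' z z' : ℝ → ℝ}

lemma exists_pot_bound (h : Profile p u u' u'') : ∃ M, 0 < M ∧ ∀ r, 0 ≤ r → pot p u r ≤ M := by
  obtain ⟨R, hR⟩ := eventually_atTop.1 (h.tendsto_pot.eventually (gt_mem_nhds one_pos))
  obtain ⟨M, hM⟩ := isCompact_Icc.bddAbove_image (h.pot_cont.continuousOn (s := Set.Icc 0 R))
  refine ⟨max M 1, by positivity, fun r hr => ?_⟩
  rcases le_total r R with h1 | h1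
  · exact (hM ⟨r, ⟨hr, h1⟩, rfl⟩).trans (le_max_left _ _)
  · exact (hR r h1).le.trans (le_max_right _ _)

lemma exists_linearized (h : Profile p u u' u'') (a b : ℝ) : ∃ z z' : ℝ → ℝ, z 0 = a ∧ z' 0 = b ∧
    (∀ r, HasDerivAt z (z' r) r) ∧ Continuous z' ∧
    ∀ r, 0 ≤ r → HasDerivAt z' ((1 - p * pot p u r) * z r) r := by
  obtain ⟨M, hM, hb⟩ := h.exists_pot_bound
  have hp := h.one_lt
  refine exists_linear_ode (M := 1 + p * M) (continuous_const.sub (continuous_const.mul h.pot_cont))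
    (fun r hr => ?_) a b
  have h1 := hb r hr
  have h2 := h.pot_pos r
  change |1 - p * pot p u r| ≤ 1 + p * M
  rw [abs_le]
  constructor <;> nlinarith

lemma exists_linearizedSol (h : Profile p u u' u'') : ∃ z z', LinearizedSol p u z z' := by
  obtain ⟨z, z', h0, h1, h2, h3, h4⟩ := h.exists_linearized 0 1
  exact ⟨z, z', h2, h4, h3, h0, h1⟩

/-- The exponent in Yanagida's functional. -/
def yexp (p : ℝ) : ℝ := 2 * (p - 1) / (p + 3)

/-- Yanagida's functional divided by `r ^ yexp p`. -/
def yred (p : ℝ) (u u' : ℝ → ℝ) (r : ℝ) : ℝ :=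
  1 / 2 * (u r + r * u' r) ^ 2 - yexp p / 2 * u r * (u r + r * u' r)
    + yexp p / 4 * (yexp p - 1) * u r ^ 2 - 1 / 2 * (r * u r) ^ 2
    + pot p u r * (r * u r) ^ 2 / (p + 1)

/-- Yanagida's functional. -/
def yfun (p : ℝ) (u u' : ℝ → ℝ) (r : ℝ) : ℝ := r ^ yexp p * yred p u u' r

/-- The Wronskian of `r u` and `z`. -/
def wron (u u' z z' : ℝ → ℝ) (r : ℝ) : ℝ := r * u r * z' r - (u r + r * u' r) * z r

/-- The companion functional for the linearized equation. -/
def ycomp (p : ℝ) (u u' z z' : ℝ → ℝ) (r : ℝ) : ℝ :=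
  r ^ yexp p * ((u r + r * u' r - yexp p / 2 * u r) * (z' r - (u r + r * u' r) * z r / (r * u r))
    + (p - 1) / (p + 1) * (pot p u r * (r * u r) * z r))

lemma yexp_pos (h : Profile p u u' u'') : 0 < yexp p := by
  have := h.one_lt
  exact div_pos (by linarith) (by linarith)

lemma yexp_lt_one (h : Profile p u u' u'') : yexp p < 1 := by
  have := h.one_lt
  have := h.lt_five
  rw [yexp, div_lt_one (by linarith)]; linarith

lemma second_deriv (h : Profile p u u' u'') {r : ℝ} (hr : 0 < r) :
    u'' r = (1 - pot p u r) * u r - 2 * u' r / r := by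
  have := h.ode' hr.le
  field_simp; linarith

lemma hasDeriv_yfun (h : Profile p u u' u'') {r : ℝ} (hr : 0 < r) : HasDerivAt (yfun p u u')
    (yexp p * r ^ yexp p * u r ^ 2 / r * ((1 - yexp p) * (2 - yexp p) / 4 - r ^ 2)) r := by
  have hp := h.one_lt
  have hA := Real.hasDerivAt_rpow_const (x := r) (p := yexp p) (Or.inl hr.ne')
  have hw := h.hasDeriv_w r
  have hw' := h.hasDeriv_w' hr.le
  have hd := hA.mul ((((((hw'.pow 2).const_mul (1 / 2)).sub
    (((h.hasDeriv r).const_mul (yexp p / 2)).mul hw')).add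
    (((h.hasDeriv r).pow 2).const_mul (yexp p / 4 * (yexp p - 1)))).sub
    ((hw.pow 2).const_mul (1 / 2))).add (((h.hasDeriv_pot r).mul (hw.pow 2)).div_const (p + 1)))
  refine hd.congr_deriv ?_
  have ha : r ^ (yexp p - 1) = r ^ yexp p / r := by rw [rpow_sub_one hr.ne']
  simp only [Pi.add_apply, Pi.sub_apply, Pi.mul_apply, Pi.pow_apply, Nat.cast_ofNat]
  rw [ha]
  have h3 := (h.pos r).ne'
  have h4 : p + 1 ≠ 0 := by linarith
  have h5 : p + 3 ≠ 0 := by linarith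
  generalize r ^ yexp p = A
  rw [yexp]
  field_simp
  ring

lemma hasDeriv_wron (h : Profile p u u' u'') (hz : LinearizedSol p u z z') {r : ℝ} (hr : 0 ≤ r) :
    HasDerivAt (wron u u' z z') (-((p - 1) * pot p u r * (r * u r) * z r)) r := by
  refine (((h.hasDeriv_w r).mul (hz.hasDeriv' r hr)).sub
    ((h.hasDeriv_w' hr).mul (hz.hasDeriv r))).congr_deriv ?_
  ring

lemma hasDeriv_ycomp (h : Profile p u u' u'') (hz : LinearizedSol p u z z') {r : ℝ} (hr : 0 < r) :
    HasDerivAt (ycomp p u u' z z') (-(2 * wron u u' z z' r * yfun p u u' r) / (r * u r) ^ 2) r := by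
  have hp := h.one_lt
  have hu := h.pos r
  have hru : r * u r ≠ 0 := by positivity
  have hA := Real.hasDerivAt_rpow_const (x := r) (p := yexp p) (Or.inl hr.ne')
  have hw := h.hasDeriv_w r
  have hw' := h.hasDeriv_w' hr.le
  have hd := hA.mul (((hw'.sub ((h.hasDeriv r).const_mul (yexp p / 2))).mul
    ((hz.hasDeriv' r hr.le).sub ((hw'.mul (hz.hasDeriv r)).div hw hru))).add
    ((((h.hasDeriv_pot r).mul hw).mul (hz.hasDeriv r)).const_mul ((p - 1) / (p + 1))))
  refine hd.congr_deriv ?_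
  have ha : r ^ (yexp p - 1) = r ^ yexp p / r := by rw [rpow_sub_one hr.ne']
  simp only [Pi.add_apply, Pi.sub_apply, Pi.mul_apply, Pi.div_apply]
  rw [ha, wron, yfun, yred]
  have h3 := (h.pos r).ne'
  have h4 : p + 1 ≠ 0 := by linarith
  have h5 : p + 3 ≠ 0 := by linarith
  generalize r ^ yexp p = A
  rw [yexp]
  field_simp
  ring

end Profile

section Linearized

variable {p : ℝ} {u u' u'' z z' : ℝ → ℝ}

lemma LinearizedSol.tendsto_div (hz : LinearizedSol p u z z') :
    Tendsto (fun r => z r / r) (𝓝[>] 0) (𝓝 1) := by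
  have := ((hz.hasDeriv 0).tendsto_slope).mono_left (nhdsWithin_mono 0 (s := Set.Ioi 0)
    (fun y hy => ne_of_gt hy))
  rw [hz.deriv_zero] at this
  refine this.congr fun r => ?_
  rw [slope_def_field, hz.zero]; simp

lemma LinearizedSol.cont (hz : LinearizedSol p u z z') : Continuous z :=
  continuous_iff_continuousAt.2 fun r => (hz.hasDeriv r).continuousAt

lemma LinearizedSol.exists_pos (hz : LinearizedSol p u z z') :
    ∃ ε, 0 < ε ∧ ∀ r, 0 < r → r ≤ ε → r / 2 ≤ z r := by
  obtain ⟨ε, hε, hε2⟩ := mem_nhdsGT_iff_exists_Ioo_subset.1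
    (hz.tendsto_div.eventually (lt_mem_nhds (show (1 / 2 : ℝ) < 1 by norm_num)))
  have hε : (0 : ℝ) < ε := hε
  refine ⟨ε / 2, by positivity, fun r hr hr2 => ?_⟩
  have : 1 / 2 < z r / r := hε2 ⟨hr, by linarith⟩
  rw [lt_div_iff₀ hr] at this
  linarith

namespace Profile

lemma cont_yfun (h : Profile p u u' u'') : Continuous (yfun p u u') := by
  have h1 := h.cont
  have h2 := h.cont'
  have h3 := h.pot_cont
  have h4 : Continuous fun r : ℝ => r ^ yexp p :=
    continuous_id.rpow_const fun _ => Or.inr h.yexp_pos.le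
  unfold yfun yred
  fun_prop

lemma tendsto_rpow_mul (h : Profile p u u' u'') {f : ℝ → ℝ}
    (hf : Tendsto (fun r => r * f r) atTop (𝓝 0)) :
    Tendsto (fun r => r ^ yexp p * f r) atTop (𝓝 0) := by
  have hn : Tendsto (fun r => ‖r * f r‖) atTop (𝓝 0) := by simpa using hf.norm
  refine squeeze_zero_norm' ?_ hn
  filter_upwards [eventually_ge_atTop 1] with r hr
  have h0 : 0 ≤ r := by linarith
  rw [norm_mul, norm_mul, norm_of_nonneg (rpow_nonneg h0 _), norm_of_nonneg h0]
  refine mul_le_mul_of_nonneg_right ?_ (norm_nonneg _)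
  calc r ^ yexp p ≤ r ^ (1 : ℝ) := rpow_le_rpow_of_exponent_le hr h.yexp_lt_one.le
    _ = r := rpow_one r

lemma tendsto_w' (h : Profile p u u' u'') :
    Tendsto (fun r => r * (u r + r * u' r)) atTop (𝓝 0) := by
  have := (h.tendsto_pow_mul 1).1.add (h.tendsto_pow_mul 2).2
  rw [add_zero] at this
  refine this.congr fun r => ?_
  ring

lemma tendsto_yfun (h : Profile p u u' u'') : Tendsto (yfun p u u') atTop (𝓝 0) := by
  refine h.tendsto_rpow_mul ?_
  have e0 : Tendsto u' atTop (𝓝 0) := by simpa using (h.tendsto_pow_mul 0).2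
  have e1 : Tendsto (fun r => r * u r) atTop (𝓝 0) := by simpa using (h.tendsto_pow_mul 1).1
  have e1' : Tendsto (fun r => r * u' r) atTop (𝓝 0) := by simpa using (h.tendsto_pow_mul 1).2
  have ew : Tendsto (fun r => u r + r * u' r) atTop (𝓝 0) := by simpa using h.lim.add e1'
  have hw := h.tendsto_w'
  have e2 := (h.tendsto_pow_mul 2).1
  have := (((((hw.mul ew).const_mul (1 / 2)).sub ((h.lim.mul hw).const_mul (yexp p / 2))).add
    ((h.lim.mul e1).const_mul (yexp p / 4 * (yexp p - 1)))).sub ((e2.mul e1).const_mul (1 / 2))).add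
    (((h.tendsto_pot.mul e2).mul e1).const_mul (1 / (p + 1)))
  simp only [mul_zero, add_zero, sub_zero] at this
  refine this.congr fun r => ?_
  rw [yred]; ring

lemma exists_yfun_sign (h : Profile p u u' u'') :
    ∃ s, 0 < s ∧ (∀ r, 0 < r → r ≤ s → 0 < yfun p u u' r) ∧
    ∀ r, 0 < r → 0 ≤ yfun p u u' r := by
  have ha := h.yexp_pos
  have ha1 := h.yexp_lt_one
  set s := √((1 - yexp p) * (2 - yexp p) / 4) with hs
  have hpos : 0 < (1 - yexp p) * (2 - yexp p) / 4 := by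
    have : 0 < (1 - yexp p) := by linarith
    have : 0 < (2 - yexp p) := by linarith
    positivity
  have hs0 : 0 < s := sqrt_pos.2 hpos
  have hs2 : (1 - yexp p) * (2 - yexp p) / 4 = s ^ 2 := (sq_sqrt hpos.le).symm
  have hcoef : ∀ r, 0 < r → 0 < yexp p * r ^ yexp p * u r ^ 2 / r := fun r hr => by
    have := h.pos r
    positivity
  have h1 : ∀ r, 0 < r → r ≤ s → 0 < yfun p u u' r := by
    intro r hr hrs
    have := lt_of_hasDerivAt_pos hr h.cont_yfun.continuousOn (fun x hx => h.hasDeriv_yfun hx.1)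
      (fun x hx => mul_pos (hcoef x hx.1) (by rw [hs2]; nlinarith [hx.1, hx.2]))
    rwa [yfun, zero_rpow ha.ne', zero_mul] at this
  refine ⟨s, hs0, h1, fun r hr => ?_⟩
  rcases le_total r s with hrs | hrs
  · exact (h1 r hr hrs).le
  · refine le_of_tendsto h.tendsto_yfun ?_
    filter_upwards [eventually_ge_atTop r] with t ht
    exact le_of_hasDerivAt_nonpos ht h.cont_yfun.continuousOn
      (fun x hx => h.hasDeriv_yfun (hr.trans hx.1))
      (fun x hx => mul_nonpos_of_nonneg_of_nonpos (hcoef x (hr.trans hx.1)).le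
        (by rw [hs2]; nlinarith [hx.1, hx.2]))

lemma tendsto_ycomp_zero (h : Profile p u u' u'') (hz : LinearizedSol p u z z') :
    Tendsto (ycomp p u u' z z') (𝓝[>] 0) (𝓝 0) := by
  have h1 := h.cont
  have h2 := h.cont'
  have h3 := h.pot_cont
  have hzc := hz.cont
  have e1 := hz.tendsto_div
  have lim : ∀ f : ℝ → ℝ, Continuous f → Tendsto f (𝓝[>] 0) (𝓝 (f 0)) :=
    fun f hf => (hf.tendsto 0).mono_left nhdsWithin_le_nhds
  have hA : Tendsto (fun r : ℝ => r ^ yexp p) (𝓝[>] 0) (𝓝 0) := by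
    have := lim (fun r : ℝ => r ^ yexp p) (continuous_id.rpow_const fun _ => Or.inr h.yexp_pos.le)
    rwa [zero_rpow h.yexp_pos.ne'] at this
  have hu0 := (h.pos 0).ne'
  have := hA.mul (((lim (fun r => u r + r * u' r - yexp p / 2 * u r) (by fun_prop)).mul
    ((lim z' hz.cont').sub (((lim (fun r => u r + r * u' r) (by fun_prop)).mul e1).div
      (lim u h1) hu0))).add
      (lim (fun r => (p - 1) / (p + 1) * (pot p u r * (r * u r) * z r)) (by fun_prop)))
  rw [zero_mul] at this
  refine this.congr' ?_
  filter_upwards [self_mem_nhdsWithin] with r hr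
  have hr' : (0 : ℝ) < r := hr
  have := (h.pos r).ne'
  simp only [ycomp, Pi.div_apply]
  congr 3
  field_simp

/-- On an interval where the Wronskian is negative the companion functional is positive. -/
lemma ycomp_mono (h : Profile p u u' u'') (hz : LinearizedSol p u z z') {a b : ℝ} (ha : 0 < a)
    (hab : a ≤ b)
    (hw : ∀ r, 0 < r → r < b → wron u u' z z' r < 0) :
    ycomp p u u' z z' a ≤ ycomp p u u' z z' b := by
  obtain ⟨s, -, -, hJ⟩ := h.exists_yfun_sign
  refine le_of_hasDerivAt_nonneg hab
    (fun x hx => (h.hasDeriv_ycomp hz (ha.trans_le hx.1)).continuousAt.continuousWithinAt)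
    (fun x hx => h.hasDeriv_ycomp hz (ha.trans hx.1)) (fun x hx => ?_)
  have hx0 := ha.trans hx.1
  have := h.pos x
  have h1 := mul_nonneg (neg_nonneg.2 (hw x hx0 hx.2).le) (hJ x hx0)
  exact div_nonneg (by linarith) (by positivity)

lemma ycomp_pos (h : Profile p u u' u'') (hz : LinearizedSol p u z z') {b : ℝ} (hb : 0 < b)
    (hw : ∀ r, 0 < r → r < b → wron u u' z z' r < 0) : 0 < ycomp p u u' z z' b := by
  obtain ⟨s, hs, hJpos, -⟩ := h.exists_yfun_sign
  set m := min s b with hm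
  have hm0 : 0 < m := lt_min hs hb
  have hnn : ∀ c, 0 < c → c ≤ b → 0 ≤ ycomp p u u' z z' c := by
    intro c hc hcb
    refine le_of_tendsto (h.tendsto_ycomp_zero hz) ?_
    filter_upwards [Ioo_mem_nhdsGT hc] with x hx
    exact h.ycomp_mono hz hx.1 hx.2.le fun r hr hrc => hw r hr (hrc.trans_le hcb)
  have h1 : ycomp p u u' z z' (m / 2) < ycomp p u u' z z' m := by
    refine lt_of_hasDerivAt_pos (by linarith)
      (fun x hx => (h.hasDeriv_ycomp hz (by linarith [hx.1])).continuousAt.continuousWithinAt)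
      (fun x hx => h.hasDeriv_ycomp hz (by linarith [hx.1])) (fun x hx => ?_)
    have hx0 : 0 < x := by linarith [hx.1]
    have := h.pos x
    have h1 := mul_pos (neg_pos.2 (hw x hx0 (hx.2.trans_le (min_le_right _ _))))
      (hJpos x hx0 (hx.2.le.trans (min_le_left _ _)))
    exact div_pos (by linarith) (by positivity)
  have h2 := hnn (m / 2) (by linarith) (by linarith [min_le_right s b])
  have h3 := h.ycomp_mono hz hm0 (min_le_right _ _) hw
  linarith

lemma hasDeriv_ratio (h : Profile p u u' u'') (hz : LinearizedSol p u z z') {r : ℝ} (hr : 0 < r) :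
    HasDerivAt (fun r => z r / (r * u r)) (wron u u' z z' r / (r * u r) ^ 2) r := by
  have := h.pos r
  refine ((hz.hasDeriv r).div (h.hasDeriv_w r) (by positivity)).congr_deriv ?_
  rw [wron]; ring

lemma wron_neg_of_pos (h : Profile p u u' u'') (hz : LinearizedSol p u z z') {b : ℝ} (hb : 0 < b)
    (hpos : ∀ r, 0 < r → r < b → 0 < z r) : wron u u' z z' b < 0 := by
  have hp := h.one_lt
  have := lt_of_hasDerivAt_neg hb
    (fun x hx => (h.hasDeriv_wron hz hx.1).continuousAt.continuousWithinAt)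
    (fun x hx => h.hasDeriv_wron hz hx.1.le) (fun x hx => by
      have h1 := h.pos x
      have h2 := h.pot_pos x
      have h3 := hpos x hx.1 hx.2
      have h4 : 0 < p - 1 := by linarith
      have h5 := hx.1
      have : 0 < (p - 1) * pot p u x * (x * u x) * z x := by positivity
      linarith)
  simpa [wron, hz.zero] using this

lemma exists_nonpos (h : Profile p u u' u'') (hz : LinearizedSol p u z z') :
    ∃ r, 0 < r ∧ z r ≤ 0 := by
  by_contra! hcon
  have hp := h.one_lt
  have hc : wron u u' z z' 1 < 0 := h.wron_neg_of_pos hz one_pos (fun r hr _ => hcon r hr)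
  set c := -wron u u' z z' 1 with hcdef
  have hmono : ∀ r, 1 ≤ r → wron u u' z z' r ≤ -c := by
    intro r hr
    rw [hcdef, neg_neg]
    refine le_of_hasDerivAt_nonpos hr
      (fun x hx => (h.hasDeriv_wron hz (by linarith [hx.1])).continuousAt.continuousWithinAt)
      (fun x hx => h.hasDeriv_wron hz (by linarith [hx.1])) (fun x hx => ?_)
    have h0 : 0 < x := by linarith [hx.1]
    have h1 := h.pos x
    have h2 := h.pot_pos x
    have h3 := hcon x h0
    have h4 : 0 < p - 1 := by linarith
    have : 0 < (p - 1) * pot p u x * (x * u x) * z x := by positivity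
    linarith
  have e1 : Tendsto (fun r => r * u r) atTop (𝓝 0) := by simpa using (h.tendsto_pow_mul 1).1
  obtain ⟨R, hR⟩ := eventually_atTop.1
    ((e1.eventually (gt_mem_nhds one_pos)).and (eventually_ge_atTop 1))
  have hR1 : 1 ≤ R := (hR R le_rfl).2
  set y := z R / (R * u R) with hy
  have hy0 : 0 < y := by
    have := hcon R (by linarith)
    have := h.pos R
    positivity
  have hc0 : 0 < c := by linarith
  set T := R + (y / c + 1) with hT
  have hRT : R ≤ T := by
    have : 0 < y / c := by positivity
    linarith
  have hkey := le_of_hasDerivAt_nonpos (f := fun r => z r / (r * u r) + c * r) hRT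
    (fun x hx => ((h.hasDeriv_ratio hz (r := x) (by linarith [hx.1])).add
      ((hasDerivAt_id x).const_mul c)).continuousAt.continuousWithinAt)
    (fun x hx => (h.hasDeriv_ratio hz (r := x) (by linarith [hx.1])).add
      ((hasDerivAt_id x).const_mul c)) (fun x hx => by
        have h0 : 0 < x := by linarith [hx.1]
        have h1 := h.pos x
        have h2 := hmono x (by linarith [hx.1])
        have h3 := (hR x hx.1.le).1
        have h4 : 0 < x * u x := by positivity
        have h5 : wron u u' z z' x / (x * u x) ^ 2 ≤ -c := by
          rw [div_le_iff₀ (by positivity)]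
          nlinarith [mul_nonneg hc0.le h4.le]
        linarith)
  have h6 : 0 < z T / (T * u T) := by
    have h0 : 0 < T := by linarith
    have := hcon T h0
    have := h.pos T
    positivity
  have h7 : c * T = c * R + y + c := by rw [hT]; field_simp; ring
  simp only [← hy] at hkey
  linarith

lemma exists_node (h : Profile p u u' u'') (hz : LinearizedSol p u z z') :
    ∃ ρ, 0 < ρ ∧ z ρ = 0 ∧ z' ρ < 0 ∧
    (∀ r, 0 < r → r < ρ → 0 < z r) ∧ (∀ r, ρ < r → z r < 0) ∧
    (∀ r, 0 < r → wron u u' z z' r < 0) := by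
  have hzc := hz.cont
  obtain ⟨ε, hε, hεz⟩ := hz.exists_pos
  obtain ⟨r0, hr0, hzr0⟩ := h.exists_nonpos hz
  have hεr0 : ε ≤ r0 := by
    by_contra! hcon
    have := hεz r0 hr0 hcon.le
    linarith
  obtain ⟨ρ, hρ, hzρ, hneg⟩ := exists_first_zero (f := fun r => -z r) hεr0 hzc.neg.continuousOn
    (by have := hεz ε hε le_rfl; linarith) (by linarith)
  have hρ0 : 0 < ρ := hε.trans hρ.1
  have hzρ : z ρ = 0 := by linarith
  have hpos : ∀ r, 0 < r → r < ρ → 0 < z r := by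
    intro r hr hrρ
    rcases lt_or_ge r ε with h1 | h1
    · have := hεz r hr h1.le; linarith
    · have := hneg r ⟨h1, hrρ⟩; linarith
  have hW1 : ∀ r, 0 < r → r ≤ ρ → wron u u' z z' r < 0 := fun r hr hrρ =>
    h.wron_neg_of_pos hz hr fun s hs hsr => hpos s hs (hsr.trans_le hrρ)
  have hanti : ∀ b, ρ < b → (∀ r, 0 < r → r < b → wron u u' z z' r < 0) → z b < 0 := by
    intro b hb hw
    have h1 := lt_of_hasDerivAt_neg hb
      (fun x hx => (h.hasDeriv_ratio hz (hρ0.trans_le hx.1)).continuousAt.continuousWithinAt)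
      (fun x hx => h.hasDeriv_ratio hz (hρ0.trans hx.1)) (fun x hx => by
        have h0 := hρ0.trans hx.1
        have := h.pos x
        exact div_neg_of_neg_of_pos (hw x h0 hx.2) (by positivity))
    rw [hzρ, zero_div] at h1
    have h0 : 0 < b := hρ0.trans hb
    have := h.pos b
    by_contra! hcon
    exact absurd h1 (not_lt.2 (by positivity))
  have hWall : ∀ r, 0 < r → wron u u' z z' r < 0 := by
    intro r1 hr1
    by_contra! hcon
    have hρr1 : ρ ≤ r1 := by
      by_contra! hlt
      exact absurd (hW1 r1 hr1 hlt.le) (not_lt.2 hcon)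
    obtain ⟨ξ, hξ, hξ0, hξneg⟩ := exists_first_zero hρr1
      (fun x hx => (h.hasDeriv_wron hz (hρ0.le.trans hx.1)).continuousAt.continuousWithinAt)
      (hW1 ρ hρ0 le_rfl) hcon
    have hw : ∀ r, 0 < r → r < ξ → wron u u' z z' r < 0 := by
      intro r hr hrξ
      rcases le_total r ρ with h1 | h1
      · exact hW1 r hr h1
      · exact hξneg r ⟨h1, hrξ⟩
    have hzξ := hanti ξ hξ.1 hw
    have hξpos : 0 < ξ := hρ0.trans hξ.1
    have hN := h.ycomp_pos hz hξpos hw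
    have hu := h.pos ξ
    have hN2 : ycomp p u u' z z' ξ =
        ξ ^ yexp p * ((p - 1) / (p + 1) * (pot p u ξ * (ξ * u ξ))) * z ξ := by
      have : z' ξ - (u ξ + ξ * u' ξ) * z ξ / (ξ * u ξ) = wron u u' z z' ξ / (ξ * u ξ) := by
        rw [wron]; field_simp
      rw [ycomp, this, hξ0]; ring
    have hp := h.one_lt
    have h4 : 0 < p - 1 := by linarith
    have h5 := h.pot_pos ξ
    have : 0 < ξ ^ yexp p * ((p - 1) / (p + 1) * (pot p u ξ * (ξ * u ξ))) := by positivity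
    rw [hN2] at hN
    nlinarith
  refine ⟨ρ, hρ0, hzρ, ?_, hpos, fun r hr => hanti r hr fun s hs _ => hWall s hs, hWall⟩
  have h1 := hWall ρ hρ0
  rw [wron, hzρ, mul_zero, sub_zero] at h1
  have := h.pos ρ
  by_contra! hcon
  exact absurd h1 (not_lt.2 (by positivity))

lemma exists_abs_w'_le (h : Profile p u u' u'') :
    ∃ R, 1 ≤ R ∧ ∀ r, R ≤ r → |u r + r * u' r| ≤ r * u r := by
  obtain ⟨R, hR, htail⟩ := h.exists_tail
  refine ⟨R, hR, fun r hr => ?_⟩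
  have hr0 : 0 < r := by linarith
  have hur := h.pos r
  refine abs_le_of_sq_le_sq ?_ (by positivity)
  have e1 : Tendsto (fun r => r * u r) atTop (𝓝 0) := by simpa using (h.tendsto_pow_mul 1).1
  have e1' : Tendsto (fun r => r * u' r) atTop (𝓝 0) := by simpa using (h.tendsto_pow_mul 1).2
  have ew : Tendsto (fun r => u r + r * u' r) atTop (𝓝 0) := by simpa using h.lim.add e1'
  have hlim : Tendsto (fun r => (u r + r * u' r) ^ 2 - (r * u r) ^ 2) atTop (𝓝 0) := by
    simpa using (ew.pow 2).sub (e1.pow 2)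
  have : (u r + r * u' r) ^ 2 - (r * u r) ^ 2 ≤ 0 := by
    refine ge_of_tendsto hlim ?_
    filter_upwards [eventually_ge_atTop r] with t ht
    have hd : ∀ x, r ≤ x → HasDerivAt (fun r => (u r + r * u' r) ^ 2 - (r * u r) ^ 2)
        (-(2 * pot p u x * (x * u x) * (u x + x * u' x))) x := by
      intro x hx
      refine (((h.hasDeriv_w' (by linarith)).pow 2).sub ((h.hasDeriv_w x).pow 2)).congr_deriv ?_
      simp only [Nat.cast_ofNat]
      ring
    refine le_of_hasDerivAt_nonneg ht (fun x hx => (hd x hx.1).continuousAt.continuousWithinAt)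
      (fun x hx => hd x hx.1.le) (fun x hx => ?_)
    have h0 : 0 < x := by linarith [hx.1]
    have h1 := htail x (hr.trans hx.1.le)
    have h2 := h.pos x
    have h3 := h.pot_pos x
    have h4 : 0 < x * u x := by positivity
    have h5 : 0 < 2 * pot p u x * (x * u x) := by positivity
    nlinarith
  linarith

lemma tendsto_ycomp_of_bounded (h : Profile p u u' u'') {B R : ℝ}
    (hB : ∀ r, R ≤ r → |z r| ≤ B ∧ |z' r| ≤ B) :
    Tendsto (ycomp p u u' z z') atTop (𝓝 0) := by
  obtain ⟨R1, hR1, hw'⟩ := h.exists_abs_w'_le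
  have hp := h.one_lt
  have e2 := (h.tendsto_pow_mul 2).1
  have e1 : Tendsto (fun r => r * u r) atTop (𝓝 0) := by simpa using (h.tendsto_pow_mul 1).1
  have a1 : Tendsto (fun r => r * |u r + r * u' r - yexp p / 2 * u r|) atTop (𝓝 0) := by
    have := (h.tendsto_w'.sub (e1.const_mul (yexp p / 2))).abs
    simp only [mul_zero, sub_zero, abs_zero] at this
    refine this.congr' ?_
    filter_upwards [eventually_ge_atTop 0] with r hr
    rw [← abs_of_nonneg hr, ← abs_mul, abs_of_nonneg hr]
    ring_nf
  have a2 : Tendsto (fun r => pot p u r * (r ^ 2 * u r)) atTop (𝓝 0) := by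
    simpa using h.tendsto_pot.mul e2
  have hlim : Tendsto (fun r => (r * |u r + r * u' r - yexp p / 2 * u r|) * (2 * B) +
      (p - 1) / (p + 1) * (pot p u r * (r ^ 2 * u r)) * B) atTop (𝓝 0) := by
    simpa using (a1.mul_const (2 * B)).add ((a2.const_mul ((p - 1) / (p + 1))).mul_const B)
  have hlim' : Tendsto (fun r => r * ((u r + r * u' r - yexp p / 2 * u r) *
      (z' r - (u r + r * u' r) * z r / (r * u r))
      + (p - 1) / (p + 1) * (pot p u r * (r * u r) * z r))) atTop (𝓝 0) := by
    refine squeeze_zero_norm' ?_ hlim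
    filter_upwards [eventually_ge_atTop (max R R1)] with r hr
    obtain ⟨hz, hz1⟩ := hB r ((le_max_left _ _).trans hr)
    have hr1 : R1 ≤ r := (le_max_right _ _).trans hr
    have hr0 : 0 < r := by linarith
    have hu := h.pos r
    have hwr : 0 < r * u r := by positivity
    have hq : |(u r + r * u' r) * z r / (r * u r)| ≤ B := by
      rw [abs_div, abs_mul, abs_of_pos hwr, div_le_iff₀ hwr]
      have := mul_le_mul (hw' r hr1) hz (abs_nonneg _) hwr.le
      linarith
    have hq2 : |z' r - (u r + r * u' r) * z r / (r * u r)| ≤ 2 * B :=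
      (abs_sub _ _).trans (by linarith)
    have hpp : 0 ≤ (p - 1) / (p + 1) := div_nonneg (by linarith) (by linarith)
    have hW := h.pot_pos r
    rw [mul_add]
    refine (norm_add_le _ _).trans (add_le_add ?_ ?_)
    · rw [norm_mul, norm_mul, Real.norm_eq_abs, Real.norm_eq_abs, Real.norm_eq_abs,
        abs_of_pos hr0, ← mul_assoc]
      exact mul_le_mul_of_nonneg_left hq2 (by positivity)
    · have : r * ((p - 1) / (p + 1) * (pot p u r * (r * u r) * z r)) =
        (p - 1) / (p + 1) * (pot p u r * (r ^ 2 * u r)) * z r := by ring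
      rw [this, norm_mul, Real.norm_eq_abs (z r), Real.norm_of_nonneg (by positivity)]
      exact mul_le_mul_of_nonneg_left hz (by positivity)
  exact h.tendsto_rpow_mul hlim'

/-- The linearized solution eventually decreases, with `r z' - z < 0`. -/
lemma exists_descent (h : Profile p u u' u'') (hz : LinearizedSol p u z z') :
    ∃ R1, ∀ R0, R1 ≤ R0 → ∃ R, R0 ≤ R ∧ z' R < 0 ∧ R * z' R - z R < 0 := by
  obtain ⟨ρ, hρ0, -, -, -, hneg, hW⟩ := h.exists_node hz
  have hp := h.one_lt
  obtain ⟨R1, hR1⟩ := eventually_atTop.1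
    (h.tendsto_pot.eventually (gt_mem_nhds (show 0 < 1 / (2 * p) by positivity)))
  have hQ : ∀ r, R1 ≤ r → 1 / 2 ≤ 1 - p * pot p u r := by
    intro r hr
    have := hR1 r hr
    rw [lt_div_iff₀ (by positivity)] at this
    linarith
  refine ⟨max R1 (max (ρ + 1) 1), fun R0 hR0 => ?_⟩
  have hR01 : R1 ≤ R0 := (le_max_left _ _).trans hR0
  have hR0ρ : ρ < R0 := by
    have := (le_max_left (ρ + 1) 1).trans ((le_max_right _ _).trans hR0); linarith
  have hR00 : 1 ≤ R0 := (le_max_right (ρ + 1) 1).trans ((le_max_right _ _).trans hR0)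
  have hz'anti : ∀ a b, R0 ≤ a → a ≤ b → z' b ≤ z' a := by
    intro a b ha hab
    refine le_of_hasDerivAt_nonpos hab hz.cont'.continuousOn
      (fun x hx => hz.hasDeriv' x (by linarith [hx.1])) (fun x hx => ?_)
    have h1 := hQ x (by linarith [hx.1])
    have h2 := hneg x (by linarith [hx.1])
    nlinarith
  obtain ⟨a, ha, ha'⟩ : ∃ a, R0 ≤ a ∧ z' a < 0 := by
    by_contra! hcon
    have hmono : ∀ r, R0 ≤ r → z R0 ≤ z r := fun r hr =>
      le_of_hasDerivAt_nonneg hr hz.cont.continuousOn (fun x _ => hz.hasDeriv x)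
        (fun x hx => hcon x hx.1.le)
    have hlim := h.tendsto_ycomp_of_bounded (z := z) (z' := z') (R := R0)
      (B := max (-z R0) (z' R0)) (fun r hr => by
        constructor
        · rw [abs_of_neg (hneg r (by linarith))]
          exact (neg_le_neg (hmono r hr)).trans (le_max_left _ _)
        · rw [abs_of_nonneg (hcon r hr)]
          exact (hz'anti R0 r le_rfl hr).trans (le_max_right _ _))
    have hpos := h.ycomp_pos hz one_pos (fun r hr _ => hW r hr)
    have : ycomp p u u' z z' 1 ≤ 0 := by
      refine ge_of_tendsto hlim ?_
      filter_upwards [eventually_ge_atTop 1] with t ht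
      exact h.ycomp_mono hz one_pos ht fun r hr _ => hW r hr
    linarith
  have hzanti : ∀ r, a ≤ r → z r ≤ z a := fun r hr =>
    le_of_hasDerivAt_nonpos hr hz.cont.continuousOn (fun x _ => hz.hasDeriv x)
      (fun x hx => (hz'anti a x ha hx.1.le).trans ha'.le)
  have hza := hneg a (by linarith)
  set D : ℝ → ℝ := fun r => r * z' r - z r with hD
  have hDd : ∀ r, 0 ≤ r → HasDerivAt D (r * ((1 - p * pot p u r) * z r)) r := by
    intro r hr
    refine (((hasDerivAt_id r).mul (hz.hasDeriv' r hr)).sub (hz.hasDeriv r)).congr_deriv ?_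
    simp
  by_cases hDa : D a < 0
  · exact ⟨a, ha, ha', hDa⟩
  push Not at hDa
  set R := a + (D a / (-z a / 2) + 1) with hR
  have haR : a ≤ R := by
    have : 0 ≤ D a / (-z a / 2) := div_nonneg hDa (by linarith)
    linarith
  refine ⟨R, ha.trans haR, (hz'anti a R ha haR).trans_lt ha', ?_⟩
  have hkey := le_of_hasDerivAt_nonpos (f := fun r => D r + (-z a / 2) * r) haR
    (fun x hx => ((hDd x (by linarith [hx.1])).add
      ((hasDerivAt_id x).const_mul _)).continuousAt.continuousWithinAt)
    (fun x hx => (hDd x (by linarith [hx.1])).add ((hasDerivAt_id x).const_mul _))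
    (fun x hx => by
      have h1 := hQ x (by linarith [hx.1])
      have h2 := hzanti x hx.1.le
      have h3 : 1 ≤ x := by linarith [hx.1]
      have h4 : (1 - p * pot p u x) * z x ≤ z a / 2 := by nlinarith
      nlinarith)
  have h5 : (-z a / 2) * R = (-z a / 2) * a + D a + -z a / 2 := by
    have := hza.ne
    rw [hR]; field_simp; ring
  change D R < 0
  linarith

end Profile

end Linearized

section RadialForm

/-- The one-dimensional quadratic form `∫ r² f'² + V f²` on `[a, b]`. -/
def rform (V f f' : ℝ → ℝ) (a b : ℝ) : ℝ := ∫ r in a..b, (r ^ 2 * f' r ^ 2 + V r * f r ^ 2)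

variable {V f f' : ℝ → ℝ} {a b : ℝ}

lemma rform_add {c : ℝ} (hV : Continuous V) (hf : ∀ r, HasDerivAt f (f' r) r)
    (hf' : Continuous f') : rform V f f' a b + rform V f f' b c = rform V f f' a c := by
  have hfc : Continuous f := continuous_iff_continuousAt.2 fun r => (hf r).continuousAt
  have : Continuous fun r => r ^ 2 * f' r ^ 2 + V r * f r ^ 2 := by fun_prop
  exact intervalIntegral.integral_add_adjacent_intervals (this.intervalIntegrable _ _)
    (this.intervalIntegrable _ _)

lemma rform_nonneg (hab : a ≤ b) (hV : ∀ r ∈ Set.Icc a b, 0 ≤ V r) : 0 ≤ rform V f f' a b :=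
  intervalIntegral.integral_nonneg hab fun r hr => by
    have := hV r hr
    positivity

/-- Riccati subsolutions bound the form from below by boundary terms. -/
lemma le_rform_of_riccati {S S' : ℝ → ℝ} (ha : 0 ≤ a) (hab : a ≤ b) (hV : Continuous V)
    (hf : ∀ r, HasDerivAt f (f' r) r) (hf' : Continuous f') (hS : ContinuousOn S (Set.Icc a b))
    (hS' : ∀ r ∈ Set.Ioo a b, HasDerivAt S (S' r) r)
    (hle : ∀ r ∈ Set.Ioo a b, S' r + S r ^ 2 / r ^ 2 ≤ V r) :
    S b * f b ^ 2 - S a * f a ^ 2 ≤ rform V f f' a b := by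
  have hfc : Continuous f := continuous_iff_continuousAt.2 fun r => (hf r).continuousAt
  have hc : Continuous fun r => r ^ 2 * f' r ^ 2 + V r * f r ^ 2 := by fun_prop
  have hI := fun x => (hc.integral_hasStrictDerivAt a x).hasDerivAt
  have := le_of_hasDerivAt_nonneg
    (f := fun x => (∫ r in a..x, (r ^ 2 * f' r ^ 2 + V r * f r ^ 2)) - S x * f x ^ 2)
    (f' := fun x => (x ^ 2 * f' x ^ 2 + V x * f x ^ 2) - (S' x * f x ^ 2 + S x * (2 * f x * f' x)))
    hab ((continuous_iff_continuousAt.2 fun x => (hI x).continuousAt).continuousOn.sub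
      (hS.mul (hfc.pow 2).continuousOn))
    (fun x hx => ((hI x).sub ((hS' x hx).mul ((hf x).pow 2))).congr_deriv (by simp))
    (fun x hx => by
      have hx0 : 0 < x := ha.trans_lt hx.1
      have h1 := mul_le_mul_of_nonneg_right (hle x hx) (sq_nonneg (f x))
      have h2 : 0 ≤ (x * f' x - S x * f x / x) ^ 2 := sq_nonneg _
      have h3 : (x * f' x - S x * f x / x) ^ 2 =
          x ^ 2 * f' x ^ 2 - 2 * S x * f x * f' x + S x ^ 2 / x ^ 2 * f x ^ 2 := by
        field_simp; ring
      rw [h3] at h2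
      linarith)
  simp only [intervalIntegral.integral_same] at this
  rw [rform]
  linarith

/-- A Riccati solution vanishing quadratically leaves some slack in the potential. -/
lemma exists_slack {S S' : ℝ → ℝ} {K : ℝ} (ha : 0 ≤ a) (hab : a < b)
    (hS : ContinuousOn S (Set.Icc a b)) (hS' : ∀ r ∈ Set.Ioo a b, HasDerivAt S (S' r) r)
    (hle : ∀ r ∈ Set.Ioo a b, S' r + S r ^ 2 / r ^ 2 ≤ V r)
    (hK : ∀ r ∈ Set.Icc a b, |S r| ≤ K * r ^ 2) :
    ∃ c, 0 < c ∧ ∀ V₂ : ℝ → ℝ, Continuous V₂ → (∀ r ∈ Set.Ioo a b, V r - c * r ^ 2 ≤ V₂ r) →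
      ∀ f f' : ℝ → ℝ, (∀ r, HasDerivAt f (f' r) r) → Continuous f' → (a = 0 ∨ f a = 0) →
        (f b = 0 ∨ 0 < S b) → 0 ≤ rform V₂ f f' a b := by
  have hb : 0 < b := ha.trans_lt hab
  have hK0 : 0 ≤ K := by
    have h1 := (abs_nonneg _).trans (hK b ⟨hab.le, le_rfl⟩)
    by_contra! hcon
    nlinarith [pow_pos hb 2]
  set l := 2 * K with hl
  obtain ⟨ε, hε, hε1, hε2⟩ : ∃ ε, 0 < ε ∧ ε * (b ^ 2 * exp (l * b)) ≤ 2 ∧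
      (0 < S b → ε * (b ^ 3 * exp (l * b)) ≤ S b) := by
    by_cases hSb : 0 < S b
    · refine ⟨min (2 / (b ^ 2 * exp (l * b))) (S b / (b ^ 3 * exp (l * b))),
        lt_min (by positivity) (by positivity), ?_, fun _ => ?_⟩
      · rw [← le_div_iff₀ (by positivity)]; exact min_le_left _ _
      · rw [← le_div_iff₀ (by positivity)]; exact min_le_right _ _
    · refine ⟨2 / (b ^ 2 * exp (l * b)), by positivity, ?_, fun h => absurd h hSb⟩
      rw [← le_div_iff₀ (by positivity)]
  refine ⟨ε, hε, fun V₂ hV₂ hVV f f' hf hf' hfa hfb => ?_⟩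
  have key := le_rform_of_riccati (V := V₂) (S := fun r => S r - ε * (r ^ 3 * exp (l * r)))
    (S' := fun r => S' r - ε * (3 * r ^ 2 * exp (l * r) + r ^ 3 * (exp (l * r) * l)))
    ha hab.le hV₂ hf hf' (hS.sub (by fun_prop))
    (fun r hr => by
      have e1 : HasDerivAt (fun r : ℝ => exp (l * r)) (exp (l * r) * l) r := by
        simpa using ((hasDerivAt_id r).const_mul l).exp
      refine ((hS' r hr).sub (((hasDerivAt_pow 3 r).mul e1).const_mul ε)).congr_deriv ?_
      norm_num)
    (fun r hr => by
      refine le_trans ?_ (hVV r hr)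
      have hr0 : 0 < r := ha.trans_lt hr.1
      have h1 := hle r hr
      have h2 := (abs_le.1 (hK r ⟨hr.1.le, hr.2.le⟩)).1
      set E := exp (l * r) with hE
      have hE1 : 1 ≤ E := one_le_exp (by positivity)
      have hEb : E ≤ exp (l * b) := by
        rw [hE]; gcongr; exact hr.2.le
      have h3 : (S r - ε * (r ^ 3 * E)) ^ 2 / r ^ 2 =
          S r ^ 2 / r ^ 2 - 2 * ε * E * (r * S r) + ε * E * (ε * (r ^ 4 * E)) := by
        field_simp
        ring
      rw [h3]
      have h4 : ε * (r ^ 2 * E) ≤ 2 := by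
        refine le_trans ?_ hε1
        have := hr.2.le
        gcongr
      have hεE : 0 < ε * E := by positivity
      have h5 : ε * E * (-(K * r ^ 2) * r) ≤ ε * E * (S r * r) := by gcongr
      have h6 : ε * E * (ε * (r ^ 4 * E)) ≤ ε * E * (2 * r ^ 2) := by
        refine mul_le_mul_of_nonneg_left ?_ hεE.le
        have := mul_le_mul_of_nonneg_left h4 (sq_nonneg r)
        linarith
      have h7 : ε * r ^ 2 ≤ ε * E * r ^ 2 := by
        have : 0 < ε * r ^ 2 := by positivity
        nlinarith
      rw [hl]
      nlinarith)
  refine le_trans ?_ key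
  have h1 : (S a - ε * (a ^ 3 * exp (l * a))) * f a ^ 2 = 0 := by
    rcases hfa with rfl | h0
    · have : S 0 = 0 := by simpa using hK 0 ⟨le_rfl, hab.le⟩
      simp [this]
    · simp [h0]
  simp only [h1, sub_zero]
  rcases hfb with h0 | h0
  · simp [h0]
  · have := hε2 h0
    have : 0 ≤ S b - ε * (b ^ 3 * exp (l * b)) := by linarith
    positivity

/-- Subtracting the multiple of a positive radial mode that creates a node does not increase the
form. -/
lemma rform_sub_le {e e' wt : ℝ → ℝ} {m T t : ℝ} (hT : 0 < T) (hV : Continuous V)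
    (hwt : Continuous wt) (hf : ∀ r, HasDerivAt f (f' r) r) (hf' : Continuous f')
    (he : ∀ r, HasDerivAt e (e' r) r) (he' : Continuous e')
    (hode : ∀ r, 0 < r → HasDerivAt (fun r => r ^ 2 * e' r) ((V r + m * wt r) * e r) r)
    (hm : 0 ≤ m) (hwt0 : ∀ r, 0 ≤ r → 0 ≤ wt r) (hfT : f T = 0)
    (horth : ∫ r in (0 : ℝ)..T, wt r * e r * f r = 0) (heT : 0 ≤ e T) (heT' : e' T ≤ 0) :
    rform V (fun r => f r - t * e r) (fun r => f' r - t * e' r) 0 T ≤ rform V f f' 0 T := by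
  have hfc : Continuous f := continuous_iff_continuousAt.2 fun r => (hf r).continuousAt
  have hec : Continuous e := continuous_iff_continuousAt.2 fun r => (he r).continuousAt
  have ibp : ∀ g g' : ℝ → ℝ, (∀ r, HasDerivAt g (g' r) r) → Continuous g' → Continuous g →
      ∫ r in (0 : ℝ)..T, (r ^ 2 * e' r * g' r + V r * e r * g r) =
        T ^ 2 * e' T * g T - m * ∫ r in (0 : ℝ)..T, wt r * e r * g r := by
    intro g g' hg hg' hgc
    have h1 := intervalIntegral.integral_eq_sub_of_hasDerivAt_of_le hT.le
      (f := fun r => r ^ 2 * e' r * g r)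
      (f' := fun r => (V r + m * wt r) * e r * g r + r ^ 2 * e' r * g' r)
      (by fun_prop) (fun r hr => (hode r hr.1).mul (hg r))
      ((by fun_prop : Continuous fun r => (V r + m * wt r) * e r * g r + r ^ 2 * e' r * g'
        r).intervalIntegrable _ _)
    have h2 : ∫ r in (0 : ℝ)..T, ((V r + m * wt r) * e r * g r + r ^ 2 * e' r * g' r) =
        (∫ r in (0 : ℝ)..T, (r ^ 2 * e' r * g' r + V r * e r * g r)) +
          ∫ r in (0 : ℝ)..T, m * (wt r * e r * g r) := by
      rw [← intervalIntegral.integral_add]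
      · refine intervalIntegral.integral_congr fun r _ => ?_
        ring
      all_goals exact Continuous.intervalIntegrable (by fun_prop) _ _
    rw [h2, intervalIntegral.integral_const_mul] at h1
    simp only [ne_eq, OfNat.ofNat_ne_zero, not_false_eq_true, zero_pow, zero_mul, sub_zero] at h1
    linarith
  have h1 := ibp f f' hf hf' hfc
  have h2 := ibp e e' he he' hec
  rw [hfT, horth, mul_zero, mul_zero, sub_zero] at h1
  have h3 : 0 ≤ ∫ r in (0 : ℝ)..T, wt r * e r * e r :=
    intervalIntegral.integral_nonneg hT.le fun r hr => by
      have := mul_nonneg (hwt0 r hr.1) (mul_self_nonneg (e r))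
      linarith
  have h4 : ∫ r in (0 : ℝ)..T, (r ^ 2 * e' r * e' r + V r * e r * e r) ≤ 0 := by
    rw [h2]
    have h5 : 0 ≤ T ^ 2 * e T * (-e' T) := mul_nonneg (by positivity) (by linarith)
    have := mul_nonneg hm h3
    linarith
  have h6 : rform V (fun r => f r - t * e r) (fun r => f' r - t * e' r) 0 T =
      rform V f f' 0 T - 2 * t * (∫ r in (0 : ℝ)..T, (r ^ 2 * e' r * f' r + V r * e r * f r)) +
        t ^ 2 * ∫ r in (0 : ℝ)..T, (r ^ 2 * e' r * e' r + V r * e r * e r) := by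
    rw [rform, rform, ← intervalIntegral.integral_const_mul, ← intervalIntegral.integral_const_mul,
      ← intervalIntegral.integral_sub, ← intervalIntegral.integral_add]
    · refine intervalIntegral.integral_congr fun r _ => ?_
      ring
    all_goals exact Continuous.intervalIntegrable (by fun_prop) _ _
  rw [h6, h1]
  have := mul_nonneg (sq_nonneg t) (neg_nonneg.2 h4)
  linarith

end RadialForm

lemma rform_mono {V V₂ f f' : ℝ → ℝ} {a b : ℝ} (hab : a ≤ b) (hV : Continuous V)
    (hV₂ : Continuous V₂) (hf : ∀ r, HasDerivAt f (f' r) r) (hf' : Continuous f')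
    (hle : ∀ r ∈ Set.Icc a b, V r ≤ V₂ r) : rform V f f' a b ≤ rform V₂ f f' a b := by
  have hfc : Continuous f := continuous_iff_continuousAt.2 fun r => (hf r).continuousAt
  refine intervalIntegral.integral_mono_on hab (Continuous.intervalIntegrable (by fun_prop) _ _)
    (Continuous.intervalIntegrable (by fun_prop) _ _) fun r hr => ?_
  have := mul_le_mul_of_nonneg_right (hle r hr) (sq_nonneg (f r))
  linarith

/-- `exists_slack` away from the origin, where the quadratic bound is automatic. -/
lemma exists_slack_of_pos {V S S' : ℝ → ℝ} {a b : ℝ} (ha : 0 < a) (hab : a < b)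
    (hS : ∀ r ∈ Set.Icc a b, HasDerivAt S (S' r) r)
    (hle : ∀ r ∈ Set.Ioo a b, S' r + S r ^ 2 / r ^ 2 ≤ V r) :
    ∃ c, 0 < c ∧ ∀ V₂ : ℝ → ℝ, Continuous V₂ → (∀ r ∈ Set.Ioo a b, V r - c * r ^ 2 ≤ V₂ r) →
      ∀ f f' : ℝ → ℝ, (∀ r, HasDerivAt f (f' r) r) → Continuous f' → (a = 0 ∨ f a = 0) →
        (f b = 0 ∨ 0 < S b) → 0 ≤ rform V₂ f f' a b := by
  have hc : ContinuousOn S (Set.Icc a b) := fun r hr => (hS r hr).continuousAt.continuousWithinAt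
  obtain ⟨M, hM⟩ := isCompact_Icc.bddAbove_image hc.abs
  refine exists_slack (K := M / a ^ 2) ha.le hab hc (fun r hr => hS r ⟨hr.1.le, hr.2.le⟩) hle
    (fun r hr => ?_)
  have h1 : |S r| ≤ M := hM ⟨r, hr, rfl⟩
  have h2 : a ^ 2 ≤ r ^ 2 := by have := hr.1; gcongr
  have h3 : 0 ≤ M := (abs_nonneg _).trans h1
  calc |S r| ≤ M / a ^ 2 * a ^ 2 := by rw [div_mul_cancel₀ _ (by positivity)]; exact h1
    _ ≤ _ := by gcongr

/-- The radial potential `k + (1 - (p + c) u^(p-1)) r²`. -/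
def radPot (p : ℝ) (u : ℝ → ℝ) (c k r : ℝ) : ℝ := k + (1 - (p + c) * pot p u r) * r ^ 2

lemma radPot_slack {p : ℝ} {u : ℝ → ℝ} {M c c₁ k r : ℝ} (hM : 0 < M)
    (hb : ∀ r, 0 ≤ r → pot p u r ≤ M) (hr : 0 ≤ r)
    (hc0 : 0 ≤ c) (hc : c ≤ c₁ / M) : radPot p u 0 k r - c₁ * r ^ 2 ≤ radPot p u c k r := by
  rw [le_div_iff₀ hM] at hc
  have h1 := mul_le_mul_of_nonneg_left (hb r hr) hc0
  have h2 : c * pot p u r ≤ c₁ := h1.trans hc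
  have := mul_le_mul_of_nonneg_right h2 (sq_nonneg r)
  simp only [radPot]
  nlinarith

/-- Riccati equation for `r² y' / y - r` when `y'' = (1 - p u^(p-1)) y`. -/
lemma hasDeriv_riccati {p : ℝ} {u y y' : ℝ → ℝ} {r : ℝ} (hr : 0 < r) (hy0 : y r ≠ 0)
    (hy : HasDerivAt y (y' r) r) (hy' : HasDerivAt y' ((1 - p * pot p u r) * y r) r) :
    HasDerivAt (fun r => r ^ 2 * y' r / y r - r)
      (radPot p u 0 0 r - (r ^ 2 * y' r / y r - r) ^ 2 / r ^ 2) r := by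
  refine ((((hasDerivAt_pow 2 r).mul hy').div hy hy0).sub (hasDerivAt_id r)).congr_deriv ?_
  simp only [radPot, Pi.mul_apply]
  field_simp
  ring

namespace Profile

variable {p : ℝ} {u u' u'' z z' : ℝ → ℝ}

lemma cont_radPot (h : Profile p u u' u'') (c k : ℝ) : Continuous (radPot p u c k) := by
  have := h.pot_cont
  unfold radPot
  fun_prop

lemma exists_radPot_nonneg (h : Profile p u u' u'') :
    ∃ R, ∀ r c k, R ≤ r → c ≤ 1 → 0 ≤ k → 0 ≤ radPot p u c k r := by
  have hp := h.one_lt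
  obtain ⟨R1, hR1⟩ := eventually_atTop.1
    (h.tendsto_pot.eventually (gt_mem_nhds (show 0 < 1 / (p + 1) by positivity)))
  refine ⟨R1, fun r c k hr hc hk => ?_⟩
  have h1 := hR1 r hr
  rw [lt_div_iff₀ (by positivity)] at h1
  have h2 := h.pot_pos r
  have : 0 ≤ 1 - (p + c) * pot p u r := by nlinarith
  rw [radPot]
  positivity

lemma exists_slack_inner (h : Profile p u u' u'') (hz : LinearizedSol p u z z') {a : ℝ} (ha : 0 < a)
    (hpos : ∀ r, 0 < r → r ≤ a → 0 < z r) :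
    ∃ c, 0 < c ∧ ∀ V₂ : ℝ → ℝ, Continuous V₂ →
      (∀ r ∈ Set.Ioo 0 a, radPot p u 0 0 r - c * r ^ 2 ≤ V₂ r) →
      ∀ f f' : ℝ → ℝ, (∀ r, HasDerivAt f (f' r) r) → Continuous f' → f a = 0 →
        0 ≤ rform V₂ f f' 0 a := by
  have hzc := hz.cont
  have hz'c := hz.cont'
  have hW := h.pot_cont
  -- lower bound `m r ≤ z`
  obtain ⟨ε, hε, hεz⟩ := hz.exists_pos
  obtain ⟨m, hm, hmz⟩ : ∃ m, 0 < m ∧ ∀ r, 0 < r → r ≤ a → m * r ≤ z r := by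
    obtain ⟨x, hx, hmin⟩ := (isCompact_Icc (a := min ε a) (b := a)).exists_isMinOn
      ⟨a, min_le_right _ _, le_rfl⟩ hzc.continuousOn
    have hx0 : 0 < x := (lt_min hε ha).trans_le hx.1
    have hzx := hpos x hx0 hx.2
    refine ⟨min (1 / 2) (z x / a), lt_min (by norm_num) (by positivity), fun r hr hra => ?_⟩
    rcases le_total r ε with h1 | h1
    · have := hεz r hr h1
      have := min_le_left (1 / 2) (z x / a)
      nlinarith
    · have h2 : z x ≤ z r := hmin ⟨(min_le_left _ _).trans h1, hra⟩
      calc min (1 / 2) (z x / a) * r ≤ z x / a * a := by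
            gcongr; exact min_le_right _ _
        _ = z x := div_mul_cancel₀ _ ha.ne'
        _ ≤ z r := h2
  obtain ⟨B, hB⟩ := (isCompact_Icc (a := (0 : ℝ)) (b := a)).bddAbove_image
    (f := fun r => |(1 - p * pot p u r) * z r|) (Continuous.continuousOn (by fun_prop))
  have hB' : ∀ r, 0 ≤ r → r ≤ a → |(1 - p * pot p u r) * z r| ≤ B := fun r h1 h2 =>
    hB ⟨r, ⟨h1, h2⟩, rfl⟩
  have hB0 : 0 ≤ B := (abs_nonneg _).trans (hB' 0 le_rfl ha.le)
  have hDd : ∀ r, 0 ≤ r → HasDerivAt (fun r => r * z' r - z r)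
      (r * ((1 - p * pot p u r) * z r)) r := by
    intro r hr
    refine (((hasDerivAt_id r).mul (hz.hasDeriv' r hr)).sub (hz.hasDeriv r)).congr_deriv ?_
    simp
  have hD : ∀ r, 0 ≤ r → r ≤ a → |r * z' r - z r| ≤ B * r ^ 2 := by
    intro r hr hra
    have e := fun x : ℝ => (hasDerivAt_pow 2 x).const_mul B
    have h1 := le_of_hasDerivAt_nonneg (f := fun x => B * x ^ 2 - (x * z' x - z x)) hr
      (by fun_prop) (fun x hx => (e x).sub (hDd x hx.1.le)) (fun x hx => by
        have h1 := (abs_le.1 (hB' x hx.1.le (hx.2.le.trans hra))).2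
        have h2 := hx.1
        have h3 := mul_le_mul_of_nonneg_left h1 h2.le
        have h4 : 0 ≤ B * x := by positivity
        norm_num
        linarith)
    have h2 := le_of_hasDerivAt_nonneg (f := fun x => B * x ^ 2 + (x * z' x - z x)) hr
      (by fun_prop) (fun x hx => (e x).add (hDd x hx.1.le)) (fun x hx => by
        have h1 := (abs_le.1 (hB' x hx.1.le (hx.2.le.trans hra))).1
        have h2 := hx.1
        have h3 := mul_le_mul_of_nonneg_left h1 h2.le
        have h4 : 0 ≤ B * x := by positivity
        norm_num
        linarith)
    simp only [hz.zero] at h1 h2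
    norm_num at h1 h2
    rw [abs_le]
    constructor <;> linarith
  have hK : ∀ r ∈ Set.Icc 0 a, |r ^ 2 * z' r / z r - r| ≤ B / m * r ^ 2 := by
    intro r hr
    rcases hr.1.eq_or_lt with rfl | h0
    · simp
    · have h1 := hmz r h0 hr.2
      have h2 := hpos r h0 hr.2
      have h3 : r ^ 2 * z' r / z r - r = r * (r * z' r - z r) / z r := by field_simp
      rw [h3, abs_div, abs_mul, abs_of_pos h0, abs_of_pos h2, div_le_iff₀ h2]
      calc r * |r * z' r - z r| ≤ r * (B * r ^ 2) := by
            have := hD r hr.1 hr.2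
            gcongr
        _ = B / m * r ^ 2 * (m * r) := by field_simp
        _ ≤ _ := by gcongr
  have hder : ∀ r, 0 < r → r ≤ a → HasDerivAt (fun r => r ^ 2 * z' r / z r - r)
      (radPot p u 0 0 r - (r ^ 2 * z' r / z r - r) ^ 2 / r ^ 2) r := fun r hr hra =>
    hasDeriv_riccati hr (hpos r hr hra).ne' (hz.hasDeriv r) (hz.hasDeriv' r hr.le)
  have hcont : ContinuousOn (fun r => r ^ 2 * z' r / z r - r) (Set.Icc 0 a) := by
    intro r hr
    rcases hr.1.eq_or_lt with rfl | h0
    · have h1 : Tendsto (fun r => B / m * r ^ 2) (𝓝[Set.Icc 0 a] 0) (𝓝 0) := by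
        have : Continuous fun r : ℝ => B / m * r ^ 2 := by fun_prop
        simpa using (this.tendsto 0).mono_left (nhdsWithin_le_nhds (s := Set.Icc 0 a))
      have := squeeze_zero_norm' (f := fun r => r ^ 2 * z' r / z r - r)
        (eventually_nhdsWithin_of_forall hK) h1
      simpa [ContinuousWithinAt] using this
    · exact (hder r h0 hr.2).continuousAt.continuousWithinAt
  obtain ⟨c, hc, H⟩ := exists_slack (V := radPot p u 0 0) le_rfl ha hcont
    (fun r hr => hder r hr.1 hr.2.le) (fun r hr => by simp) hK
  exact ⟨c, hc, fun V₂ hV₂ hle f f' hf hf' hfa => H V₂ hV₂ hle f f' hf hf' (Or.inl rfl) (Or.inl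
    hfa)⟩

/-- A positive solution near `[n, R]` with the right sign of the Riccati function at `R`, where `n`
lies in the interval on which `z` is positive. -/
lemma exists_outer_solution (h : Profile p u u' u'') (hz : LinearizedSol p u z z') (R1 : ℝ) :
    ∃ n R : ℝ, ∃ y y' : ℝ → ℝ, 0 < n ∧ n < R ∧ R1 ≤ R ∧ (∀ r, 0 < r → r ≤ n → 0 < z r) ∧
      (∀ r, HasDerivAt y (y' r) r) ∧
      (∀ r, 0 ≤ r → HasDerivAt y' ((1 - p * pot p u r) * y r) r) ∧
      (∀ r ∈ Set.Icc n R, 0 < y r) ∧ 0 < R * y' R - y R := by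
  obtain ⟨ρ, hρ, hzρ, hz'ρ, hpos, hneg, -⟩ := h.exists_node hz
  obtain ⟨R2, hR2⟩ := h.exists_descent hz
  obtain ⟨R, hR, -, hRd⟩ := hR2 (max (max (ρ + 1) R1) R2) (le_max_right _ _)
  have hρR : ρ < R := by
    have := (le_max_left _ _).trans ((le_max_left _ _).trans hR)
    linarith
  have hR1 : R1 ≤ R := (le_max_right _ _).trans ((le_max_left _ _).trans hR)
  obtain ⟨y, y', hy0, hy'0, hy, hyc, hy'⟩ := h.exists_linearized 1 0
  have hyct : Continuous y := continuous_iff_continuousAt.2 fun r => (hy r).continuousAt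
  have hzc := hz.cont
  have hz'c := hz.cont'
  have hw : ∀ r, 0 ≤ r → y r * z' r - z r * y' r = 1 := by
    intro r hr
    have hd : ∀ x, 0 ≤ x → HasDerivAt (fun r => y r * z' r - z r * y' r) 0 x := fun x hx => by
      refine (((hy x).mul (hz.hasDeriv' x hx)).sub ((hz.hasDeriv x).mul (hy' x hx))).congr_deriv ?_
      ring
    have h1 := le_of_hasDerivAt_nonneg hr (by fun_prop) (fun x hx => hd x hx.1.le) (by simp)
    have h2 := le_of_hasDerivAt_nonpos hr (by fun_prop) (fun x hx => hd x hx.1.le) (by simp)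
    simp only [hy0, hz.deriv_zero, hz.zero] at h1 h2
    linarith
  have hyρ : y ρ < 0 := by
    have := hw ρ hρ.le
    rw [hzρ, zero_mul, sub_zero] at this
    by_contra! hc
    nlinarith
  have hzR := hneg R hρR
  set κ := y R / z R with hκ
  obtain ⟨ε, hε, hε1, hε2⟩ : ∃ ε, 0 < ε ∧ 0 < 1 + ε * κ ∧
      0 < -(R * z' R - z R) - ε * (R * y' R - y R) := by
    have h1 : ∀ᶠ ε in 𝓝[>] (0 : ℝ), 0 < 1 + ε * κ := by
      refine ((by fun_prop : Continuous fun ε : ℝ => 1 + ε * κ).tendsto 0).mono_left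
        nhdsWithin_le_nhds |>.eventually (lt_mem_nhds (by simp))
    have h2 : ∀ᶠ ε in 𝓝[>] (0 : ℝ), 0 < -(R * z' R - z R) - ε * (R * y' R - y R) := by
      refine ((by fun_prop : Continuous fun ε : ℝ =>
        -(R * z' R - z R) - ε * (R * y' R - y R)).tendsto 0).mono_left
        nhdsWithin_le_nhds |>.eventually (lt_mem_nhds (by simpa using hRd))
    obtain ⟨ε, ⟨ha, hb⟩, hc⟩ := ((h1.and h2).and self_mem_nhdsWithin).exists
    exact ⟨ε, hc, ha, hb⟩
  have hYρ : 0 < -z ρ - ε * y ρ := by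
    rw [hzρ]; nlinarith
  obtain ⟨δ, hδ, hball⟩ := Metric.eventually_nhds_iff.1
    (((by fun_prop : Continuous fun r => -z r - ε * y r).tendsto ρ).eventually (lt_mem_nhds hYρ))
  have hn1 : max (ρ - δ / 2) (ρ / 2) < ρ := max_lt (by linarith) (by linarith)
  have hn0 : 0 < max (ρ - δ / 2) (ρ / 2) := lt_max_of_lt_right (by linarith)
  refine ⟨max (ρ - δ / 2) (ρ / 2), R, fun r => -z r - ε * y r, fun r => -z' r - ε * y' r,
    hn0, hn1.trans hρR, hR1, fun r hr hrn => hpos r hr (hrn.trans_lt hn1),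
    fun r => (hz.hasDeriv r).neg.sub ((hy r).const_mul ε), fun r hr => ?_, fun r hr => ?_, ?_⟩
  · refine ((hz.hasDeriv' r hr).neg.sub ((hy' r hr).const_mul ε)).congr_deriv ?_
    ring
  · rcases le_or_gt r ρ with h1 | h1
    · have h2 := (le_max_left _ _).trans hr.1
      refine hball ?_
      rw [Real.dist_eq, abs_lt]
      constructor <;> linarith
    · have h2 : κ ≤ y r / z r := by
        have hd : ∀ x, ρ < x → HasDerivAt (fun r => y r / z r) (-1 / z x ^ 2) x := fun x hx => by
          refine ((hy x).div (hz.hasDeriv x) (hneg x hx).ne).congr_deriv ?_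
          rw [← hw x (hρ.trans hx).le]
          ring
        exact le_of_hasDerivAt_nonpos hr.2
          (fun x hx => (hd x (h1.trans_le hx.1)).continuousAt.continuousWithinAt)
          (fun x hx => hd x (h1.trans hx.1)) (fun x hx =>
            div_nonpos_of_nonpos_of_nonneg (by norm_num) (sq_nonneg _))
      have h3 := hneg r h1
      have h4 : 0 < 1 + ε * (y r / z r) := by nlinarith
      have hz0 := h3.ne
      have h5 : -z r - ε * y r = -z r * (1 + ε * (y r / z r)) := by
        field_simp
        ring
      simp only [h5]
      exact mul_pos (by linarith) h4
  · linarith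

/-- Nonnegativity of the form on functions vanishing at the node `n`. -/
lemma exists_node_form_nonneg (h : Profile p u u' u'') :
    ∃ c₀, 0 < c₀ ∧ c₀ ≤ 1 ∧ ∃ n T₀, 0 < n ∧ n < T₀ ∧
    ∀ c T, 0 ≤ c → c ≤ c₀ → T₀ ≤ T → ∀ f f' : ℝ → ℝ, (∀ r, HasDerivAt f (f' r) r) →
      Continuous f' → f n = 0 → 0 ≤ rform (radPot p u c 0) f f' 0 T := by
  obtain ⟨z, z', hz⟩ := h.exists_linearizedSol
  obtain ⟨Rt, hRt⟩ := h.exists_radPot_nonneg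
  obtain ⟨M, hM, hb⟩ := h.exists_pot_bound
  obtain ⟨n, R, y, y', hn, hnR, hR1, hzpos, hy, hy', hypos, hSR⟩ := h.exists_outer_solution hz Rt
  obtain ⟨c₁, hc₁, H1⟩ := h.exists_slack_inner hz hn hzpos
  obtain ⟨c₂, hc₂, H2⟩ := exists_slack_of_pos (V := radPot p u 0 0)
    (S := fun r => r ^ 2 * y' r / y r - r) hn hnR
    (fun r hr => hasDeriv_riccati (hn.trans_le hr.1) (hypos r hr).ne' (hy r)
      (hy' r (hn.le.trans hr.1))) (fun r hr => by simp)
  refine ⟨min 1 (min (c₁ / M) (c₂ / M)), by positivity, min_le_left _ _, n, R, hn, hnR,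
    fun c T hc hcc hT f f' hf hf' hfn => ?_⟩
  have hV := h.cont_radPot c 0
  have e1 : c ≤ 1 := hcc.trans (min_le_left _ _)
  have e2 : c ≤ c₁ / M := hcc.trans ((min_le_right _ _).trans (min_le_left _ _))
  have e3 : c ≤ c₂ / M := hcc.trans ((min_le_right _ _).trans (min_le_right _ _))
  rw [← rform_add (b := n) hV hf hf', ← rform_add (b := R) (a := n) hV hf hf']
  have k1 := H1 _ hV (fun r hr => radPot_slack hM hb hr.1.le hc e2) f f' hf hf' hfn
  have k2 := H2 _ hV (fun r hr => radPot_slack hM hb (hn.trans hr.1).le hc e3) f f' hf hf'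
    (Or.inr hfn) (Or.inr (by
      have h1 := hypos R ⟨hnR.le, le_rfl⟩
      have h2 : R ^ 2 * y' R / y R - R = R * (R * y' R - y R) / y R := by field_simp
      have := hn.trans hnR
      simp only [h2]
      positivity))
  have k3 : 0 ≤ rform (radPot p u c 0) f f' R T :=
    rform_nonneg hT fun r hr => hRt r c 0 (hR1.trans hr.1) e1 le_rfl
  linarith

/-- Coercivity in the radial sector. -/
lemma exists_form_zero (h : Profile p u u' u'') : ∃ c₀, 0 < c₀ ∧ c₀ ≤ 1 ∧ ∃ T₀, 0 < T₀ ∧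
    ∀ c T, 0 ≤ c → c ≤ c₀ → T₀ ≤ T → ∀ f f' : ℝ → ℝ, (∀ r, HasDerivAt f (f' r) r) →
      Continuous f' → f T = 0 → ∫ r in (0 : ℝ)..T, pot p u r * r ^ 2 * u r * f r = 0 →
        0 ≤ rform (radPot p u c 0) f f' 0 T := by
  obtain ⟨c₀, hc₀, hc1, n, T₀, hn, hT₀, H⟩ := h.exists_node_form_nonneg
  refine ⟨c₀, hc₀, hc1, T₀, hn.trans hT₀, fun c T hc hcc hT f f' hf hf' hfT horth => ?_⟩
  have hT0 : 0 < T := (hn.trans hT₀).trans_le hT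
  have hp := h.one_lt
  have hWc := h.pot_cont
  have huc' := h.cont'
  have hun := h.pos n
  refine le_trans (H c T hc hcc hT (fun r => f r - f n / u n * u r)
    (fun r => f' r - f n / u n * u' r) (fun r => (hf r).sub ((h.hasDeriv r).const_mul _))
    (by fun_prop) (by field_simp; ring)) ?_
  refine rform_sub_le (wt := fun r => pot p u r * r ^ 2) (m := p - 1 + c) hT0 (h.cont_radPot c 0)
    (by fun_prop) hf hf' h.hasDeriv h.cont' (fun r hr => ?_) (by linarith) (fun r hr => ?_) hfT
    horth (h.pos T).le (h.deriv_neg hT0).le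
  · refine ((hasDerivAt_pow 2 r).mul (h.hasDeriv' r)).congr_deriv ?_
    have := h.ode' hr.le
    simp only [radPot]
    norm_num
    linear_combination r * this
  · have := h.pot_pos r
    positivity

lemma hasDeriv_sq_mul (h : Profile p u u' u'') {r : ℝ} (hr : 0 < r) :
    HasDerivAt (fun r => r ^ 2 * u'' r) (radPot p u 0 2 r * u' r) r := by
  have hev : (fun r => r ^ 2 * u'' r) =ᶠ[𝓝 r] fun r => r ^ 2 * ((1 - pot p u r) * u r) - 2 * r *
    u' r := by
    filter_upwards [lt_mem_nhds hr] with x hx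
    have := h.ode' hx.le
    linear_combination x * this
  refine HasDerivAt.congr_of_eventuallyEq ?_ hev
  refine (((hasDerivAt_pow 2 r).mul (((h.hasDeriv_pot r).const_sub 1).mul (h.hasDeriv r))).sub
    (((hasDerivAt_id r).const_mul 2).mul (h.hasDeriv' r))).congr_deriv ?_
  have h1 := h.ode' hr.le
  have h2 := (h.pos r).ne'
  simp only [radPot, Pi.mul_apply]
  norm_num
  field_simp
  linear_combination -2 * h1

lemma hasDeriv_riccati_one (h : Profile p u u' u'') {r : ℝ} (hr : 0 < r) :
    HasDerivAt (fun r => r ^ 2 * u'' r / u' r)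
      (radPot p u 0 2 r - (r ^ 2 * u'' r / u' r) ^ 2 / r ^ 2) r := by
  have h1 := (h.deriv_neg hr).ne
  refine ((h.hasDeriv_sq_mul hr).div (h.hasDeriv' r) h1).congr_deriv ?_
  field_simp

/-- Nonnegativity of the form in the sectors of degree at least two. -/
lemma exists_form_two (h : Profile p u u' u'') : ∃ c₀, 0 < c₀ ∧ c₀ ≤ 1 ∧
    ∀ c T, 0 ≤ c → c ≤ c₀ → 0 < T → ∀ f f' : ℝ → ℝ, (∀ r, HasDerivAt f (f' r) r) →
      Continuous f' → f T = 0 → 0 ≤ rform (radPot p u c 6) f f' 0 T := by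
  obtain ⟨K, hK, hKb⟩ : ∃ K, 0 < K ∧ ∀ r, 0 ≤ r → r ^ 2 * pot p u r ≤ K := by
    obtain ⟨R, hR⟩ := eventually_atTop.1
      (h.tendsto_sq_mul_pot.eventually (gt_mem_nhds (show (0 : ℝ) < 1 by norm_num)))
    have := h.pot_cont
    obtain ⟨B, hB⟩ := (isCompact_Icc (a := (0 : ℝ)) (b := R)).bddAbove_image
      (f := fun r => r ^ 2 * pot p u r) (Continuous.continuousOn (by fun_prop))
    refine ⟨max 1 B, by positivity, fun r hr => ?_⟩
    rcases le_total r R with h1 | h1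
    · exact (hB ⟨r, ⟨hr, h1⟩, rfl⟩).trans (le_max_right _ _)
    · exact (hR r h1).le.trans (le_max_left _ _)
  refine ⟨min 1 (4 / K), by positivity, min_le_left _ _, fun c T hc hcc hT f f' hf hf' hfT => ?_⟩
  have hcK : c ≤ 4 / K := hcc.trans (min_le_right _ _)
  rw [le_div_iff₀ hK] at hcK
  have hcont : ContinuousOn (fun r => r ^ 2 * u'' r / u' r) (Set.Icc 0 T) := by
    intro r hr
    rcases hr.1.eq_or_lt with rfl | h0
    · have h1 : Tendsto (fun r : ℝ => r * u'' r / (u' r / r)) (𝓝[>] 0) (𝓝 (0 * u'' 0 / u'' 0)) :=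
        (((continuous_id.mul h.cont'').tendsto 0).mono_left nhdsWithin_le_nhds).div
          h.tendsto_deriv_div h.second_deriv_zero.ne
      have h2 : ContinuousWithinAt (fun r => r ^ 2 * u'' r / u' r) (Set.Ioi 0) 0 := by
        simp only [zero_mul, zero_div] at h1
        rw [ContinuousWithinAt]
        simp only [ne_eq, OfNat.ofNat_ne_zero, not_false_eq_true, zero_pow, zero_mul, zero_div]
        refine h1.congr' ?_
        filter_upwards [self_mem_nhdsWithin] with x hx
        have hx0 : (0 : ℝ) < x := hx
        have := (h.deriv_neg hx0).ne
        field_simp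
      exact (continuousWithinAt_Ioi_iff_Ici.1 h2).mono fun x hx => hx.1
    · exact (h.hasDeriv_riccati_one h0).continuousAt.continuousWithinAt
  have key := le_rform_of_riccati (V := radPot p u 0 2) le_rfl hT.le (h.cont_radPot 0 2) hf hf'
    hcont (fun r hr => h.hasDeriv_riccati_one hr.1) (fun r hr => by simp)
  simp only [hfT, ne_eq, OfNat.ofNat_ne_zero, not_false_eq_true, zero_pow, mul_zero, zero_mul,
    zero_div, sub_zero] at key
  refine key.trans (rform_mono hT.le (h.cont_radPot 0 2) (h.cont_radPot c 6) hf hf' fun r hr => ?_)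
  have := mul_le_mul_of_nonneg_left (hKb r hr.1) hc
  simp only [radPot]
  linarith

lemma exists_second_deriv_pos (h : Profile p u u' u'') : ∃ R, 0 < R ∧ ∀ r, R ≤ r → 0 < u'' r := by
  obtain ⟨R, hR⟩ := eventually_atTop.1
    (h.tendsto_pot.eventually (gt_mem_nhds (show (0 : ℝ) < 1 by norm_num)))
  refine ⟨max R 1, by positivity, fun r hr => ?_⟩
  have h1 := hR r ((le_max_left _ _).trans hr)
  have hr0 : 0 < r := lt_of_lt_of_le one_pos ((le_max_right _ _).trans hr)
  rw [h.second_deriv hr0]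
  have h2 := h.pos r
  have h3 := h.deriv_neg hr0
  have h4 : 0 < (1 - pot p u r) * u r := mul_pos (by linarith) h2
  have h5 : 2 * u' r / r ≤ 0 := div_nonpos_of_nonpos_of_nonneg (by linarith) hr0.le
  linarith

/-- A Riccati function for the degree one sector, positive far away. -/
lemma exists_riccati_one (h : Profile p u u' u'') {n : ℝ} (hn : 0 < n) (R1 : ℝ) :
    ∃ S S' : ℝ → ℝ, ∃ R, n < R ∧ R1 ≤ R ∧
    (∀ r, n ≤ r → HasDerivAt S (S' r) r) ∧
    (∀ r, n ≤ r → S' r + S r ^ 2 / r ^ 2 = radPot p u 0 2 r) ∧ 0 < S R := by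
  have huc' := h.cont'
  set g : ℝ → ℝ := fun s => 1 / ((max s n) ^ 2 * u' (max s n) ^ 2) with hg
  have hgpos : ∀ s, 0 < (max s n) ^ 2 * u' (max s n) ^ 2 := fun s => by
    have h1 : 0 < max s n := lt_max_of_lt_right hn
    have := pow_pos (neg_pos.2 (h.deriv_neg h1)) 2
    rw [neg_sq] at this
    positivity
  have hgc : Continuous g := continuous_const.div (by fun_prop) fun s => (hgpos s).ne'
  set G : ℝ → ℝ := fun r => 1 + ∫ s in n..r, g s with hG
  have hGd : ∀ r, n ≤ r → HasDerivAt G (1 / (r ^ 2 * u' r ^ 2)) r := fun r hr => by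
    have := ((hgc.integral_hasStrictDerivAt n r).hasDerivAt).const_add 1
    simpa only [hg, max_eq_left hr] using this
  have hGpos : ∀ r, n ≤ r → 0 < G r := fun r hr => by
    have := intervalIntegral.integral_nonneg (μ := volume) (f := g) hr fun s _ =>
      (one_div_pos.2 (hgpos s)).le
    simp only [hG]
    linarith
  have hu' : ∀ r, n ≤ r → u' r < 0 := fun r hr => h.deriv_neg (hn.trans_le hr)
  obtain ⟨R2, -, hR2⟩ := h.exists_second_deriv_pos
  obtain ⟨R, hnR, hRR, hpos⟩ : ∃ R, n < R ∧ R1 ≤ R ∧ 0 < R ^ 2 * u'' R * u' R * G R + 1 := by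
    by_contra! hcon
    set A := max (max (n + 1) R1) R2 with hA
    have hAn : n < A := lt_of_lt_of_le (lt_add_one n) ((le_max_left _ _).trans (le_max_left _ _))
    have hA1 : R1 ≤ A := (le_max_right _ _).trans (le_max_left _ _)
    have hA2 : R2 ≤ A := le_max_right _ _
    have hEd : ∀ r, A ≤ r → HasDerivAt (fun r => -u' r * G r)
        (-u'' r * G r + -u' r * (1 / (r ^ 2 * u' r ^ 2))) r := fun r hr =>
      (h.hasDeriv' r).neg.mul (hGd r (hAn.le.trans hr))
    have hE : ∀ r, A ≤ r → -u' r * G r ≤ -u' A * G A := fun r hr => by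
      refine le_of_hasDerivAt_nonpos hr
        (fun x hx => (hEd x hx.1).continuousAt.continuousWithinAt) (fun x hx => hEd x hx.1.le)
        (fun x hx => ?_)
      have h1 := hcon x (hAn.trans hx.1) (hA1.trans hx.1.le)
      have h2 := hu' x (hAn.le.trans hx.1.le)
      have hx0 : 0 < x := hn.trans (hAn.trans hx.1)
      have h3 : -u'' x * G x + -u' x * (1 / (x ^ 2 * u' x ^ 2)) =
          (x ^ 2 * u'' x * u' x * G x + 1) / (x ^ 2 * -u' x) := by
        have := h2.ne
        field_simp
        ring
      rw [h3]
      exact div_nonpos_of_nonpos_of_nonneg h1 (mul_nonneg (sq_nonneg _) (by linarith))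
    have hB : 0 < -u' A * G A := mul_pos (neg_pos.2 (hu' A hAn.le)) (hGpos A hAn.le)
    have hlim : Tendsto (fun r => r ^ 2 * u'' r) atTop (𝓝 0) := by
      have e1 := (h.tendsto_pow_mul 2).1
      have e2 := (h.tendsto_pow_mul 1).2
      have e3 := ((h.tendsto_pot.const_sub 1).mul e1).sub (e2.const_mul 2)
      simp only [sub_zero, mul_zero] at e3
      refine e3.congr' ?_
      filter_upwards [eventually_ge_atTop 0] with r hr
      have := h.ode' hr
      linear_combination -r * this
    obtain ⟨r, hr1, hr2⟩ := ((hlim.eventually (gt_mem_nhds (one_div_pos.2 hB))).and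
      (eventually_gt_atTop A)).exists
    have h1 := hcon r (hAn.trans hr2) (hA1.trans hr2.le)
    have h2 := hE r hr2.le
    have h3 : 0 < r ^ 2 * u'' r :=
      mul_pos (pow_pos (hn.trans (hAn.trans hr2)) 2) (hR2 r (hA2.trans hr2.le))
    rw [lt_div_iff₀ hB] at hr1
    have h4 := mul_le_mul_of_nonneg_left h2 h3.le
    nlinarith
  refine ⟨fun r => r ^ 2 * u'' r / u' r + 1 / (u' r ^ 2 * G r),
    fun r => radPot p u 0 2 r - (r ^ 2 * u'' r / u' r + 1 / (u' r ^ 2 * G r)) ^ 2 / r ^ 2,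
    R, hnR, hRR, fun r hr => ?_, fun r hr => by ring, ?_⟩
  · have h1 := (hu' r hr).ne
    have h2 := (hGpos r hr).ne'
    have hr0 : r ≠ 0 := (hn.trans_le hr).ne'
    have h3 := (((h.hasDeriv' r).pow 2).mul (hGd r hr)).inv (by simp [h1, h2])
    refine ((h.hasDeriv_riccati_one (hn.trans_le hr)).add h3).congr_of_eventuallyEq
      (Eventually.of_forall fun x => by simp) |>.congr_deriv ?_
    simp only [Pi.mul_apply, Pi.pow_apply]
    field_simp
    ring
  · have h1 := hu' R hnR.le
    have h2 := hGpos R hnR.le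
    have h3 : R ^ 2 * u'' R / u' R + 1 / (u' R ^ 2 * G R) =
        (R ^ 2 * u'' R * u' R * G R + 1) / ((-u' R) ^ 2 * G R) := by
      have := h1.ne
      field_simp
    have h4 : 0 < -u' R := by linarith
    simp only [h3]
    positivity

/-- Nonnegativity in the degree one sector. -/
lemma exists_form_one (h : Profile p u u' u'') : ∃ c₀, 0 < c₀ ∧ c₀ ≤ 1 ∧ ∃ T₀, 0 < T₀ ∧
    ∀ c T, 0 ≤ c → c ≤ c₀ → T₀ ≤ T → ∀ f f' : ℝ → ℝ, (∀ r, HasDerivAt f (f' r) r) →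
      Continuous f' → f T = 0 → ∫ r in (0 : ℝ)..T, pot p u r * r ^ 2 * u' r * f r = 0 →
        0 ≤ rform (radPot p u c 2) f f' 0 T := by
  have hp := h.one_lt
  obtain ⟨Rt, hRt⟩ := h.exists_radPot_nonneg
  obtain ⟨M, hM, hb⟩ := h.exists_pot_bound
  obtain ⟨R2, -, hR2⟩ := h.exists_second_deriv_pos
  obtain ⟨n, hn, hnM⟩ : ∃ n : ℝ, 0 < n ∧ (p + 1) * M * n ^ 2 = 2 := by
    refine ⟨√(2 / ((p + 1) * M)), by positivity, ?_⟩
    rw [sq_sqrt (by positivity)]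
    field_simp
  obtain ⟨S, S', R, hnR, hR1, hS, hle, hSR⟩ := h.exists_riccati_one hn (max Rt R2)
  obtain ⟨c₂, hc₂, H2⟩ := exists_slack_of_pos (V := radPot p u 0 2) (S := S) hn hnR
    (fun r hr => hS r hr.1) (fun r hr => (hle r hr.1.le).le)
  refine ⟨min 1 (c₂ / M), by positivity, min_le_left _ _, R, hn.trans hnR,
    fun c T hc hcc hT f f' hf hf' hfT horth => ?_⟩
  have hT0 : 0 < T := (hn.trans hnR).trans_le hT
  have e1 : c ≤ 1 := hcc.trans (min_le_left _ _)
  have e2 : c ≤ c₂ / M := hcc.trans (min_le_right _ _)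
  have hWc := h.pot_cont
  have huc'' := h.cont''
  have hun := (neg_pos.2 (h.deriv_neg hn)).ne'
  have hV := h.cont_radPot c 2
  set t := f n / -u' n with ht
  refine le_trans ?_ (rform_sub_le (e := fun r => -u' r) (e' := fun r => -u'' r)
    (wt := fun r => pot p u r * r ^ 2) (m := c) (t := t) hT0 hV (by fun_prop) hf hf'
    (fun r => (h.hasDeriv' r).neg) (by fun_prop) (fun r hr => ?_) hc (fun r hr => ?_) hfT
    ?_ (neg_nonneg.2 (h.deriv_neg hT0).le)
    (neg_nonpos.2 (hR2 T ((le_max_right _ _).trans (hR1.trans hT))).le))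
  · have hgd : ∀ r, HasDerivAt (fun r => f r - t * -u' r) (f' r - t * -u'' r) r :=
      fun r => (hf r).sub ((h.hasDeriv' r).neg.const_mul t)
    have hgc : Continuous fun r => f' r - t * -u'' r := by fun_prop
    have hgn : f n - t * -u' n = 0 := by rw [ht, div_mul_cancel₀ _ hun, sub_self]
    rw [← rform_add (b := n) hV hgd hgc, ← rform_add (b := R) (a := n) hV hgd hgc]
    have k1 : 0 ≤ rform (radPot p u c 2) (fun r => f r - t * -u' r)
        (fun r => f' r - t * -u'' r) 0 n := rform_nonneg hn.le fun r hr => by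
      have h1 : (p + c) * pot p u r ≤ (p + 1) * M := by
        have := hb r hr.1
        have := (h.pot_pos r).le
        gcongr
      have h2 : (p + c) * pot p u r * r ^ 2 ≤ (p + 1) * M * n ^ 2 := by
        have := hr.1
        have := hr.2
        gcongr
      simp only [radPot]
      nlinarith [sq_nonneg r]
    have k2 := H2 _ hV (fun r hr => radPot_slack hM hb (hn.trans hr.1).le hc e2) _ _ hgd hgc
      (Or.inr hgn) (Or.inr hSR)
    have k3 : 0 ≤ rform (radPot p u c 2) (fun r => f r - t * -u' r)
        (fun r => f' r - t * -u'' r) R T :=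
      rform_nonneg hT fun r hr => hRt r c 2 ((le_max_left _ _).trans (hR1.trans hr.1))
        e1 (by norm_num)
    linarith
  · refine ((h.hasDeriv_sq_mul hr).neg.congr_of_eventuallyEq
      (Eventually.of_forall fun x => by simp)).congr_deriv ?_
    simp only [radPot]
    ring
  · have := h.pot_pos r
    positivity
  · rw [← neg_eq_zero, ← intervalIntegral.integral_neg]
    simpa using horth

/-- Nonnegativity of the slightly perturbed form in all angular sectors at once. -/
lemma exists_radial_forms_nonneg (h : Profile p u u' u'') :
    ∃ c T₀, 0 < c ∧ 0 < T₀ ∧ ∀ T, T₀ ≤ T → ∀ f f' : ℝ → ℝ,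
    (∀ r, HasDerivAt f (f' r) r) → Continuous f' → f T = 0 →
      (∫ r in (0 : ℝ)..T, pot p u r * r ^ 2 * u r * f r = 0 →
        0 ≤ rform (radPot p u c 0) f f' 0 T) ∧
      (∫ r in (0 : ℝ)..T, pot p u r * r ^ 2 * u' r * f r = 0 →
        0 ≤ rform (radPot p u c 2) f f' 0 T) ∧
      0 ≤ rform (radPot p u c 6) f f' 0 T := by
  obtain ⟨c₀, hc₀, -, S₀, hS₀, H₀⟩ := h.exists_form_zero
  obtain ⟨c₁, hc₁, -, S₁, hS₁, H₁⟩ := h.exists_form_one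
  obtain ⟨c₂, hc₂, -, H₂⟩ := h.exists_form_two
  have hc : 0 < min c₀ (min c₁ c₂) := lt_min hc₀ (lt_min hc₁ hc₂)
  refine ⟨min c₀ (min c₁ c₂), max S₀ S₁, hc, lt_max_of_lt_left hS₀,
    fun T hT f f' hf hf' hfT => ⟨?_, ?_, ?_⟩⟩
  · exact H₀ _ T hc.le (min_le_left _ _) ((le_max_left _ _).trans hT) f f' hf hf' hfT
  · exact H₁ _ T hc.le ((min_le_right _ _).trans (min_le_left _ _))
      ((le_max_right _ _).trans hT) f f' hf hf' hfT
  · exact H₂ _ T hc.le ((min_le_right _ _).trans (min_le_right _ _))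
      (hS₀.trans_le ((le_max_left _ _).trans hT)) f f' hf hf' hfT

end Profile

section Sphere

/-- Integral over the unit sphere of `ℝ³`. -/
def sint (F : E3 → ℝ) : ℝ :=
  ∫ ω : Metric.sphere (0 : E3) 1, F ω ∂(volume : Measure E3).toSphere

lemma integrable_sphere {F : E3 → ℝ} (hF : Continuous F) :
    Integrable (fun ω : Metric.sphere (0 : E3) 1 => F ω) (volume : Measure E3).toSphere :=
  (hF.comp continuous_subtype_val).integrable_of_hasCompactSupport
    (HasCompactSupport.of_compactSpace _)

/-- Integration in polar coordinates. -/
lemma integral_eq_integral_sint {F : E3 → ℝ} (hF : Continuous F) (hFs : HasCompactSupport F) :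
    ∫ x, F x = ∫ r in Set.Ioi (0 : ℝ), r ^ 2 * sint fun ω => F (r • ω) := by
  have hFint : Integrable (fun x : E3 => F x) := hF.integrable_of_hasCompactSupport hFs
  have hmp := (volume : Measure E3).measurePreserving_homeomorphUnitSphereProd
  have hemb := (homeomorphUnitSphereProd E3).measurableEmbedding
  set g : Metric.sphere (0 : E3) 1 × Set.Ioi (0 : ℝ) → ℝ := fun q => F ((q.2 : ℝ) • (q.1 : E3))
    with hg
  have hgc : ∀ x : ({0}ᶜ : Set E3), g (homeomorphUnitSphereProd E3 x) = F x := by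
    intro x
    have hx : ‖(x : E3)‖ ≠ 0 := norm_ne_zero_iff.2 x.2
    simp [hg, smul_smul, hx]
  have h1 : ∫ x, F x = ∫ x : ({0}ᶜ : Set E3), F x ∂((volume : Measure E3).comap (↑)) := by
    rw [integral_subtype_comap (measurableSet_singleton _).compl, restrict_compl_singleton]
  have hFint' : Integrable (fun x : ({0}ᶜ : Set E3) => F x) ((volume : Measure E3).comap (↑)) := by
    have := (integrableOn_iff_comap_subtypeVal (measurableSet_singleton (0 : E3)).compl
      (f := F) (μ := volume)).1 hFint.integrableOn
    exact this
  have hgi : Integrable g ((volume : Measure E3).toSphere.prod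
      (.volumeIoiPow (Module.finrank ℝ E3 - 1))) := by
    rw [← hmp.integrable_comp_emb hemb]
    exact hFint'.congr (Eventually.of_forall fun x => (hgc x).symm)
  rw [h1, ← integral_congr_ae (Eventually.of_forall hgc), hmp.integral_comp hemb,
    integral_prod_symm _ hgi, Measure.volumeIoiPow, integral_withDensity_eq_integral_toReal_smul]
  · rw [← integral_subtype_comap measurableSet_Ioi
      (fun r : ℝ => r ^ 2 * sint fun ω => F (r • ω))]
    refine integral_congr_ae (Eventually.of_forall fun r => ?_)
    have : (0 : ℝ) < r := r.2
    simp [hg, sint, ENNReal.toReal_ofReal, this.le]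
  · fun_prop
  · exact Eventually.of_forall fun _ => ENNReal.ofReal_lt_top

lemma integral_eq_intervalIntegral_sint {F : E3 → ℝ} (hF : Continuous F) {T : ℝ} (hT : 0 ≤ T)
    (hs : ∀ x, T ≤ ‖x‖ → F x = 0) :
    ∫ x, F x = ∫ r in (0 : ℝ)..T, r ^ 2 * sint fun ω => F (r • ω) := by
  have hc : HasCompactSupport F := HasCompactSupport.intro (isCompact_closedBall (0 : E3) T)
    fun x hx => hs x (by simpa using (not_le.1 (by simpa using hx)).le)
  rw [integral_eq_integral_sint hF hc, intervalIntegral.integral_of_le hT]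
  refine (setIntegral_eq_of_subset_of_forall_sdiff_eq_zero measurableSet_Ioi
    (fun x hx => hx.1) fun r hr => ?_)
  have hr0 : (0 : ℝ) < r := hr.1
  have hTr : T ≤ r := by
    by_contra! hcon
    exact hr.2 ⟨hr0, hcon.le⟩
  have : ∀ ω : Metric.sphere (0 : E3) 1, F (r • (ω : E3)) = 0 := fun ω => hs _ (by
    rw [norm_smul, norm_eq_of_mem_sphere, mul_one, norm_of_nonneg hr0.le]; exact hTr)
  simp [sint, this]

open scoped Pointwise in
/-- The sphere measure is invariant under linear isometries. -/
lemma sint_comp_isometry (L : E3 ≃ₗᵢ[ℝ] E3) {F : E3 → ℝ} (hF : Continuous F) :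
    sint (fun x => F (L x)) = sint F := by
  set φ : Metric.sphere (0 : E3) 1 → Metric.sphere (0 : E3) 1 :=
    fun ω => ⟨L ω, by simp⟩ with hφ
  have hφc : Continuous φ := by
    refine Continuous.subtype_mk ?_ _
    exact L.continuous.comp continuous_subtype_val
  have hmap : Measure.map φ (volume : Measure E3).toSphere = (volume : Measure E3).toSphere := by
    ext s hs
    rw [Measure.map_apply hφc.measurable hs, Measure.toSphere_apply' _ hs,
      Measure.toSphere_apply' _ (hφc.measurable hs)]
    congr 1
    have : Set.Ioo (0 : ℝ) 1 • ((↑) '' (φ ⁻¹' s) : Set E3) =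
        L.toMeasurableEquiv ⁻¹' (Set.Ioo (0 : ℝ) 1 • ((↑) '' s : Set E3)) := by
      ext x
      simp only [Set.mem_smul, Set.mem_image, Set.mem_preimage, Subtype.exists]
      constructor
      · rintro ⟨r, hr, y, ⟨ω, hω, h1, rfl⟩, rfl⟩
        exact ⟨r, hr, L ω, ⟨L ω, by simpa using hω, h1, rfl⟩, by simp⟩
      · rintro ⟨r, hr, y, ⟨ω, hω, h1, rfl⟩, h2⟩
        refine ⟨r, hr, L.symm ω, ⟨L.symm ω, by simpa using hω, ?_, rfl⟩, ?_⟩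
        · simpa [hφ] using h1
        · apply L.injective
          simpa using h2
    rw [this, L.measurePreserving.measure_preimage_equiv]
  have h1 : sint F = ∫ ω, F ω ∂(Measure.map φ (volume : Measure E3).toSphere) := by
    rw [hmap, sint]
  rw [h1, integral_map hφc.measurable.aemeasurable]
  · rfl
  · rw [hmap]
    exact (integrable_sphere hF).aestronglyMeasurable

end Sphere

section Rotations

lemma fin_three_cases (k : Fin 3) : k = 0 ∨ k = 1 ∨ k = 2 := by
  fin_cases k <;> simp

/-- Derivative along the rotations around the `k`-th axis. -/
def angD (k : Fin 3) (F : E3 → ℝ) (x : E3) : ℝ :=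
  x (k + 1) * pd F (k + 2) x - x (k + 2) * pd F (k + 1) x

/-- The rotation by the angle `t` around the `k`-th axis, as a function. -/
def rotFun (k : Fin 3) (t : ℝ) (x : E3) : E3 :=
  x k • EuclideanSpace.single k 1 +
    (cos t * x (k + 1) - sin t * x (k + 2)) • EuclideanSpace.single (k + 1) 1 +
    (sin t * x (k + 1) + cos t * x (k + 2)) • EuclideanSpace.single (k + 2) 1

lemma norm_rotFun (k : Fin 3) (t : ℝ) (x : E3) : ‖rotFun k t x‖ = ‖x‖ := by
  have h := sin_sq_add_cos_sq t
  rw [← sq_eq_sq₀ (norm_nonneg _) (norm_nonneg _), EuclideanSpace.real_norm_sq_eq,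
    EuclideanSpace.real_norm_sq_eq, Fin.sum_univ_three, Fin.sum_univ_three]
  obtain rfl | rfl | rfl := fin_three_cases k <;> simp [rotFun]
  · linear_combination (x 1 ^ 2 + x 2 ^ 2) * h
  · linear_combination (x 0 ^ 2 + x 2 ^ 2) * h
  · linear_combination (x 0 ^ 2 + x 1 ^ 2) * h

/-- The rotation by the angle `t` around the `k`-th axis. -/
def rot (k : Fin 3) (t : ℝ) : E3 ≃ₗᵢ[ℝ] E3 :=
  LinearIsometry.toLinearIsometryEquiv
    { toFun := rotFun k t
      map_add' := fun x y => by
        simp only [rotFun, PiLp.add_apply]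
        module
      map_smul' := fun c x => by
        simp only [rotFun, PiLp.smul_apply, smul_eq_mul, RingHom.id_apply]
        module
      norm_map' := norm_rotFun k t } rfl

lemma rot_apply (k : Fin 3) (t : ℝ) (x : E3) : rot k t x = rotFun k t x := rfl

lemma rot_zero (k : Fin 3) (x : E3) : rot k 0 x = x := by
  rw [rot_apply]
  ext i
  obtain rfl | rfl | rfl := fin_three_cases k <;> obtain rfl | rfl | rfl := fin_three_cases i <;>
    simp [rotFun]

lemma hasDerivAt_comp_rot {F : E3 → ℝ} (hF : Differentiable ℝ F) (k : Fin 3) (x : E3) (t : ℝ) :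
    HasDerivAt (fun t => F (rot k t x)) (angD k F (rot k t x)) t := by
  have h1 : HasDerivAt (fun t => rot k t x)
      ((rot k t x (k + 1)) • EuclideanSpace.single (k + 2) 1 -
        (rot k t x (k + 2)) • EuclideanSpace.single (k + 1) 1) t := by
    have e1 := (((hasDerivAt_cos t).mul_const (x (k + 1))).sub
      ((hasDerivAt_sin t).mul_const (x (k + 2)))).smul_const
        (EuclideanSpace.single (k + 1) (1 : ℝ) : E3)
    have e2 := (((hasDerivAt_sin t).mul_const (x (k + 1))).add
      ((hasDerivAt_cos t).mul_const (x (k + 2)))).smul_const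
        (EuclideanSpace.single (k + 2) (1 : ℝ) : E3)
    refine ((e1.const_add (x k • (EuclideanSpace.single k (1 : ℝ) : E3))).add e2).congr_deriv ?_
    have c1 : rotFun k t x (k + 1) = cos t * x (k + 1) - sin t * x (k + 2) := by
      obtain rfl | rfl | rfl := fin_three_cases k <;> simp [rotFun]
    have c2 : rotFun k t x (k + 2) = sin t * x (k + 1) + cos t * x (k + 2) := by
      obtain rfl | rfl | rfl := fin_three_cases k <;> simp [rotFun]
    rw [rot_apply, c1, c2]
    module
  refine ((hF _).hasFDerivAt.comp_hasDerivAt t h1).congr_deriv ?_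
  simp [angD, pd]

lemma continuous_pd {F : E3 → ℝ} (hF : ContDiff ℝ 1 F) (i : Fin 3) : Continuous (pd F i) :=
  (hF.continuous_fderiv (by norm_num)).clm_apply continuous_const

lemma continuous_angD {F : E3 → ℝ} (hF : ContDiff ℝ 1 F) (k : Fin 3) : Continuous (angD k F) := by
  have h1 := continuous_pd hF (k + 1)
  have h2 := continuous_pd hF (k + 2)
  unfold angD
  fun_prop

/-- Fubini on `[a, b] × S²`. -/
lemma intervalIntegral_sint_swap {H : ℝ × E3 → ℝ} (hH : Continuous H) (a b : ℝ) :
    ∫ s in a..b, sint (fun x => H (s, x)) = sint fun x => ∫ s in a..b, H (s, x) := by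
  refine intervalIntegral_integral_swap ?_
  have hcc : Continuous fun q : ℝ × Metric.sphere (0 : E3) 1 => H (q.1, q.2) :=
    hH.comp (by fun_prop)
  have h3 : (volume.restrict (Set.uIoc a b)).prod (volume : Measure E3).toSphere =
      (volume.prod (volume : Measure E3).toSphere).restrict (Set.uIoc a b ×ˢ Set.univ) := by
    rw [← Measure.prod_restrict, Measure.restrict_univ]
  rw [h3]
  exact (hcc.continuousOn.integrableOn_compact (isCompact_uIcc.prod isCompact_univ)).mono_set
    (Set.prod_mono Set.uIoc_subset_uIcc le_rfl)

/-- Angular derivatives integrate to zero over the sphere. -/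
lemma sint_angD {F : E3 → ℝ} (hF : ContDiff ℝ 1 F) (k : Fin 3) : sint (angD k F) = 0 := by
  have hc := continuous_angD hF k
  have hrc : Continuous fun q : ℝ × E3 => rot k q.1 q.2 := by
    simp only [rot_apply, rotFun]
    fun_prop
  have h1 : ∀ ω : E3, ∫ s in (0 : ℝ)..1, angD k F (rot k s ω) = F (rot k 1 ω) - F ω := by
    intro ω
    rw [intervalIntegral.integral_eq_sub_of_hasDerivAt
      (fun t _ => hasDerivAt_comp_rot (hF.differentiable (by norm_num)) k ω t), rot_zero]
    have : Continuous fun s => angD k F (rot k s ω) := hc.comp (by fun_prop)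
    exact this.intervalIntegrable _ _
  have h2 : ∫ s in (0 : ℝ)..1, sint (fun x => angD k F (rot k s x)) =
      sint fun ω => ∫ s in (0 : ℝ)..1, angD k F (rot k s ω) := by
    exact intervalIntegral_sint_swap (H := fun q => angD k F (rot k q.1 q.2)) (hc.comp hrc) 0 1
  have h4 : (fun ω => ∫ s in (0 : ℝ)..1, angD k F (rot k s ω)) = fun ω => F (rot k 1 ω) - F ω :=
    funext h1
  have h5 : sint (fun ω => F (rot k 1 ω) - F ω) = sint (fun ω => F (rot k 1 ω)) - sint F :=
    integral_sub (integrable_sphere (hF.continuous.comp (rot k 1).continuous))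
      (integrable_sphere hF.continuous)
  rw [h4, h5, sint_comp_isometry _ hF.continuous, sub_self] at h2
  simpa [sint_comp_isometry _ hc] using h2

end Rotations

section SphereAlgebra

variable {F G : E3 → ℝ}

lemma sint_add (hF : Continuous F) (hG : Continuous G) :
    sint (fun x => F x + G x) = sint F + sint G :=
  integral_add (integrable_sphere hF) (integrable_sphere hG)

lemma sint_sub (hF : Continuous F) (hG : Continuous G) :
    sint (fun x => F x - G x) = sint F - sint G :=
  integral_sub (integrable_sphere hF) (integrable_sphere hG)

lemma sint_const_mul (c : ℝ) (F : E3 → ℝ) : sint (fun x => c * F x) = c * sint F :=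
  integral_const_mul c _

lemma sint_neg (F : E3 → ℝ) : sint (fun x => -F x) = -sint F :=
  integral_neg _

lemma sint_sum {ι : Type*} (s : Finset ι) {F : ι → E3 → ℝ} (hF : ∀ i, Continuous (F i)) :
    sint (fun x => ∑ i ∈ s, F i x) = ∑ i ∈ s, sint (F i) :=
  integral_finsetSum s fun i _ => integrable_sphere (hF i)

lemma sint_congr (h : ∀ x : E3, ‖x‖ = 1 → F x = G x) : sint F = sint G :=
  integral_congr_ae (Eventually.of_forall fun ω => h ω (by simp))

lemma sint_nonneg (h : ∀ x : E3, ‖x‖ = 1 → 0 ≤ F x) : 0 ≤ sint F :=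
  integral_nonneg fun ω => h ω (by simp)

lemma sint_mono (hF : Continuous F) (hG : Continuous G) (h : ∀ x : E3, ‖x‖ = 1 → F x ≤ G x) :
    sint F ≤ sint G :=
  integral_mono (integrable_sphere hF) (integrable_sphere hG) fun ω => h ω (by simp)

/-- Area of the unit sphere. -/
def sphereArea : ℝ := sint fun _ => 1

lemma sphereArea_pos : 0 < sphereArea := by
  have h : (volume : Measure E3).toSphere ≠ 0 := Measure.toSphere_ne_zero _
  have h2 := Measure.measure_univ_pos.2 h
  simpa [sphereArea, sint, Measure.real] using ENNReal.toReal_pos h2.ne' (measure_ne_top _ _)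

lemma sint_const (c : ℝ) : sint (fun _ => c) = c * sphereArea := by
  rw [sphereArea, ← sint_const_mul]; simp

lemma pd_mul (hF : ContDiff ℝ 1 F) (hG : ContDiff ℝ 1 G) (i : Fin 3) (x : E3) :
    pd (fun x => F x * G x) i x = pd F i x * G x + F x * pd G i x := by
  have h := fderiv_fun_mul (hF.differentiable (by norm_num) x) (hG.differentiable (by norm_num) x)
  simp [pd, h]; ring

lemma pd_add (hF : ContDiff ℝ 1 F) (hG : ContDiff ℝ 1 G) (i : Fin 3) (x : E3) :
    pd (fun x => F x + G x) i x = pd F i x + pd G i x := by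
  have h := fderiv_fun_add (hF.differentiable (by norm_num) x) (hG.differentiable (by norm_num) x)
  simp [pd, h]

lemma pd_const (c : ℝ) (i : Fin 3) (x : E3) : pd (fun _ => c) i x = 0 := by
  simp [pd]

lemma contDiff_coord (j : Fin 3) {n : WithTop ℕ∞} : ContDiff ℝ n fun x : E3 => x j := by
  fun_prop

lemma pd_coord (j i : Fin 3) (x : E3) : pd (fun x => x j) i x = if j = i then 1 else 0 := by
  have h : (fun x : E3 => x j) = EuclideanSpace.proj (𝕜 := ℝ) j := rfl
  rw [pd, h, ContinuousLinearMap.fderiv]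
  simp

lemma angD_mul (hF : ContDiff ℝ 1 F) (hG : ContDiff ℝ 1 G) (k : Fin 3) (x : E3) :
    angD k (fun x => F x * G x) x = angD k F x * G x + F x * angD k G x := by
  simp only [angD, pd_mul hF hG]; ring

lemma angD_add (hF : ContDiff ℝ 1 F) (hG : ContDiff ℝ 1 G) (k : Fin 3) (x : E3) :
    angD k (fun x => F x + G x) x = angD k F x + angD k G x := by
  simp only [angD, pd_add hF hG]; ring

/-- Integration by parts for the angular derivatives. -/
lemma sint_angD_mul (hF : ContDiff ℝ 1 F) (hG : ContDiff ℝ 1 G) (k : Fin 3) :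
    sint (fun x => angD k F x * G x) = -sint (fun x => F x * angD k G x) := by
  have h := sint_angD (hF.mul hG) k
  have h2 : angD k (fun x => F x * G x) = fun x => angD k F x * G x + F x * angD k G x :=
    funext (angD_mul hF hG k)
  have h3 := sint_add (F := fun x => angD k F x * G x) (G := fun x => F x * angD k G x)
    ((continuous_angD hF k).mul hG.continuous) (hF.continuous.mul (continuous_angD hG k))
  rw [h2] at h
  linarith

lemma angD_coord_self (k : Fin 3) : angD k (fun x => x k) = fun _ => 0 := by
  funext x
  simp only [angD, pd_coord]
  obtain rfl | rfl | rfl := fin_three_cases k <;> simp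

lemma angD_coord_add_one (k : Fin 3) : angD k (fun x => x (k + 1)) = fun x => -x (k + 2) := by
  funext x
  simp only [angD, pd_coord]
  obtain rfl | rfl | rfl := fin_three_cases k <;> simp

lemma angD_coord_add_two (k : Fin 3) : angD k (fun x => x (k + 2)) = fun x => x (k + 1) := by
  funext x
  simp only [angD, pd_coord]
  obtain rfl | rfl | rfl := fin_three_cases k <;> simp

lemma sint_coord (j : Fin 3) : sint (fun x => x j) = 0 := by
  have h := sint_angD (contDiff_coord (j + 2 + 2) (n := 1)) (j + 2)
  rwa [angD_coord_add_two, show j + 2 + 1 = j by rw [add_assoc]; simp] at h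

lemma sint_coord_mul_succ (k : Fin 3) : sint (fun x => x k * x (k + 1)) = 0 := by
  have h := sint_angD ((contDiff_coord k (n := 1)).mul (contDiff_coord (k + 2))) k
  have h2 : angD k (fun x => x k * x (k + 2)) = fun x => x k * x (k + 1) := by
    funext x
    rw [angD_mul (contDiff_coord _) (contDiff_coord _), angD_coord_self, angD_coord_add_two]
    simp
  rwa [h2] at h

lemma sint_coord_sq_succ (k : Fin 3) :
    sint (fun x => x (k + 1) * x (k + 1)) = sint (fun x => x (k + 2) * x (k + 2)) := by
  have h := sint_angD_mul (contDiff_coord (k + 2) (n := 1)) (contDiff_coord (k + 1)) k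
  rw [angD_coord_add_one, angD_coord_add_two] at h
  simp only [mul_neg] at h
  rw [sint_neg, neg_neg] at h
  exact h

/-- Second moments of the uniform measure on the sphere. -/
lemma sint_coord_mul_coord (i j : Fin 3) :
    sint (fun x => x i * x j) = if i = j then sphereArea / 3 else 0 := by
  have a0 := sint_coord_mul_succ 0
  have a1 := sint_coord_mul_succ 1
  have a2 := sint_coord_mul_succ 2
  have b0 := sint_coord_sq_succ 0
  have b1 := sint_coord_sq_succ 1
  have hs : sphereArea = sint (fun x => x 0 * x 0) + sint (fun x => x 1 * x 1) +
      sint (fun x => x 2 * x 2) := by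
    rw [← sint_add (by fun_prop) (by fun_prop), ← sint_add (by fun_prop) (by fun_prop)]
    refine sint_congr fun x hx => ?_
    have h := EuclideanSpace.real_norm_sq_eq x
    rw [hx, Fin.sum_univ_three] at h
    linarith
  simp only [Fin.isValue, zero_add, show (1 : Fin 3) + 1 = 2 from rfl, show (2 : Fin 3) + 1 = 0
    from rfl,
    show (1 : Fin 3) + 2 = 0 from rfl] at a0 a1 a2 b0 b1
  obtain rfl | rfl | rfl := fin_three_cases i <;> obtain rfl | rfl | rfl := fin_three_cases j <;>
    simp <;> first | linarith | skip
  all_goals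
    simp only [mul_comm] at a0 a1 a2 ⊢
    first | exact a0 | exact a1 | exact a2

end SphereAlgebra

section Polynomials

open MvPolynomial

/-- The polynomial function on `ℝ³` given by a polynomial. -/
def ev : MvPolynomial (Fin 3) ℝ →ₐ[ℝ] (E3 → ℝ) := aeval fun i x => x i

lemma ev_X (i : Fin 3) : ev (X i) = fun x => x i := by simp [ev]

lemma ev_C (c : ℝ) : ev (C c) = fun _ => c := by
  simp [ev, algHom_C]; rfl

lemma contDiff_ev (P : MvPolynomial (Fin 3) ℝ) : ContDiff ℝ 1 (ev P) := by
  induction P using MvPolynomial.induction_on with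
  | C a => rw [ev_C]; exact contDiff_const
  | add P Q hP hQ => rw [map_add]; exact hP.add hQ
  | mul_X P i hP => rw [map_mul, ev_X]; exact hP.mul (contDiff_coord i)

lemma continuous_ev (P : MvPolynomial (Fin 3) ℝ) : Continuous (ev P) := (contDiff_ev P).continuous

lemma pd_ev (P : MvPolynomial (Fin 3) ℝ) (i : Fin 3) : pd (ev P) i = ev (pderiv i P) := by
  induction P using MvPolynomial.induction_on with
  | C a => rw [ev_C, pderiv_C, map_zero]; exact funext fun x => pd_const a i x
  | add P Q hP hQ =>
    rw [map_add, map_add, map_add, ← hP, ← hQ]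
    exact funext fun x => pd_add (contDiff_ev P) (contDiff_ev Q) i x
  | mul_X P j hP =>
    rw [map_mul, ev_X, pderiv_mul, map_add, map_mul, map_mul, ← hP, ev_X]
    funext x
    have := pd_mul (contDiff_ev P) (contDiff_coord j) i x
    rw [pd_coord] at this
    refine this.trans ?_
    by_cases hij : j = i
    · subst hij; simp
    · simp [hij, pderiv_X]

/-- Angular derivatives of polynomials. -/
def polyD (k : Fin 3) (P : MvPolynomial (Fin 3) ℝ) : MvPolynomial (Fin 3) ℝ :=
  X (k + 1) * pderiv (k + 2) P - X (k + 2) * pderiv (k + 1) P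

lemma angD_ev (k : Fin 3) (P : MvPolynomial (Fin 3) ℝ) : angD k (ev P) = ev (polyD k P) := by
  funext x
  simp [angD, polyD, pd_ev, ev_X]

lemma pderiv_comm (i j : Fin 3) (P : MvPolynomial (Fin 3) ℝ) :
    pderiv i (pderiv j P) = pderiv j (pderiv i P) := by
  by_cases hij : i = j
  · rw [hij]
  ext m
  simp only [coeff_pderiv, add_right_comm m, Finsupp.add_apply]
  rw [Finsupp.single_eq_of_ne hij, Finsupp.single_eq_of_ne (Ne.symm hij)]
  push_cast
  ring

/-- The Euler operator. -/
def euler (P : MvPolynomial (Fin 3) ℝ) : MvPolynomial (Fin 3) ℝ := ∑ i, X i * pderiv i P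

/-- The Laplacian of polynomials. -/
def polyLap (P : MvPolynomial (Fin 3) ℝ) : MvPolynomial (Fin 3) ℝ := ∑ i, pderiv i (pderiv i P)

lemma sum_polyD_polyD (P : MvPolynomial (Fin 3) ℝ) :
    ∑ k, polyD k (polyD k P) =
      (∑ i, X i ^ 2) * polyLap P - (euler (euler P) + euler P) := by
  have e1 : (1 : Fin 3) + 1 = 2 := rfl
  have e2 : (2 : Fin 3) + 1 = 0 := rfl
  have e3 : (1 : Fin 3) + 2 = 0 := rfl
  have e4 : (2 : Fin 3) + 2 = 1 := rfl
  simp only [polyD, polyLap, euler, Fin.sum_univ_three, map_add, map_sub, pderiv_mul, pderiv_X,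
    zero_add, e1, e2, e3, e4]
  simp only [Pi.single_apply, Fin.isValue, Fin.reduceEq, if_true, if_false,
    pderiv_comm 1 0, pderiv_comm 2 0, pderiv_comm 2 1]
  ring

/-- The spherical Laplacian (up to sign) on polynomials restricted to the sphere. -/
def polyL (P : MvPolynomial (Fin 3) ℝ) : MvPolynomial (Fin 3) ℝ :=
  euler (euler P) + euler P - polyLap P

lemma ev_polyL {x : E3} (hx : ‖x‖ = 1) (P : MvPolynomial (Fin 3) ℝ) :
    ev (polyL P) x = -∑ k, ev (polyD k (polyD k P)) x := by
  have h := congrArg (fun Q => ev Q x) (sum_polyD_polyD P)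
  have h1 := EuclideanSpace.real_norm_sq_eq x
  rw [hx, Fin.sum_univ_three] at h1
  simp only [map_mul, map_sub, map_add, map_pow, ev_X, Fin.sum_univ_three, Pi.add_apply,
    Pi.sub_apply, Pi.mul_apply, Pi.pow_apply] at h
  rw [Fin.sum_univ_three, h, ← h1, polyL]
  simp only [map_sub, map_add, Pi.add_apply, Pi.sub_apply]
  ring

lemma coeff_euler (P : MvPolynomial (Fin 3) ℝ) (m : Fin 3 →₀ ℕ) :
    coeff m (euler P) = m.degree * coeff m P := by
  have h : ∀ i : Fin 3, coeff m (X i * pderiv i P) = m i * coeff m P := by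
    intro i
    rw [mul_comm, coeff_mul_X']
    split_ifs with hi
    · have h1 : m - Finsupp.single i 1 + Finsupp.single i 1 = m := by
        refine tsub_add_cancel_of_le ?_
        rw [Finsupp.single_le_iff]
        exact Nat.one_le_iff_ne_zero.2 (Finsupp.mem_support_iff.1 hi)
      rw [coeff_pderiv, h1, mul_comm]
      congr 1
      have := congrArg (fun f => (f i : ℝ)) h1
      simpa using this
    · rw [Finsupp.notMem_support_iff.1 hi]; simp
  rw [euler, coeff_sum, Finset.sum_congr rfl fun i _ => h i, ← Finset.sum_mul,
    Finsupp.degree_eq_sum]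
  push_cast; rfl

/-- Polynomials of degree at most `N`. -/
abbrev polyLE (N : ℕ) : Submodule ℝ (MvPolynomial (Fin 3) ℝ) := restrictTotalDegree (Fin 3) ℝ N

lemma mem_polyLE_iff {N : ℕ} {P : MvPolynomial (Fin 3) ℝ} :
    P ∈ polyLE N ↔ ∀ m : Fin 3 →₀ ℕ, N < m.degree → coeff m P = 0 := by
  rw [mem_restrictTotalDegree]
  constructor
  · intro h m hm
    refine coeff_eq_zero_of_totalDegree_lt (lt_of_le_of_lt h ?_)
    rwa [Finsupp.degree_apply] at hm
  · intro h
    refine Finset.sup_le fun m hm => ?_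
    by_contra! hcon
    exact mem_support_iff.1 hm (h m hcon)

lemma polyLE_mono {M N : ℕ} (h : M ≤ N) : polyLE M ≤ polyLE N := fun _ hP =>
  mem_polyLE_iff.2 fun m hm => mem_polyLE_iff.1 hP m (h.trans_lt hm)

lemma euler_mem {N : ℕ} {P : MvPolynomial (Fin 3) ℝ} (hP : P ∈ polyLE N) : euler P ∈ polyLE N :=
  mem_polyLE_iff.2 fun m hm => by rw [coeff_euler, mem_polyLE_iff.1 hP m hm, mul_zero]

lemma euler_sub_mem {N : ℕ} {P : MvPolynomial (Fin 3) ℝ} (hP : P ∈ polyLE (N + 1)) :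
    euler P - (N + 1 : ℝ) • P ∈ polyLE N :=
  mem_polyLE_iff.2 fun m hm => by
    rw [coeff_sub, coeff_euler, coeff_smul]
    rcases (Nat.succ_le_of_lt hm).eq_or_lt with h | h
    · rw [← h]; push_cast; simp
    · rw [mem_polyLE_iff.1 hP m h]; simp

lemma pderiv_mem {N : ℕ} {P : MvPolynomial (Fin 3) ℝ} (hP : P ∈ polyLE (N + 1)) (i : Fin 3) :
    pderiv i P ∈ polyLE N :=
  mem_polyLE_iff.2 fun m hm => by
    rw [coeff_pderiv, mem_polyLE_iff.1 hP, zero_mul]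
    simpa using hm

lemma polyLap_mem {N : ℕ} {P : MvPolynomial (Fin 3) ℝ} (hP : P ∈ polyLE (N + 1)) :
    polyLap P ∈ polyLE N :=
  Submodule.sum_mem _ fun i _ =>
    pderiv_mem (polyLE_mono (Nat.le_succ N) (pderiv_mem hP i)) i

lemma polyL_mem {N : ℕ} {P : MvPolynomial (Fin 3) ℝ} (hP : P ∈ polyLE (N + 1)) :
    polyL P ∈ polyLE (N + 1) :=
  Submodule.sub_mem _ (Submodule.add_mem _ (euler_mem (euler_mem hP)) (euler_mem hP))
    (polyLE_mono (Nat.le_succ N) (polyLap_mem hP))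

lemma polyL_sub_mem {N : ℕ} {P : MvPolynomial (Fin 3) ℝ} (hP : P ∈ polyLE (N + 1)) :
    polyL P - ((N + 1) * (N + 2) : ℝ) • P ∈ polyLE N := by
  have h1 := euler_sub_mem hP
  have h2 := euler_sub_mem (euler_mem hP)
  have h3 := polyLap_mem hP
  have h := Submodule.sub_mem _ (Submodule.add_mem _ h2
    (Submodule.smul_mem _ (N + 2 : ℝ) h1)) h3
  convert h using 1
  rw [polyL]
  module

end Polynomials

section SphericalGap

open MvPolynomial

/-- Orthogonal projection, in `L²(S²)`, on a finite-dimensional space of polynomials. -/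
lemma exists_poly_proj {φ : E3 → ℝ} (hφ : Continuous φ)
    (W : Submodule ℝ (MvPolynomial (Fin 3) ℝ)) [Module.Finite ℝ W] :
    ∃ P ∈ W, ∀ Q ∈ W, sint (fun x => (φ x - ev P x) * ev Q x) = 0 := by
  set σ := (volume : Measure E3).toSphere
  let res : (F : E3 → ℝ) → Continuous F → C(Metric.sphere (0 : E3) 1, ℝ) := fun F hF =>
    ⟨fun ω => F ω, hF.comp continuous_subtype_val⟩
  let T := ContinuousMap.toLp (E := ℝ) 2 σ ℝ
  let evS : MvPolynomial (Fin 3) ℝ →ₗ[ℝ] C(Metric.sphere (0 : E3) 1, ℝ) :=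
    { toFun := fun P => res (ev P) (continuous_ev P)
      map_add' := fun P Q => by ext ω; simp [res]
      map_smul' := fun c P => by ext ω; simp [res] }
  let L : MvPolynomial (Fin 3) ℝ →ₗ[ℝ] Lp ℝ 2 σ := T.toLinearMap.comp evS
  have hfin : FiniteDimensional ℝ (W.map L) := inferInstance
  obtain ⟨P, hP, hPL⟩ := (Submodule.mem_map).1
    ((W.map L).starProjection_apply_mem (T (res φ hφ)))
  refine ⟨P, hP, fun Q hQ => ?_⟩
  have h := Submodule.starProjection_inner_eq_zero (K := W.map L) (T (res φ hφ)) (L Q)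
    (Submodule.mem_map_of_mem hQ)
  rw [← hPL] at h
  have h2 : T (res φ hφ) - L P = T (res φ hφ - evS P) := by
    rw [map_sub]; rfl
  rw [h2] at h
  have h3 := ContinuousMap.inner_toLp σ (res φ hφ - evS P) (evS Q) (𝕜 := ℝ)
  have h4 := h3.symm.trans h
  rw [sint, ← h4]
  refine integral_congr_ae (Eventually.of_forall fun ω => ?_)
  simp [res, evS, mul_comm]

/-- Uniform approximation by polynomials on the sphere. -/
lemma exists_poly_near {φ : E3 → ℝ} (hφ : Continuous φ) {ε : ℝ} (hε : 0 < ε) :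
    ∃ P, ∀ x : E3, ‖x‖ = 1 → |ev P x - φ x| < ε := by
  let crd : Fin 3 → C(Metric.sphere (0 : E3) 1, ℝ) := fun i => ⟨fun ω => (ω : E3) i, by fun_prop⟩
  let A : MvPolynomial (Fin 3) ℝ →ₐ[ℝ] C(Metric.sphere (0 : E3) 1, ℝ) := aeval crd
  have hA : ∀ P (ω : Metric.sphere (0 : E3) 1), A P ω = ev P ω := by
    intro P ω
    induction P using MvPolynomial.induction_on with
    | C a => rw [ev_C]; simp [A, algHom_C]
    | add P Q hP hQ => simp [hP, hQ]
    | mul_X P i hP => simp [hP, ev_X]; left; simp [A, crd]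
  have hsep : A.range.SeparatesPoints := by
    intro x y hxy
    have : ∃ i, (x : E3) i ≠ (y : E3) i := by
      by_contra! hcon
      exact hxy (Subtype.ext (by ext i; exact hcon i))
    obtain ⟨i, hi⟩ := this
    refine ⟨_, ⟨A (X i), ⟨X i, rfl⟩, rfl⟩, ?_⟩
    simpa [hA, ev_X] using hi
  obtain ⟨⟨g, P, rfl⟩, hg⟩ := ContinuousMap.exists_mem_subalgebra_near_continuous_of_separatesPoints
    A.range hsep (fun ω => φ ω) (hφ.comp continuous_subtype_val) ε hε
  refine ⟨P, fun x hx => ?_⟩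
  have := hg ⟨x, by simp [hx]⟩
  rw [← Real.norm_eq_abs]
  simpa [hA] using this

/-- The `L²(S²)` inner product of polynomials. -/
def ip (P Q : MvPolynomial (Fin 3) ℝ) : ℝ := sint fun x => ev P x * ev Q x

lemma ip_comm (P Q) : ip P Q = ip Q P := by simp only [ip, mul_comm]

lemma ip_add_left (P P' Q) : ip (P + P') Q = ip P Q + ip P' Q := by
  simp only [ip, map_add, Pi.add_apply, add_mul]
  exact sint_add ((continuous_ev P).mul (continuous_ev Q))
    ((continuous_ev P').mul (continuous_ev Q))

lemma ip_smul_left (c : ℝ) (P Q) : ip (c • P) Q = c * ip P Q := by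
  simp only [ip, map_smul, Pi.smul_apply, smul_eq_mul, mul_assoc]
  exact sint_const_mul _ _

lemma ip_add_right (P Q Q') : ip P (Q + Q') = ip P Q + ip P Q' := by
  rw [ip_comm, ip_add_left, ip_comm Q, ip_comm Q']

lemma ip_smul_right (c : ℝ) (P Q) : ip P (c • Q) = c * ip P Q := by
  rw [ip_comm, ip_smul_left, ip_comm]

lemma ip_self_nonneg (P) : 0 ≤ ip P P := sint_nonneg fun _ _ => mul_self_nonneg _

/-- Green's formula on the sphere. -/
lemma sum_sint_angD_mul {F : E3 → ℝ} (hF : ContDiff ℝ 1 F) (P : MvPolynomial (Fin 3) ℝ) :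
    ∑ k, sint (fun x => angD k F x * angD k (ev P) x) = sint (fun x => F x * ev (polyL P) x) := by
  have h : ∀ k, sint (fun x => angD k F x * angD k (ev P) x) =
      sint fun x => -(F x * ev (polyD k (polyD k P)) x) := by
    intro k
    rw [angD_ev, sint_angD_mul hF (contDiff_ev _), angD_ev, sint_neg]
  have h2 := sint_sum Finset.univ (F := fun k x => -(F x * ev (polyD k (polyD k P)) x)) fun k =>
    (hF.continuous.mul (continuous_ev _)).neg
  rw [Finset.sum_congr rfl fun k _ => h k, ← h2]
  refine sint_congr fun x hx => ?_
  rw [ev_polyL hx, Finset.sum_neg_distrib, ← Finset.mul_sum]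
  ring

lemma ip_polyL_comm (P Q) : ip P (polyL Q) = ip Q (polyL P) := by
  rw [ip, ip, ← sum_sint_angD_mul (contDiff_ev P), ← sum_sint_angD_mul (contDiff_ev Q)]
  simp only [mul_comm]

lemma polyL_add (P Q) : polyL (P + Q) = polyL P + polyL Q := by
  simp only [polyL, euler, polyLap, map_add, mul_add, Finset.sum_add_distrib, map_sum]
  abel

/-- Polynomials orthogonal to the polynomials of degree at most one on the sphere have
spherical Rayleigh quotient at least six. -/
lemma six_mul_ip_le (N : ℕ) : ∀ P ∈ polyLE (N + 1), (∀ Q ∈ polyLE 1, ip P Q = 0) →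
    6 * ip P P ≤ ip P (polyL P) := by
  induction N with
  | zero =>
    intro P hP hQ
    rw [hQ P hP, hQ _ (polyL_mem hP)]; simp
  | succ N ih =>
    intro P hP hQ
    obtain ⟨P0, hP0, hproj⟩ := exists_poly_proj (continuous_ev P) (polyLE (N + 1))
    obtain ⟨P1, rfl⟩ : ∃ P1, P = P1 + P0 := ⟨P - P0, by abel⟩
    have h1 : ∀ Q ∈ polyLE (N + 1), ip P1 Q = 0 := by
      intro Q hQ'
      have := hproj Q hQ'
      simpa [ip] using this
    have hP1 : P1 ∈ polyLE (N + 1 + 1) := by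
      have := Submodule.sub_mem _ hP (polyLE_mono (Nat.le_succ _) hP0)
      simpa using this
    have h0 : ∀ Q ∈ polyLE 1, ip P0 Q = 0 := by
      intro Q hQ'
      have a := hQ Q hQ'
      rwa [ip_add_left, h1 Q (polyLE_mono (by omega) hQ'), zero_add] at a
    have i0 := ih P0 hP0 h0
    have i1 : ip P1 (polyL P1) = ((N + 2) * (N + 3) : ℝ) * ip P1 P1 := by
      have a := h1 _ (polyL_sub_mem hP1)
      obtain ⟨R, hR⟩ : ∃ R, R = polyL P1 - (((N + 1 : ℕ) + 1) * ((N + 1 : ℕ) + 2) : ℝ) • P1 :=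
        ⟨_, rfl⟩
      rw [← hR] at a
      have b : polyL P1 = R + (((N + 1 : ℕ) + 1) * ((N + 1 : ℕ) + 2) : ℝ) • P1 := by rw [hR]; abel
      rw [b, ip_add_right, a, ip_smul_right]
      push_cast; ring
    have i2 := h1 _ (polyL_mem hP0)
    have i3 := h1 _ hP0
    have i4 := ip_polyL_comm P0 P1
    have i5 := ip_self_nonneg P1
    rw [polyL_add]
    simp only [ip_add_left, ip_add_right]
    rw [ip_comm P0 P1, i4, i1, i2, i3]
    have hN : (0 : ℝ) ≤ N := Nat.cast_nonneg N
    nlinarith [mul_nonneg hN i5, mul_nonneg (mul_nonneg hN hN) i5]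

lemma sint_mul_ev_eq_zero_of_mem {F : E3 → ℝ} (hF : Continuous F) (h0 : sint F = 0)
    (h1 : ∀ j, sint (fun x => F x * x j) = 0) {Q : MvPolynomial (Fin 3) ℝ} (hQ : Q ∈ polyLE 1) :
    sint (fun x => F x * ev Q x) = 0 := by
  have hm : ∀ m ∈ Q.support, sint (fun x => F x * ev (monomial m (coeff m Q)) x) = 0 := by
    intro m hm
    have hd : m.degree ≤ 1 := by
      by_contra! hcon
      exact mem_support_iff.1 hm (mem_polyLE_iff.1 hQ m hcon)
    rcases Nat.le_one_iff_eq_zero_or_eq_one.1 hd with h | h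
    · rw [Finsupp.degree_eq_zero_iff] at h
      have h2 : ev (monomial m (coeff m Q)) = fun _ => coeff m Q := by
        rw [h, ← C_apply, ev_C]
      simp only [h2, mul_comm (F _)]
      rw [sint_const_mul, h0, mul_zero]
    · obtain ⟨j, rfl⟩ : m ∈ Set.range fun a : Fin 3 => Finsupp.single a 1 := by
        rw [Finsupp.range_single_one]; exact h
      have h2 : ∀ x, F x * ev (monomial (Finsupp.single j 1) (coeff (Finsupp.single j 1) Q)) x =
          coeff (Finsupp.single j 1) Q * (F x * x j) := by
        intro x
        have : monomial (Finsupp.single j 1) (coeff (Finsupp.single j 1) Q) =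
          C (coeff (Finsupp.single j 1) Q) * X j := (C_mul_X_eq_monomial).symm
        rw [this, map_mul, ev_C, ev_X, Pi.mul_apply]
        ring
      simp only [h2]
      rw [sint_const_mul, h1, mul_zero]
  have h2 : ∀ x, F x * ev Q x = ∑ m ∈ Q.support, F x * ev (monomial m (coeff m Q)) x := by
    intro x
    conv_lhs => rw [Q.as_sum]
    rw [map_sum, Finset.sum_apply, Finset.mul_sum]
  simp only [h2]
  have h3 := sint_sum Q.support (F := fun m x => F x * ev (monomial m (coeff m Q)) x)
    fun m => hF.mul (continuous_ev _)
  rw [h3]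
  exact Finset.sum_eq_zero hm

/-- The spherical Poincaré inequality orthogonally to the spherical harmonics of degree at most
one. -/
theorem six_mul_sint_sq_le {η : E3 → ℝ} (hη : ContDiff ℝ 1 η) (h0 : sint η = 0)
    (h1 : ∀ j, sint (fun x => η x * x j) = 0) :
    6 * sint (fun x => η x ^ 2) ≤ ∑ k, sint fun x => angD k η x ^ 2 := by
  have hηc := hη.continuous
  have key : ∀ ε > 0, 6 * sint (fun x => η x ^ 2) ≤
      (∑ k, sint fun x => angD k η x ^ 2) + 6 * (ε ^ 2 * sphereArea) := by
    intro ε hε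
    obtain ⟨P, hP⟩ := exists_poly_near hηc hε
    have hPN : P ∈ polyLE (P.totalDegree + 1) :=
      polyLE_mono (Nat.le_succ _) ((mem_restrictTotalDegree _ _ _).2 le_rfl)
    set N := P.totalDegree
    obtain ⟨g, hg, hproj⟩ := exists_poly_proj hηc (polyLE (N + 1))
    have cg := continuous_ev g
    have cP := continuous_ev P
    have hortho : ∀ Q ∈ polyLE (N + 1), sint (fun x => η x * ev Q x) = ip g Q := by
      intro Q hQ
      have a := sint_sub (F := fun x => η x * ev Q x) (G := fun x => ev g x * ev Q x)
        (hηc.mul (continuous_ev Q)) (cg.mul (continuous_ev Q))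
      have b := hproj Q hQ
      simp only [sub_mul] at b
      rw [ip]; linarith
    have hg1 : ∀ Q ∈ polyLE 1, ip g Q = 0 := fun Q hQ => by
      rw [← hortho Q (polyLE_mono (by omega) hQ), sint_mul_ev_eq_zero_of_mem hηc h0 h1 hQ]
    have e1 := six_mul_ip_le N g hg hg1
    have e2 : ∀ k, 0 ≤ sint (fun x => angD k η x ^ 2) -
        2 * sint (fun x => angD k η x * angD k (ev g) x) +
        sint (fun x => angD k (ev g) x * angD k (ev g) x) := by
      intro k
      have c1 := continuous_angD hη k
      have c2 := continuous_angD (contDiff_ev g) k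
      rw [← sint_const_mul, ← sint_sub (by fun_prop) (by fun_prop),
        ← sint_add (by fun_prop) (by fun_prop)]
      refine sint_nonneg fun x _ => ?_
      nlinarith [sq_nonneg (angD k η x - angD k (ev g) x)]
    have e3 := Finset.sum_nonneg fun k (_ : k ∈ Finset.univ) => e2 k
    rw [Finset.sum_add_distrib, Finset.sum_sub_distrib, ← Finset.mul_sum, sum_sint_angD_mul hη,
      sum_sint_angD_mul (contDiff_ev g), hortho _ (polyL_mem hg), ← ip] at e3
    have e4 : sint (fun x => η x ^ 2) - ip g g ≤ ε ^ 2 * sphereArea := by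
      have f1 : sint (fun x => (η x - ev P x) ^ 2) ≤ ε ^ 2 * sphereArea := by
        rw [← sint_const]
        refine sint_mono (by fun_prop) continuous_const fun x hx => ?_
        rw [← sq_abs, abs_sub_comm]
        exact pow_le_pow_left₀ (abs_nonneg _) (hP x hx).le 2
      have f2 : 0 ≤ sint fun x => (ev g x - ev P x) ^ 2 := sint_nonneg fun x _ => sq_nonneg _
      have f3 : sint (fun x => (η x - ev P x) ^ 2) =
          sint (fun x => η x ^ 2) - 2 * sint (fun x => η x * ev P x) +
            sint (fun x => ev P x ^ 2) := by
        rw [← sint_const_mul, ← sint_sub (by fun_prop) (by fun_prop),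
          ← sint_add (by fun_prop) (by fun_prop)]
        exact sint_congr fun x _ => by ring
      have f4 : sint (fun x => (ev g x - ev P x) ^ 2) =
          ip g g - 2 * ip g P + sint (fun x => ev P x ^ 2) := by
        rw [ip, ip, ← sint_const_mul, ← sint_sub (by fun_prop) (by fun_prop),
          ← sint_add (by fun_prop) (by fun_prop)]
        exact sint_congr fun x _ => by ring
      have f5 := hortho P hPN
      linarith
    linarith
  refine le_of_forall_pos_le_add fun δ hδ => ?_
  have hm := sphereArea_pos
  have h := key (√(δ / (6 * sphereArea))) (sqrt_pos.2 (by positivity))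
  rw [sq_sqrt (by positivity)] at h
  refine h.trans (le_of_eq ?_)
  field_simp

end SphericalGap

section SphericalDecomposition

/-- Mean over the unit sphere. -/
def sphMean (F : E3 → ℝ) : ℝ := sint F / sphereArea

/-- Coefficient of the `j`-th coordinate function in the spherical harmonics expansion. -/
def sphMom (j : Fin 3) (F : E3 → ℝ) : ℝ := 3 * sint (fun x => F x * x j) / sphereArea

/-- What remains of a function on the sphere after subtracting its spherical harmonics components
of degree at most one. -/
def sphRem (F : E3 → ℝ) (x : E3) : ℝ := F x - sphMean F - ∑ j, sphMom j F * x j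

variable {F : E3 → ℝ}

lemma continuous_sphRem (hF : Continuous F) : Continuous (sphRem F) := by
  unfold sphRem; fun_prop

lemma contDiff_sphRem (hF : ContDiff ℝ 1 F) : ContDiff ℝ 1 (sphRem F) := by
  unfold sphRem; fun_prop

lemma sint_eq_sphMean : sint F = sphereArea * sphMean F := by
  rw [sphMean]; field_simp [sphereArea_pos.ne']

lemma sint_mul_coord_eq_sphMom (j : Fin 3) :
    sint (fun x => F x * x j) = sphereArea / 3 * sphMom j F := by
  rw [sphMom]; field_simp [sphereArea_pos.ne']

lemma sint_affine_mul (G : E3 → ℝ) (hG : Continuous G) (a : ℝ) (b : Fin 3 → ℝ) :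
    sint (fun x => (a + ∑ j, b j * x j) * G x) =
      a * sint G + ∑ j, b j * sint (fun x => G x * x j) := by
  have h : ∀ x : E3, (a + ∑ j, b j * x j) * G x = a * G x + ∑ j, b j * (G x * x j) := by
    intro x
    rw [add_mul, Finset.sum_mul]
    congr 1
    exact Finset.sum_congr rfl fun j _ => by ring
  simp only [h]
  rw [sint_add (by fun_prop) (by fun_prop), sint_const_mul, sint_sum _ (by fun_prop)]
  simp only [sint_const_mul]

lemma sint_affine (a : ℝ) (b : Fin 3 → ℝ) :
    sint (fun x => a + ∑ j, b j * x j) = a * sphereArea := by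
  have h := sint_affine_mul (fun _ => 1) continuous_const a b
  simpa [sint_coord, sphereArea] using h

lemma sint_affine_mul_coord (a : ℝ) (b : Fin 3 → ℝ) (i : Fin 3) :
    sint (fun x => (a + ∑ j, b j * x j) * x i) = sphereArea / 3 * b i := by
  rw [sint_affine_mul (fun x => x i) (by fun_prop)]
  simp only [sint_coord, sint_coord_mul_coord]
  simp [mul_comm]

lemma sphRem_eq (x : E3) : sphRem F x = F x - (sphMean F + ∑ j, sphMom j F * x j) := by
  rw [sphRem]; ring

lemma sint_sphRem (hF : Continuous F) : sint (sphRem F) = 0 := by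
  have h : sphRem F = fun x => F x - (sphMean F + ∑ j, sphMom j F * x j) := funext sphRem_eq
  rw [h, sint_sub hF (by fun_prop), sint_affine, sint_eq_sphMean]
  ring

lemma sint_sphRem_mul_coord (hF : Continuous F) (i : Fin 3) :
    sint (fun x => sphRem F x * x i) = 0 := by
  simp only [sphRem_eq, sub_mul]
  rw [sint_sub (by fun_prop) (by fun_prop), sint_affine_mul_coord, sint_mul_coord_eq_sphMom]
  ring

lemma sint_affine_mul_sphRem (hF : Continuous F) (a : ℝ) (b : Fin 3 → ℝ) :
    sint (fun x => (a + ∑ j, b j * x j) * sphRem F x) = 0 := by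
  rw [sint_affine_mul _ (continuous_sphRem hF), sint_sphRem hF]
  simp [sint_sphRem_mul_coord hF]

lemma sint_affine_sq (a : ℝ) (b : Fin 3 → ℝ) :
    sint (fun x => (a + ∑ j, b j * x j) ^ 2) =
      sphereArea * a ^ 2 + sphereArea / 3 * ∑ j, b j ^ 2 := by
  simp only [pow_two]
  rw [sint_affine_mul (fun x => a + ∑ j, b j * x j) (by fun_prop), sint_affine]
  simp only [sint_affine_mul_coord, Finset.mul_sum]
  congr 1
  · ring
  · exact Finset.sum_congr rfl fun j _ => by ring

/-- Parseval identity for the decomposition in spherical harmonics. -/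
lemma sint_sq_eq (hF : Continuous F) :
    sint (fun x => F x ^ 2) = sphereArea * sphMean F ^ 2 +
      sphereArea / 3 * ∑ j, sphMom j F ^ 2 + sint (fun x => sphRem F x ^ 2) := by
  have hc := continuous_sphRem hF
  have h1 := sint_affine_sq (sphMean F) (fun j => sphMom j F)
  have h2 := sint_affine_mul_sphRem hF (sphMean F) (fun j => sphMom j F)
  have h3 : sint (fun x => F x ^ 2) =
      sint (fun x => (sphMean F + ∑ j, sphMom j F * x j) ^ 2) +
      2 * sint (fun x => (sphMean F + ∑ j, sphMom j F * x j) * sphRem F x) +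
      sint (fun x => sphRem F x ^ 2) := by
    rw [← sint_const_mul, ← sint_add (by fun_prop) (by fun_prop),
        ← sint_add (by fun_prop) (by fun_prop)]
    refine sint_congr fun x _ => ?_
    rw [sphRem_eq]; ring
  rw [h3, h1, h2]; ring

open MvPolynomial in
/-- Lower bound for the angular Dirichlet energy. -/
lemma le_sum_sint_angD_sq (hF : ContDiff ℝ 1 F) :
    sphereArea / 3 * (2 * ∑ j, sphMom j F ^ 2) + 6 * sint (fun x => sphRem F x ^ 2) ≤
      ∑ k, sint fun x => angD k F x ^ 2 := by
  have hr := contDiff_sphRem hF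
  have hrc := hr.continuous
  have gap := six_mul_sint_sq_le hr (sint_sphRem hF.continuous)
    (sint_sphRem_mul_coord hF.continuous)
  set P : MvPolynomial (Fin 3) ℝ := C (sphMean F) + ∑ j, C (sphMom j F) * X j with hP
  have evP : ev P = fun x => sphMean F + ∑ j, sphMom j F * x j := by
    funext x; simp [hP, ev_X]
  have evL : ∀ x, ev (polyL P) x = 2 * ∑ j, sphMom j F * x j := by
    have hL : polyL P = 2 * ∑ j, C (sphMom j F) * X j := by
      simp [polyL, hP, euler, polyLap, pderiv_X, Fin.sum_univ_three, Pi.single_apply]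
      ring
    intro x
    rw [hL]
    simp only [map_mul, map_ofNat, map_sum, ev_C, ev_X, Pi.mul_apply, Finset.sum_apply]
    rfl
  have hFs : F = fun x => ev P x + sphRem F x := by
    funext x; rw [evP, sphRem_eq]; ring
  have hk : ∀ k, sint (fun x => angD k F x ^ 2) =
      sint (fun x => angD k (ev P) x * angD k (ev P) x) +
      2 * sint (fun x => angD k (sphRem F) x * angD k (ev P) x) +
      sint (fun x => angD k (sphRem F) x ^ 2) := by
    intro k
    have c1 := continuous_angD hr k
    have c2 := continuous_angD (contDiff_ev P) k
    rw [← sint_const_mul, ← sint_add (by fun_prop) (by fun_prop),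
        ← sint_add (by fun_prop) (by fun_prop)]
    refine sint_congr fun x _ => ?_
    have : angD k F x = angD k (ev P) x + angD k (sphRem F) x := by
      conv_lhs => rw [hFs]
      exact angD_add (contDiff_ev P) hr k x
    rw [this]; ring
  have h1 : sint (fun x => sphRem F x * ev (polyL P) x) = 0 := by
    have := sint_affine_mul_sphRem hF.continuous 0 (fun j => sphMom j F)
    simp only [evL]
    have h2 : ∀ x, sphRem F x * (2 * ∑ j, sphMom j F * x j) =
      2 * ((0 + ∑ j, sphMom j F * x j) * sphRem F x) := fun x => by ring
    simp only [h2]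
    rw [sint_const_mul, this, mul_zero]
  have h2 : sint (fun x => ev P x * ev (polyL P) x) =
      sphereArea / 3 * (2 * ∑ j, sphMom j F ^ 2) := by
    have := sint_affine_mul (fun x => sphMean F + ∑ j, sphMom j F * x j) (by fun_prop) 0
      (fun j => sphMom j F)
    simp only [evL, evP]
    have h2 : ∀ x : E3, (sphMean F + ∑ j, sphMom j F * x j) * (2 * ∑ j, sphMom j F * x j) =
      2 * ((0 + ∑ j, sphMom j F * x j) * (sphMean F + ∑ j, sphMom j F * x j)) := fun x => by ring
    simp only [h2]
    rw [sint_const_mul, this]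
    simp only [sint_affine_mul_coord, Finset.mul_sum, zero_mul, zero_add]
    exact Finset.sum_congr rfl fun j _ => by ring
  rw [Finset.sum_congr rfl fun k _ => hk k, Finset.sum_add_distrib, Finset.sum_add_distrib,
    ← Finset.mul_sum, sum_sint_angD_mul hr, sum_sint_angD_mul (contDiff_ev P), h1, h2]
  linarith

end SphericalDecomposition

section Parametric

lemma continuous_sint {H : ℝ × E3 → ℝ} (hH : Continuous H) :
    Continuous fun s => sint fun x => H (s, x) := by
  have : Continuous (Function.uncurry fun (s : ℝ) (ω : Metric.sphere (0 : E3) 1) => H (s, ω)) :=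
    hH.comp (by fun_prop)
  have h := continuous_parametric_integral_of_continuous (μ := (volume : Measure E3).toSphere)
    this isCompact_univ
  simpa [sint] using h

/-- Differentiation under the integral over the sphere. -/
lemma hasDerivAt_sint {H H' : ℝ × E3 → ℝ} (hd : ∀ s x, HasDerivAt (fun s => H (s, x)) (H' (s, x)) s)
    (hH : Continuous H) (hH' : Continuous H') (s : ℝ) :
    HasDerivAt (fun s => sint fun x => H (s, x)) (sint fun x => H' (s, x)) s := by
  have h1 : (fun s => sint fun x => H (s, x)) =
      fun s => (∫ t in (0 : ℝ)..s, sint fun x => H' (t, x)) + sint fun x => H (0, x) := by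
    funext s
    rw [intervalIntegral_sint_swap hH', ← sint_add (by fun_prop) (by fun_prop)]
    refine sint_congr fun x _ => ?_
    rw [intervalIntegral.integral_eq_sub_of_hasDerivAt (fun t _ => hd t x)]
    · ring
    · exact Continuous.intervalIntegrable (by fun_prop) _ _
  rw [h1]
  have hc := continuous_sint hH'
  exact (intervalIntegral.integral_hasDerivAt_right (hc.intervalIntegrable _ _)
    (hc.stronglyMeasurableAtFilter _ _) hc.continuousAt).add_const _

end Parametric

section Core

/-- The radial derivative of `ν` at `r • x`. -/
def radD (ν : E3 → ℝ) (r : ℝ) (x : E3) : ℝ := ∑ i, x i * pd ν i (r • x)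

variable {ν : E3 → ℝ}

lemma E3_eq_sum (x : E3) : x = ∑ i, x i • (EuclideanSpace.single i (1 : ℝ) : E3) := by
  ext j
  simp [Fin.sum_univ_three]
  obtain rfl | rfl | rfl := fin_three_cases j <;> simp

lemma fderiv_eq_sum (x y : E3) : fderiv ℝ ν x y = ∑ i, y i * pd ν i x := by
  conv_lhs => rw [E3_eq_sum y]
  simp [pd]

lemma hasDerivAt_ray (hν : ContDiff ℝ 1 ν) (x : E3) (r : ℝ) :
    HasDerivAt (fun r => ν (r • x)) (radD ν r x) r := by
  have h1 : HasDerivAt (fun r : ℝ => r • x) ((1 : ℝ) • x) r := (hasDerivAt_id r).smul_const x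
  have h2 := (hν.differentiable (by norm_num) (r • x)).hasFDerivAt.comp_hasDerivAt r h1
  refine h2.congr_deriv ?_
  rw [one_smul, fderiv_eq_sum, radD]

lemma continuous_radD (hν : ContDiff ℝ 1 ν) : Continuous fun q : ℝ × E3 => radD ν q.1 q.2 := by
  have := fun i => continuous_pd hν i
  unfold radD
  fun_prop

lemma gradient_apply (x : E3) (i : Fin 3) : gradient ν x i = pd ν i x := by
  have : ⟪gradient ν x, (EuclideanSpace.single i (1 : ℝ) : E3)⟫ =
      fderiv ℝ ν x (EuclideanSpace.single i 1) := by
    simp [gradient]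
  rw [pd, ← this, EuclideanSpace.inner_single_right]
  simp

lemma norm_gradient_sq (x : E3) : ‖gradient ν x‖ ^ 2 = ∑ i, pd ν i x ^ 2 := by
  rw [EuclideanSpace.real_norm_sq_eq]
  simp only [gradient_apply]

lemma pd_comp_smul (hν : ContDiff ℝ 1 ν) (r : ℝ) (i : Fin 3) (x : E3) :
    pd (fun x => ν (r • x)) i x = r * pd ν i (r • x) := by
  have h1 : HasFDerivAt (fun x : E3 => r • x) (r • ContinuousLinearMap.id ℝ E3) x :=
    (hasFDerivAt_id x).const_smul r
  have h2 := (hν.differentiable (by norm_num) (r • x)).hasFDerivAt.comp x h1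
  have h3 : fderiv ℝ (fun x => ν (r • x)) x = _ := h2.fderiv
  rw [pd, h3]
  simp [pd]

/-- Decomposition of the gradient in radial and angular parts. -/
lemma sq_mul_norm_gradient_sq (hν : ContDiff ℝ 1 ν) (r : ℝ) {x : E3} (hx : ‖x‖ = 1) :
    r ^ 2 * ‖gradient ν (r • x)‖ ^ 2 =
      r ^ 2 * radD ν r x ^ 2 + ∑ k, angD k (fun x => ν (r • x)) x ^ 2 := by
  have h1 := EuclideanSpace.real_norm_sq_eq x
  rw [hx, Fin.sum_univ_three] at h1
  rw [norm_gradient_sq]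
  simp only [angD, radD, pd_comp_smul hν, Fin.sum_univ_three, zero_add,
    show (1 : Fin 3) + 1 = 2 from rfl, show (2 : Fin 3) + 1 = 0 from rfl,
    show (1 : Fin 3) + 2 = 0 from rfl, show (2 : Fin 3) + 2 = 1 from rfl]
  linear_combination r ^ 2 * (pd ν 0 (r • x) ^ 2 + pd ν 1 (r • x) ^ 2 + pd ν 2 (r • x) ^ 2) * h1

lemma hasDerivAt_sphMean_ray (hν : ContDiff ℝ 1 ν) (r : ℝ) :
    HasDerivAt (fun r => sphMean fun x => ν (r • x)) (sphMean (radD ν r)) r := by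
  have := hν.continuous
  exact (hasDerivAt_sint (H := fun q => ν (q.1 • q.2)) (H' := fun q => radD ν q.1 q.2)
    (fun s x => hasDerivAt_ray hν x s) (by fun_prop) (continuous_radD hν) r).div_const _

lemma hasDerivAt_sphMom_ray (hν : ContDiff ℝ 1 ν) (j : Fin 3) (r : ℝ) :
    HasDerivAt (fun r => sphMom j fun x => ν (r • x)) (sphMom j (radD ν r)) r := by
  have := hν.continuous
  have := continuous_radD hν
  exact ((hasDerivAt_sint (H := fun q => ν (q.1 • q.2) * q.2 j)
    (H' := fun q => radD ν q.1 q.2 * q.2 j)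
    (fun s x => (hasDerivAt_ray hν x s).mul_const (x j)) (by fun_prop) (by fun_prop)
      r).const_mul 3).div_const _

lemma continuous_sphMean_radD (hν : ContDiff ℝ 1 ν) : Continuous fun r => sphMean (radD ν r) :=
  (continuous_sint (continuous_radD hν)).div_const _

lemma continuous_sphMom_radD (hν : ContDiff ℝ 1 ν) (j : Fin 3) :
    Continuous fun r => sphMom j (radD ν r) := by
  have := continuous_radD hν
  exact ((continuous_sint (H := fun q => radD ν q.1 q.2 * q.2 j)
    (by fun_prop)).const_mul 3).div_const _

lemma hasDerivAt_sphRem_ray (hν : ContDiff ℝ 1 ν) (x : E3) (r : ℝ) :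
    HasDerivAt (fun r => sphRem (fun x => ν (r • x)) x) (sphRem (radD ν r) x) r := by
  refine ((hasDerivAt_ray hν x r).sub (hasDerivAt_sphMean_ray hν r)).sub ?_
  exact HasDerivAt.fun_sum fun j _ => (hasDerivAt_sphMom_ray hν j r).mul_const _

variable {p c T : ℝ} {u u' u'' : ℝ → ℝ}

lemma form_integrand_ge (hν : ContDiff ℝ 1 ν) (r : ℝ) :
    sphereArea * (r ^ 2 * sphMean (radD ν r) ^ 2 +
        radPot p u c 0 r * (sphMean fun x => ν (r • x)) ^ 2) +
      sphereArea / 3 * ∑ j, (r ^ 2 * sphMom j (radD ν r) ^ 2 +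
        radPot p u c 2 r * (sphMom j fun x => ν (r • x)) ^ 2) +
      sint (fun x => r ^ 2 * sphRem (radD ν r) x ^ 2 +
        radPot p u c 6 r * sphRem (fun x => ν (r • x)) x ^ 2) ≤
    r ^ 2 * sint (fun x => ‖gradient ν (r • x)‖ ^ 2 + ν (r • x) ^ 2 -
      (p + c) * pot p u r * ν (r • x) ^ 2) := by
  have hνr : ContDiff ℝ 1 fun x : E3 => ν (r • x) := hν.comp (contDiff_const_smul r)
  have hc := hνr.continuous
  have hD : Continuous (radD ν r) :=
    (continuous_radD hν).comp (by fun_prop : Continuous fun x : E3 => (r, x))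
  have hA := fun k => continuous_angD hνr k
  have hR := continuous_sphRem hc
  have hR' := continuous_sphRem hD
  have e1 := sint_sq_eq hD
  have e2 := sint_sq_eq hc
  have e3 := le_sum_sint_angD_sq hνr
  have e4 : r ^ 2 * sint (fun x => ‖gradient ν (r • x)‖ ^ 2 + ν (r • x) ^ 2 -
      (p + c) * pot p u r * ν (r • x) ^ 2) =
      r ^ 2 * sint (fun x => radD ν r x ^ 2) +
      ∑ k, sint (fun x => angD k (fun x => ν (r • x)) x ^ 2) +
      r ^ 2 * (1 - (p + c) * pot p u r) * sint (fun x => ν (r • x) ^ 2) := by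
    rw [← sint_sum _ (by fun_prop), ← sint_const_mul, ← sint_const_mul, ← sint_const_mul,
      ← sint_add (by fun_prop) (by fun_prop), ← sint_add (by fun_prop) (by fun_prop)]
    refine sint_congr fun x hx => ?_
    rw [← sq_mul_norm_gradient_sq hν r hx]
    ring
  have e5 : sint (fun x => r ^ 2 * sphRem (radD ν r) x ^ 2 +
        radPot p u c 6 r * sphRem (fun x => ν (r • x)) x ^ 2) =
      r ^ 2 * sint (fun x => sphRem (radD ν r) x ^ 2) +
        radPot p u c 6 r * sint (fun x => sphRem (fun x => ν (r • x)) x ^ 2) := by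
    rw [← sint_const_mul, ← sint_const_mul, ← sint_add (by fun_prop) (by fun_prop)]
  rw [e4, e5, e1, e2, Finset.sum_add_distrib, ← Finset.mul_sum, ← Finset.mul_sum]
  simp only [radPot]
  linarith

end Core

section CoreForm

variable {p : ℝ} {u u' u'' : ℝ → ℝ}

lemma integral_mul_eq_sphMean {ν W : E3 → ℝ} {g : ℝ → ℝ} (hν : Continuous ν) (hW : Continuous W)
    {T : ℝ} (hT : 0 ≤ T) (hs : ∀ x, T ≤ ‖x‖ → ν x = 0)
    (hg : ∀ r, 0 ≤ r → ∀ x : E3, ‖x‖ = 1 → W (r • x) = g r) :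
    ∫ x, ν x * W x = sphereArea * ∫ r in (0 : ℝ)..T, g r * r ^ 2 * sphMean fun x => ν (r • x) := by
  rw [integral_eq_intervalIntegral_sint (by fun_prop) hT fun x hx => by rw [hs x hx, zero_mul],
    ← intervalIntegral.integral_const_mul]
  refine intervalIntegral.integral_congr fun r hr => ?_
  rw [Set.uIcc_of_le hT] at hr
  have h1 : sint (fun x => ν (r • x) * W (r • x)) = g r * sint fun x => ν (r • x) := by
    rw [← sint_const_mul]
    exact sint_congr fun x hx => by rw [hg r hr.1 x hx, mul_comm]
  simp only [h1]
  rw [sint_eq_sphMean]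
  ring

lemma integral_mul_eq_sphMom {ν W : E3 → ℝ} {g : ℝ → ℝ} (j : Fin 3) (hν : Continuous ν)
    (hW : Continuous W) {T : ℝ} (hT : 0 ≤ T) (hs : ∀ x, T ≤ ‖x‖ → ν x = 0)
    (hg : ∀ r, 0 ≤ r → ∀ x : E3, ‖x‖ = 1 → W (r • x) = g r * x j) :
    ∫ x, ν x * W x =
      sphereArea / 3 * ∫ r in (0 : ℝ)..T, g r * r ^ 2 * sphMom j fun x => ν (r • x) := by
  rw [integral_eq_intervalIntegral_sint (by fun_prop) hT fun x hx => by rw [hs x hx, zero_mul],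
    ← intervalIntegral.integral_const_mul]
  refine intervalIntegral.integral_congr fun r hr => ?_
  rw [Set.uIcc_of_le hT] at hr
  have h1 : sint (fun x => ν (r • x) * W (r • x)) = g r * sint fun x => ν (r • x) * x j := by
    rw [← sint_const_mul]
    exact sint_congr fun x hx => by rw [hg r hr.1 x hx]; ring
  simp only [h1]
  rw [sint_mul_coord_eq_sphMom]
  ring

/-- Nonnegativity of the perturbed quadratic form on functions orthogonal to the negative and null
directions. -/
theorem Profile.exists_form_nonneg (h : Profile p u u' u'') :
    ∃ c T₀, 0 < c ∧ 0 < T₀ ∧ ∀ T, T₀ ≤ T → ∀ ν : E3 → ℝ, ContDiff ℝ 1 ν →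
      (∀ x, T ≤ ‖x‖ → ν x = 0) → (∀ x, T ≤ ‖x‖ → gradient ν x = 0) →
      ∫ r in (0 : ℝ)..T, pot p u r * u r * r ^ 2 * (sphMean fun x => ν (r • x)) = 0 →
      (∀ j, ∫ r in (0 : ℝ)..T, pot p u r * u' r * r ^ 2 * (sphMom j fun x => ν (r • x)) = 0) →
      0 ≤ ∫ x, (‖gradient ν x‖ ^ 2 + ν x ^ 2 - (p + c) * pot p u ‖x‖ * ν x ^ 2) := by
  obtain ⟨c, T₀, hc, hT₀, H⟩ := h.exists_radial_forms_nonneg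
  refine ⟨c, T₀, hc, hT₀, fun T hT ν hν hs hs' horth0 horth1 => ?_⟩
  have hT0 : 0 ≤ T := hT₀.le.trans hT
  have hνc := hν.continuous
  have hpot := h.pot_cont
  have hV := h.cont_radPot c
  have hpd := fun i => continuous_pd hν i
  have hg : Continuous fun x => ‖gradient ν x‖ ^ 2 := by
    simp only [norm_gradient_sq]; fun_prop
  have hνT : ∀ x : E3, ‖x‖ = 1 → ν (T • x) = 0 := fun x hx =>
    hs _ (by rw [norm_smul, hx, mul_one, Real.norm_eq_abs]; exact le_abs_self T)
  have hmean0 : sphMean (fun x => ν (T • x)) = 0 := by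
    rw [sphMean, sint_congr (G := fun _ => 0) hνT, sint_const]; simp
  have hmom0 : ∀ j, sphMom j (fun x => ν (T • x)) = 0 := fun j => by
    rw [sphMom, sint_congr (G := fun _ => 0) fun x hx => by rw [hνT x hx, zero_mul], sint_const]
    simp
  have f0 := (H T hT _ _ (hasDerivAt_sphMean_ray hν) (continuous_sphMean_radD hν) hmean0).1 
    ((intervalIntegral.integral_congr fun r _ => by ring).trans horth0)
  have f1 := fun j => (H T hT _ _ (hasDerivAt_sphMom_ray hν j) (continuous_sphMom_radD hν j)
    (hmom0 j)).2.1 ((intervalIntegral.integral_congr fun r _ => by ring).trans (horth1 j))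
  have cm : Continuous fun r => sphMean fun x => ν (r • x) :=
    continuous_iff_continuousAt.2 fun r => (hasDerivAt_sphMean_ray hν r).continuousAt
  have cm' := continuous_sphMean_radD hν
  have cj : ∀ j, Continuous fun r => sphMom j fun x => ν (r • x) := fun j =>
    continuous_iff_continuousAt.2 fun r => (hasDerivAt_sphMom_ray hν j r).continuousAt
  have cj' := continuous_sphMom_radD hν
  have cD := continuous_radD hν
  have cR : Continuous fun q : ℝ × E3 => sphRem (fun x => ν (q.1 • x)) q.2 := by
    unfold sphRem
    have := fun j => (cj j).comp continuous_fst (Y := ℝ) (X := ℝ × E3)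
    have := cm.comp continuous_fst (Y := ℝ) (X := ℝ × E3)
    fun_prop
  have cR' : Continuous fun q : ℝ × E3 => sphRem (radD ν q.1) q.2 := by
    unfold sphRem
    have := fun j => (cj' j).comp continuous_fst (Y := ℝ) (X := ℝ × E3)
    have := cm'.comp continuous_fst (Y := ℝ) (X := ℝ × E3)
    fun_prop
  have cRx : ∀ x, Continuous fun r => sphRem (radD ν r) x := fun x =>
    cR'.comp (by fun_prop : Continuous fun r : ℝ => (r, x))
  have f2 : 0 ≤ ∫ r in (0 : ℝ)..T, sint (fun x => r ^ 2 * sphRem (radD ν r) x ^ 2 +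
        radPot p u c 6 r * sphRem (fun x => ν (r • x)) x ^ 2) := by
    rw [intervalIntegral_sint_swap (H := fun q => q.1 ^ 2 * sphRem (radD ν q.1) q.2 ^ 2 +
        radPot p u c 6 q.1 * sphRem (fun x => ν (q.1 • x)) q.2 ^ 2) (by fun_prop)]
    refine sint_nonneg fun x hx => ?_
    refine (H T hT _ _ (hasDerivAt_sphRem_ray hν x) (cRx x) ?_).2.2
    simp [sphRem, hmean0, hmom0, hνT x hx]
  rw [integral_eq_intervalIntegral_sint (by fun_prop) hT0 fun x hx => by
    rw [hs x hx, hs' x hx]; simp]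
  have cS : Continuous fun r => sint (fun x => r ^ 2 * sphRem (radD ν r) x ^ 2 +
      radPot p u c 6 r * sphRem (fun x => ν (r • x)) x ^ 2) :=
    continuous_sint (H := fun q => q.1 ^ 2 * sphRem (radD ν q.1) q.2 ^ 2 +
      radPot p u c 6 q.1 * sphRem (fun x => ν (q.1 • x)) q.2 ^ 2) (by fun_prop)
  have cQ : Continuous fun r : ℝ => sint fun x => ‖gradient ν (r • x)‖ ^ 2 + ν (r • x) ^ 2 -
      (p + c) * pot p u ‖r • x‖ * ν (r • x) ^ 2 :=
    continuous_sint (H := fun q => ‖gradient ν (q.1 • q.2)‖ ^ 2 + ν (q.1 • q.2) ^ 2 -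
      (p + c) * pot p u ‖q.1 • q.2‖ * ν (q.1 • q.2) ^ 2) (by
        have := hg.comp (by fun_prop : Continuous fun q : ℝ × E3 => q.1 • q.2)
        have : Continuous fun q : ℝ × E3 => ‖gradient ν (q.1 • q.2)‖ ^ 2 := this
        fun_prop)
  have c0 : Continuous fun r => r ^ 2 * sphMean (radD ν r) ^ 2 +
      radPot p u c 0 r * (sphMean fun x => ν (r • x)) ^ 2 := by
    have := hV 0
    fun_prop
  have c1 : ∀ j, Continuous fun r => r ^ 2 * sphMom j (radD ν r) ^ 2 +
      radPot p u c 2 r * (sphMom j fun x => ν (r • x)) ^ 2 := fun j => by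
    have := hV 2
    have := cj j
    have := cj' j
    fun_prop
  have e1 := intervalIntegral.integral_mono_on hT0
    (f := fun r => sphereArea * (r ^ 2 * sphMean (radD ν r) ^ 2 +
        radPot p u c 0 r * (sphMean fun x => ν (r • x)) ^ 2) +
      sphereArea / 3 * ∑ j, (r ^ 2 * sphMom j (radD ν r) ^ 2 +
        radPot p u c 2 r * (sphMom j fun x => ν (r • x)) ^ 2) +
      sint (fun x => r ^ 2 * sphRem (radD ν r) x ^ 2 +
        radPot p u c 6 r * sphRem (fun x => ν (r • x)) x ^ 2))
    (g := fun r => r ^ 2 * sint fun x => ‖gradient ν (r • x)‖ ^ 2 + ν (r • x) ^ 2 -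
        (p + c) * pot p u ‖r • x‖ * ν (r • x) ^ 2) (μ := volume)
    (Continuous.intervalIntegrable (by fun_prop) _ _)
    (Continuous.intervalIntegrable (by fun_prop) _ _) (by
      intro r hr
      refine (form_integrand_ge (p := p) (u := u) (c := c) hν r).trans_eq ?_
      congr 1
      refine sint_congr fun x hx => ?_
      rw [norm_smul, hx, mul_one, Real.norm_of_nonneg hr.1])
  refine le_trans ?_ e1
  rw [intervalIntegral.integral_add, intervalIntegral.integral_add,
    intervalIntegral.integral_const_mul, intervalIntegral.integral_const_mul,
    intervalIntegral.integral_finsetSum]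
  · have hm := sphereArea_pos
    have f1' := Finset.sum_nonneg fun j (_ : j ∈ Finset.univ) => f1 j
    exact add_nonneg (add_nonneg (mul_nonneg hm.le f0) (mul_nonneg (by positivity) f1')) f2
  · exact fun j _ => (c1 j).intervalIntegrable _ _
  all_goals exact Continuous.intervalIntegrable (by fun_prop) _ _

end CoreForm

section IntegrationByParts

variable {f g : E3 → ℝ}

lemma contDiff_pd {n m : WithTop ℕ∞} (hf : ContDiff ℝ n f) (h : m + 1 ≤ n) (i : Fin 3) :
    ContDiff ℝ m (pd f i) :=
  (hf.fderiv_right h).clm_apply contDiff_const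

lemma hasCompactSupport_pd (hf : HasCompactSupport f) (i : Fin 3) : HasCompactSupport (pd f i) :=
  hf.fderiv_apply ℝ _

lemma pd_comm (hf : ContDiff ℝ 2 f) (i j : Fin 3) : pd (pd f i) j = pd (pd f j) i := by
  funext x
  have hs : IsSymmSndFDerivAt ℝ f x := hf.contDiffAt.isSymmSndFDerivAt (by simp)
  have hd : DifferentiableAt ℝ (fderiv ℝ f) x :=
    (hf.fderiv_right (m := 1) (by norm_num)).differentiable (by norm_num) x
  have h : ∀ a b : Fin 3, pd (pd f a) b x =
      fderiv ℝ (fderiv ℝ f) x (EuclideanSpace.single b 1) (EuclideanSpace.single a 1) := by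
    intro a b
    have := (hd.hasFDerivAt.clm_apply
      (hasFDerivAt_const (EuclideanSpace.single a (1 : ℝ) : E3) x)).fderiv
    rw [pd, show pd f a = fun y => fderiv ℝ f y (EuclideanSpace.single a 1) from rfl, this]
    simp
  rw [h, h, hs.eq]

lemma integral_mul_pd (hf : ContDiff ℝ 1 f) (hfs : HasCompactSupport f) (hg : ContDiff ℝ 1 g)
    (i : Fin 3) : ∫ x, f x * pd g i x = -∫ x, pd f i x * g x := by
  have := hf.continuous
  have := hg.continuous
  have := continuous_pd hf i
  have := continuous_pd hg i
  exact integral_mul_fderiv_eq_neg_fderiv_mul_of_integrable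
    (Continuous.integrable_of_hasCompactSupport (by fun_prop) (hasCompactSupport_pd hfs
      i).mul_right)
    (Continuous.integrable_of_hasCompactSupport (by fun_prop) hfs.mul_right)
    (Continuous.integrable_of_hasCompactSupport (by fun_prop) hfs.mul_right)
    (fun x _ => hf.differentiable (by norm_num) x) (fun x _ => hg.differentiable (by norm_num) x)

lemma h1i_eq (hf : ContDiff ℝ 1 f) (hfs : HasCompactSupport f) (hg : ContDiff ℝ 1 g) :
    h1i f g = (∑ i, ∫ x, pd f i x * pd g i x) + ∫ x, f x * g x := by
  have := hf.continuous
  have := hg.continuous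
  have := continuous_pd hf
  have := continuous_pd hg
  have hi : ∀ i, Integrable fun x => pd f i x * pd g i x := fun i =>
    Continuous.integrable_of_hasCompactSupport (by fun_prop) (hasCompactSupport_pd hfs i).mul_right
  have h0 : Integrable fun x => f x * g x :=
    Continuous.integrable_of_hasCompactSupport (by fun_prop) hfs.mul_right
  rw [← integral_finsetSum _ fun i _ => hi i,
    ← integral_add (integrable_finsetSum _ fun i _ => hi i) h0, h1i]
  congr 1
  funext x
  rw [PiLp.inner_apply]
  simp [gradient_apply, mul_comm]

lemma h1i_eq_integral_lap (hf : ContDiff ℝ 1 f) (hfs : HasCompactSupport f) (hg : ContDiff ℝ 2 g) :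
    h1i f g = ∫ x, f x * (-lap g x + g x) := by
  have hg1 : ContDiff ℝ 1 g := hg.of_le (by norm_num)
  have hp := fun i => contDiff_pd hg (m := 1) (by norm_num) i
  have := hf.continuous
  have := hg.continuous
  have hpp := fun i => continuous_pd (hp i) i
  have hi : ∀ i, Integrable fun x => f x * pd (pd g i) i x := fun i =>
    Continuous.integrable_of_hasCompactSupport (by fun_prop) hfs.mul_right
  have h0 : Integrable fun x => f x * g x :=
    Continuous.integrable_of_hasCompactSupport (by fun_prop) hfs.mul_right
  have h1 : ∀ x, f x * (-lap g x + g x) = -(∑ i, f x * pd (pd g i) i x) + f x * g x := by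
    intro x; rw [lap, ← Finset.mul_sum]; ring
  have h2 : Integrable fun x => -(∑ i, f x * pd (pd g i) i x) :=
    (integrable_finsetSum _ fun i _ => hi i).neg
  rw [h1i_eq hf hfs hg1]
  simp only [h1]
  rw [integral_add h2 h0, integral_neg,
    integral_finsetSum _ fun i _ => hi i, ← Finset.sum_neg_distrib]
  congr 1
  refine Finset.sum_congr rfl fun i _ => ?_
  rw [integral_mul_pd hf hfs (hp i), neg_neg]

lemma h1i_pd_right (hf : ContDiff ℝ 2 f) (hfs : HasCompactSupport f) (hg : ContDiff ℝ 2 g)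
    (j : Fin 3) : h1i f (pd g j) = -h1i (pd f j) g := by
  have hf1 : ContDiff ℝ 1 f := hf.of_le (by norm_num)
  have hg1 : ContDiff ℝ 1 g := hg.of_le (by norm_num)
  have hpg := fun i => contDiff_pd hg (m := 1) (by norm_num) i
  have hpf := fun i => contDiff_pd hf (m := 1) (by norm_num) i
  rw [h1i_eq hf1 hfs (hpg j), h1i_eq (hpf j) (hasCompactSupport_pd hfs j) hg1, neg_add,
    ← Finset.sum_neg_distrib]
  congr 1
  · refine Finset.sum_congr rfl fun i _ => ?_
    rw [pd_comm hg j i, integral_mul_pd (hpf i) (hasCompactSupport_pd hfs i) (hpg i), pd_comm hf i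
      j]
  · exact integral_mul_pd hf1 hfs hg1 j

end IntegrationByParts

section RadialFunctions

lemma hasFDerivAt_comp_norm {g : ℝ → ℝ} {g' : ℝ} {x : E3} (hx : x ≠ 0)
    (hg : HasDerivAt g g' ‖x‖) :
    HasFDerivAt (fun y : E3 => g ‖y‖) ((g' / ‖x‖) • innerSL ℝ x) x := by
  have hn : ‖x‖ ≠ 0 := norm_ne_zero_iff.2 hx
  have h1 : HasFDerivAt (fun y : E3 => √(‖y‖ ^ 2)) ((1 / (2 * √(‖x‖ ^ 2))) • (2 • innerSL ℝ x)) x :=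
    (hasStrictFDerivAt_norm_sq x).hasFDerivAt.sqrt (by positivity)
  simp only [sqrt_sq (norm_nonneg _)] at h1
  refine (hg.comp_hasFDerivAt x h1).congr_fderiv ?_
  ext y
  simp
  field_simp

lemma pd_comp_norm {g : ℝ → ℝ} {g' : ℝ} {x : E3} (hx : x ≠ 0) (hg : HasDerivAt g g' ‖x‖)
    (i : Fin 3) : pd (fun y => g ‖y‖) i x = g' / ‖x‖ * x i := by
  rw [pd, (hasFDerivAt_comp_norm hx hg).fderiv]
  simp [EuclideanSpace.inner_single_right]

end RadialFunctions

section RadialSolution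

/-- Restriction of a function on `ℝ³` to a line through the origin. -/
def axisFun (U : E3 → ℝ) (r : ℝ) : ℝ := U (r • EuclideanSpace.single 0 1)

variable {U : E3 → ℝ}

lemma eq_axisFun_norm (hUrad : ∃ Ub : ℝ → ℝ, ∀ x, U x = Ub ‖x‖) (x : E3) :
    U x = axisFun U ‖x‖ := by
  obtain ⟨Ub, hUb⟩ := hUrad
  simp [axisFun, hUb, norm_smul]

lemma contDiff_axisFun (hU : ContDiff ℝ 2 U) : ContDiff ℝ 2 (axisFun U) :=
  hU.comp (contDiff_id.smul contDiff_const)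

lemma hasDerivAt_axisFun (hU : ContDiff ℝ 2 U) (r : ℝ) :
    HasDerivAt (axisFun U) (deriv (axisFun U) r) r :=
  ((contDiff_axisFun hU).differentiable (by norm_num) r).hasDerivAt

lemma contDiff_deriv_axisFun (hU : ContDiff ℝ 2 U) : ContDiff ℝ 1 (deriv (axisFun U)) :=
  ((contDiff_succ_iff_deriv (n := 1)).1 (contDiff_axisFun hU)).2.2

lemma hasDerivAt_deriv_axisFun (hU : ContDiff ℝ 2 U) (r : ℝ) :
    HasDerivAt (deriv (axisFun U)) (deriv (deriv (axisFun U)) r) r :=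
  ((contDiff_deriv_axisFun hU).differentiable (by norm_num) r).hasDerivAt

lemma deriv_axisFun_zero (hUrad : ∃ Ub : ℝ → ℝ, ∀ x, U x = Ub ‖x‖) :
    deriv (axisFun U) 0 = 0 := by
  have h : (fun r => axisFun U (-r)) = axisFun U := by
    obtain ⟨Ub, hUb⟩ := hUrad
    funext r
    simp [axisFun, hUb, norm_smul]
  have h2 := deriv_comp_neg (axisFun U) 0
  rw [h, neg_zero] at h2
  linarith

lemma pd_radial (hU : ContDiff ℝ 2 U) (hUrad : ∃ Ub : ℝ → ℝ, ∀ x, U x = Ub ‖x‖) {x : E3}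
    (hx : x ≠ 0) (i : Fin 3) : pd U i x = deriv (axisFun U) ‖x‖ / ‖x‖ * x i := by
  have h : U = fun y => axisFun U ‖y‖ := funext (eq_axisFun_norm hUrad)
  conv_lhs => rw [h]
  exact pd_comp_norm hx (hasDerivAt_axisFun hU _) i

lemma pd_radial_smul (hU : ContDiff ℝ 2 U) (hUrad : ∃ Ub : ℝ → ℝ, ∀ x, U x = Ub ‖x‖) {r : ℝ}
    (hr : 0 ≤ r) {x : E3} (hx : ‖x‖ = 1) (i : Fin 3) :
    pd U i (r • x) = deriv (axisFun U) r * x i := by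
  have hpos : ∀ r : ℝ, 0 < r → pd U i (r • x) = deriv (axisFun U) r * x i := by
    intro r hr
    have hn : ‖r • x‖ = r := by rw [norm_smul, hx, mul_one, Real.norm_of_nonneg hr.le]
    have hne : r • x ≠ 0 := by rw [← norm_ne_zero_iff, hn]; exact hr.ne'
    rw [pd_radial hU hUrad hne, hn, PiLp.smul_apply, smul_eq_mul]
    field_simp
  have c1 : Continuous fun r : ℝ => pd U i (r • x) :=
    (continuous_pd (hU.of_le (by norm_num)) i).comp (by fun_prop)
  have c2 : Continuous fun r : ℝ => deriv (axisFun U) r * x i :=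
    (contDiff_deriv_axisFun hU).continuous.mul continuous_const
  have h := closure_minimal (s := Set.Ioi (0 : ℝ)) (fun r hr => hpos r hr) (isClosed_eq c1 c2)
  rw [closure_Ioi] at h
  exact h hr

lemma lap_radial (hU : ContDiff ℝ 2 U) (hUrad : ∃ Ub : ℝ → ℝ, ∀ x, U x = Ub ‖x‖) {x : E3}
    (hx : x ≠ 0) :
    lap U x = deriv (deriv (axisFun U)) ‖x‖ + 2 * deriv (axisFun U) ‖x‖ / ‖x‖ := by
  have hn : ‖x‖ ≠ 0 := norm_ne_zero_iff.2 hx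
  set v := deriv (axisFun U)
  have hw : HasDerivAt (fun s => v s / s) ((deriv v ‖x‖ * ‖x‖ - v ‖x‖ * 1) / ‖x‖ ^ 2) ‖x‖ :=
    (hasDerivAt_deriv_axisFun hU _).div (hasDerivAt_id _) hn
  have h : ∀ i, pd (pd U i) i x =
      (deriv v ‖x‖ * ‖x‖ - v ‖x‖ * 1) / ‖x‖ ^ 2 / ‖x‖ * x i ^ 2 + v ‖x‖ / ‖x‖ := by
    intro i
    have he : pd U i =ᶠ[𝓝 x] fun y => v ‖y‖ / ‖y‖ * y i := by
      filter_upwards [isOpen_ne.mem_nhds hx] with y hy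
      exact pd_radial hU hUrad hy i
    have h1 := hasFDerivAt_comp_norm hx hw
    have h2 : HasFDerivAt (fun y : E3 => y i) (EuclideanSpace.proj (𝕜 := ℝ) i : E3 →L[ℝ] ℝ) x :=
      (EuclideanSpace.proj (𝕜 := ℝ) i : E3 →L[ℝ] ℝ).hasFDerivAt
    rw [pd, he.fderiv_eq, (h1.fun_mul h2).fderiv]
    simp [EuclideanSpace.inner_single_right]
    ring
  have hs := EuclideanSpace.real_norm_sq_eq x
  rw [lap, Finset.sum_congr rfl fun i _ => h i, Finset.sum_add_distrib, ← Finset.mul_sum, ← hs]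
  simp
  field_simp
  ring

lemma profile_axisFun {p : ℝ} (hp1 : 1 < p) (hp5 : p < 5) (hU : ContDiff ℝ 2 U)
    (hUpos : ∀ x, 0 < U x) (hUrad : ∃ Ub : ℝ → ℝ, ∀ x, U x = Ub ‖x‖)
    (hUeq : ∀ x, -lap U x + U x = U x ^ p) (hUlim : Tendsto U (cocompact E3) (𝓝 0)) :
    Profile p (axisFun U) (deriv (axisFun U)) (deriv (deriv (axisFun U))) where
  one_lt := hp1
  lt_five := hp5
  hasDeriv := hasDerivAt_axisFun hU
  hasDeriv' := hasDerivAt_deriv_axisFun hU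
  cont'' := (contDiff_deriv_axisFun hU).continuous_deriv (by norm_num)
  pos := fun r => hUpos _
  deriv_zero := deriv_axisFun_zero hUrad
  ode := fun r hr => by
    have hn : ‖r • (EuclideanSpace.single 0 1 : E3)‖ = r := by
      simp [norm_smul, abs_of_pos hr]
    have hne : r • (EuclideanSpace.single 0 1 : E3) ≠ 0 := by
      rw [← norm_ne_zero_iff, hn]; exact hr.ne'
    have h := hUeq (r • EuclideanSpace.single 0 1)
    rw [lap_radial hU hUrad hne, hn] at h
    change -_ + axisFun U r = axisFun U r ^ p at h
    have hr' := hr.ne'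
    rw [← h]
    field_simp
    ring
  lim := by
    refine hUlim.comp ?_
    rw [← Metric.cobounded_eq_cocompact, ← tendsto_norm_atTop_iff_cobounded]
    simpa [norm_smul] using tendsto_abs_atTop_atTop

end RadialSolution

section Coercivity

variable {p : ℝ} {U ν : E3 → ℝ}

lemma integrable_sq_of_hasCompactSupport (hν : Continuous ν) (hνs : HasCompactSupport ν) :
    Integrable fun x => ν x ^ 2 := by
  simp only [sq]
  exact (hν.mul hν).integrable_of_hasCompactSupport hνs.mul_right

lemma axisFun_smul (hUrad : ∃ Ub : ℝ → ℝ, ∀ x, U x = Ub ‖x‖) {r : ℝ} (hr : 0 ≤ r) {x : E3}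
    (hx : ‖x‖ = 1) : U (r • x) = axisFun U r := by
  rw [eq_axisFun_norm hUrad, norm_smul, hx, mul_one, Real.norm_of_nonneg hr]

lemma pd_rpow (hU : ContDiff ℝ 2 U) (hUpos : ∀ x, 0 < U x) (j : Fin 3) (x : E3) :
    pd (fun y => U y ^ p) j x = p * (U x ^ (p - 1) * pd U j x) := by
  have hd : HasFDerivAt U (fderiv ℝ U x) x := (hU.differentiable (by norm_num) x).hasFDerivAt
  rw [pd, (hd.rpow_const (Or.inl (hUpos x).ne')).fderiv]
  simp [pd, mul_assoc]

lemma integral_mul_rpow_eq_zero (hU : ContDiff ℝ 2 U) (hUeq : ∀ x, -lap U x + U x = U x ^ p)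
    (hν : ContDiff ℝ 1 ν) (hνs : HasCompactSupport ν) (horth : h1i ν U = 0) :
    ∫ x, ν x * U x ^ p = 0 := by
  rw [h1i_eq_integral_lap hν hνs hU] at horth
  simpa only [hUeq] using horth

lemma integral_mul_rpow_mul_pd_eq_zero (hp : 1 < p) (hU : ContDiff ℝ 2 U) (hUpos : ∀ x, 0 < U x)
    (hUeq : ∀ x, -lap U x + U x = U x ^ p) (hν : ContDiff ℝ 2 ν) (hνs : HasCompactSupport ν)
    (j : Fin 3) (horth : h1i ν (pd U j) = 0) : ∫ x, ν x * (U x ^ (p - 1) * pd U j x) = 0 := by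
  have h0 : ∫ x, pd ν j x * U x ^ p = 0 := by
    refine integral_mul_rpow_eq_zero hU hUeq (contDiff_pd hν (by norm_num) j)
      (hasCompactSupport_pd hνs j) ?_
    rw [h1i_pd_right hν hνs hU] at horth
    exact neg_eq_zero.1 horth
  have hg : ContDiff ℝ 1 fun x => U x ^ p :=
    (hU.of_le (by norm_num)).rpow_const_of_ne fun x => (hUpos x).ne'
  have h1 := integral_mul_pd (hν.of_le (by norm_num)) hνs hg j
  rw [h0, neg_zero] at h1
  simp only [pd_rpow hU hUpos, mul_left_comm _ p, integral_const_mul] at h1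
  exact (mul_eq_zero.1 h1).resolve_left (by linarith)

end Coercivity

/-- coercivity of `Q` on the orthogonal complement of `U` and its partial
derivatives. -/
theorem quadratic_form_coercive (p : ℝ) (hp1 : 1 < p) (hp5 : p < 5)
    (U : E3 → ℝ) (hUsmooth : ContDiff ℝ 2 U) (hUpos : ∀ x, 0 < U x)
    (hUrad : ∃ Ub : ℝ → ℝ, ∀ x, U x = Ub ‖x‖)
    (hUeq : ∀ x, -lap U x + U x = U x ^ p)
    (hUlim : Tendsto U (cocompact E3) (𝓝 0))
    (hUL2 : Integrable (fun x => (U x) ^ 2))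
    (hUgradL2 : Integrable (fun x => ‖gradient U x‖ ^ 2)) :
    ∃ C > 0, ∀ ν : E3 → ℝ, ContDiff ℝ (⊤ : ℕ∞) ν → HasCompactSupport ν →
      h1i ν U = 0 → (∀ j : Fin 3, h1i ν (pd U j) = 0) →
      C * ∫ x : E3, (‖gradient ν x‖ ^ 2 + (ν x) ^ 2) ≤
        ∫ x : E3, (‖gradient ν x‖ ^ 2 + (ν x) ^ 2 - p * U x ^ (p - 1) * (ν x) ^ 2) := by
  have h := profile_axisFun hp1 hp5 hUsmooth hUpos hUrad hUeq hUlim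
  obtain ⟨c, T₀, hc, hT₀, hform⟩ := h.exists_form_nonneg
  have hpc : 0 < p + c := by linarith
  refine ⟨c / (p + c), div_pos hc hpc, fun ν hν hνs horth horth' => ?_⟩
  have hν2 : ContDiff ℝ 2 ν := contDiff_infty.1 hν 2
  have hν1 : ContDiff ℝ 1 ν := hν.of_le (by exact_mod_cast le_top)
  obtain ⟨R, hR⟩ := hνs.isBounded.subset_closedBall 0
  set T := max T₀ (R + 1)
  have hT : 0 ≤ T := hT₀.le.trans (le_max_left _ _)
  have hout : ∀ x : E3, T ≤ ‖x‖ → x ∉ tsupport ν := fun x hx hmem => by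
    have h1 := mem_closedBall_zero_iff.1 (hR hmem)
    have h2 : R + 1 ≤ T := le_max_right _ _
    linarith
  have hνT : ∀ x : E3, T ≤ ‖x‖ → ν x = 0 := fun x hx => image_eq_zero_of_notMem_tsupport (hout x hx)
  have hgT : ∀ x : E3, T ≤ ‖x‖ → gradient ν x = 0 := fun x hx => by
    rw [gradient, fderiv_of_notMem_tsupport ℝ (hout x hx), map_zero]
  have hUc := hUsmooth.continuous
  have hpow : ∀ q : ℝ, Continuous fun x => U x ^ q := fun q =>
    hUc.rpow_const fun x => Or.inl (hUpos x).ne'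
  have hmean : ∫ r in 0..T, pot p (axisFun U) r * axisFun U r * r ^ 2 *
      sphMean (fun x => ν (r • x)) = 0 := by
    have h1 := integral_mul_rpow_eq_zero hUsmooth hUeq hν1 hνs horth
    rw [integral_mul_eq_sphMean hν.continuous (hpow p) hT hνT fun r hr x hx => by
      rw [axisFun_smul hUrad hr hx, h.rpow_eq]] at h1
    exact (mul_eq_zero.1 h1).resolve_left sphereArea_pos.ne'
  have hmom : ∀ j, ∫ r in 0..T, pot p (axisFun U) r * deriv (axisFun U) r * r ^ 2 *
      sphMom j (fun x => ν (r • x)) = 0 := by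
    intro j
    have h1 := integral_mul_rpow_mul_pd_eq_zero hp1 hUsmooth hUpos hUeq hν2 hνs j (horth' j)
    rw [integral_mul_eq_sphMom (W := fun x => U x ^ (p - 1) * pd U j x) j hν.continuous
      ((hpow (p - 1)).mul (continuous_pd (hUsmooth.of_le (by norm_num)) j)) hT hνT
      (g := fun r => pot p (axisFun U) r * deriv (axisFun U) r) fun r hr x hx => by
      rw [axisFun_smul hUrad hr hx, pd_radial_smul hUsmooth hUrad hr hx, pot, mul_assoc]] at h1
    exact (mul_eq_zero.1 h1).resolve_left (div_pos sphereArea_pos three_pos).ne'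
  have hpos := hform T (le_max_left _ _) ν hν1 hνT hgT hmean hmom
  have hpot : ∀ x, pot p (axisFun U) ‖x‖ = U x ^ (p - 1) := fun x => by
    rw [pot, ← eq_axisFun_norm hUrad]
  have hνc := hν.continuous
  have hA : Integrable fun x => ‖gradient ν x‖ ^ 2 + ν x ^ 2 := by
    have hpd := continuous_pd hν1
    simp only [norm_gradient_sq]
    exact (integrable_finsetSum _ fun i _ =>
      integrable_sq_of_hasCompactSupport (hpd i) (hasCompactSupport_pd hνs i)).add
      (integrable_sq_of_hasCompactSupport hνc hνs)
  have hB : Integrable fun x => U x ^ (p - 1) * ν x ^ 2 := by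
    have := hpow (p - 1)
    simp only [sq]
    exact Continuous.integrable_of_hasCompactSupport (by fun_prop) hνs.mul_right.mul_left
  simp only [hpot, mul_assoc] at hpos ⊢
  rw [integral_sub hA (hB.const_mul _), integral_const_mul] at hpos ⊢
  rw [div_mul_eq_mul_div, div_le_iff₀ hpc]
  nlinarith
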